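/- arXiv:1606.06346 — 13 statements merged into one kernel-verified Lean document; each statement's English description precedes it below -/
import Mathlib

section
/- The function ω is continuous on ℝ × [0,∞). That is: with k₁(x,r) = ∫_b^c μ(t)β(t)/[(t−x)² + r²]^{ν(t)/2} dt and k₂(x,r) = ∫_b^c β(t)/[(t−x)² + r²]^{ν(t)/2} dt, the function ω defined by ω(x,r) = k₁(x,r)/k₂(x,r) when r > 0 or x ∉ [b,c], and ω(x,0) = μ(x) when x ∈ [b,c], is continuous at every point of ℝ × [0,∞). -/
open MeasureTheory Set Filter

theorem rpow_le_rpow_of_base_le_one {d q s M : ℝ} (hd : 0 < d) (hd1 : d ≤ 1) (hq : d ≤ q)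
    (hs : 0 ≤ s) (hsM : s ≤ M) : d ^ M ≤ q ^ s :=
  (Real.rpow_le_rpow_of_exponent_ge hd hd1 hsM).trans (Real.rpow_le_rpow hd.le hq hs)

theorem norm_div_rpow_le {g d q s M : ℝ} (hd : 0 < d) (hd1 : d ≤ 1) (hq : d ≤ q)
    (hs : 0 ≤ s) (hsM : s ≤ M) : ‖g / q ^ s‖ ≤ |g| / d ^ M := by
  have h := rpow_le_rpow_of_base_le_one hd hd1 hq hs hsM
  have h0 : 0 < d ^ M := Real.rpow_pos_of_pos hd M
  rw [Real.norm_eq_abs, abs_div, abs_of_pos (h0.trans_le h)]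
  gcongr

theorem aemeasurable_kernel {m : Measure ℝ} {g ν : ℝ → ℝ}
    (hg : AEMeasurable g m) (hν : AEMeasurable ν m) (p : ℝ × ℝ) :
    AEMeasurable (fun t => g t / (((t - p.1) ^ 2 + p.2 ^ 2) ^ (ν t / 2))) m := by
  have h : AEMeasurable (fun t : ℝ => (t - p.1) ^ 2 + p.2 ^ 2) m := by fun_prop
  exact hg.div (h.pow (hν.div_const 2))

theorem integrable_kernel {m : Measure ℝ} {g ν : ℝ → ℝ} {M d : ℝ} {p : ℝ × ℝ}
    (hg : Integrable g m) (hν : AEMeasurable ν m) (hν0 : ∀ᵐ t ∂m, 1 < ν t)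
    (hνM : ∀ᵐ t ∂m, ν t ≤ M) (hd : 0 < d) (hd1 : d ≤ 1)
    (hq : ∀ᵐ t ∂m, d ≤ (t - p.1) ^ 2 + p.2 ^ 2) :
    Integrable (fun t => g t / (((t - p.1) ^ 2 + p.2 ^ 2) ^ (ν t / 2))) m := by
  refine (hg.abs.div_const (d ^ (M / 2))).mono'
    (aemeasurable_kernel hg.aemeasurable hν p).aestronglyMeasurable ?_
  filter_upwards [hν0, hνM, hq] with t h0 hM h
  exact norm_div_rpow_le hd hd1 h (by linarith) (by linarith)

theorem continuousAt_integral_kernel {m : Measure ℝ} {g ν : ℝ → ℝ} {M d : ℝ} {p : ℝ × ℝ}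
    (hg : Integrable g m) (hν : AEMeasurable ν m) (hν0 : ∀ᵐ t ∂m, 1 < ν t)
    (hνM : ∀ᵐ t ∂m, ν t ≤ M) (hd : 0 < d) (hd1 : d ≤ 1)
    (hq : ∀ᶠ z : ℝ × ℝ in nhds p, ∀ᵐ t ∂m, d ≤ (t - z.1) ^ 2 + z.2 ^ 2) :
    ContinuousAt
      (fun z : ℝ × ℝ => ∫ t, g t / (((t - z.1) ^ 2 + z.2 ^ 2) ^ (ν t / 2)) ∂m) p := by
  refine continuousAt_of_dominated (bound := fun t => |g t| / d ^ (M / 2)) ?_ ?_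
    (hg.abs.div_const _) ?_
  · exact .of_forall fun z =>
      (aemeasurable_kernel hg.aemeasurable hν z).aestronglyMeasurable
  · filter_upwards [hq] with z hz
    filter_upwards [hν0, hνM, hz] with t h0 hM h
    exact norm_div_rpow_le hd hd1 h (by linarith) (by linarith)
  · filter_upwards [hq.self_of_nhds] with t ht
    have hpos := hd.trans_le ht
    refine ContinuousAt.div continuousAt_const (ContinuousAt.rpow_const ?_ (.inl hpos.ne'))
      (Real.rpow_pos_of_pos hpos _).ne'
    fun_prop

theorem eventually_lt_lintegral_kernel {m : Measure ℝ} [NullSingletonClass m] {g ν : ℝ → ℝ} {x : ℝ}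
    (hg : AEMeasurable g m) (hν : AEMeasurable ν m)
    (htop : ∫⁻ t, ENNReal.ofReal (g t * |t - x| ^ (-(ν t))) ∂m = ⊤) {N : ENNReal} (hN : N < ⊤) :
    ∀ᶠ p : ℝ × ℝ in nhds (x, 0),
      N < ∫⁻ t, ENNReal.ofReal (g t / (((t - p.1) ^ 2 + p.2 ^ 2) ^ (ν t / 2))) ∂m := by
  refine eventually_lt_of_lt_liminf (lt_of_lt_of_le ?_ (lintegral_liminf_le' fun p =>
    (aemeasurable_kernel hg hν p).ennreal_ofReal))
  refine hN.trans_eq (htop.symm.trans (lintegral_congr_ae ?_))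
  filter_upwards [compl_mem_ae_iff.2 (measure_singleton x)] with t ht
  have htx : t - x ≠ 0 := sub_ne_zero.2 ht
  have hpos : 0 < (t - x) ^ 2 + (0 : ℝ) ^ 2 := by positivity
  have hval : g t * |t - x| ^ (-(ν t)) = g t / (((t - x) ^ 2 + 0 ^ 2) ^ (ν t / 2)) := by
    rw [Real.rpow_neg (abs_nonneg _), div_eq_mul_inv, zero_pow two_ne_zero, add_zero, ← sq_abs,
      ← Real.rpow_natCast, ← Real.rpow_mul (abs_nonneg _)]
    congr 3
    push_cast
    ring
  have hcont : ContinuousAt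
      (fun p : ℝ × ℝ => g t / (((t - p.1) ^ 2 + p.2 ^ 2) ^ (ν t / 2))) (x, 0) := by
    refine ContinuousAt.div continuousAt_const (ContinuousAt.rpow_const ?_ (.inl hpos.ne'))
      (Real.rpow_pos_of_pos hpos _).ne'
    fun_prop
  rw [hval]
  exact ((ENNReal.continuous_ofReal.continuousAt.comp hcont).tendsto.liminf_eq).symm

theorem lintegral_rpow_neg_eq_top {S : Set ℝ} {β ν : ℝ → ℝ} {u v x k : ℝ}
    (huv : u < v) (hx : x ∈ Icc u v) (hsub : Ioc u v ⊆ S) (hle : v - u ≤ 1) (hk : 0 < k)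
    (hβ : ∀ t ∈ Ioc u v, k ≤ β t) (hν : ∀ t ∈ Ioc u v, 1 ≤ ν t) :
    ∫⁻ t in S, ENNReal.ofReal (β t * |t - x| ^ (-(ν t))) = ⊤ := by
  by_contra hne
  have hnot : ¬ IntervalIntegrable (fun t => (t - x)⁻¹) volume u v := by
    rw [intervalIntegrable_sub_inv_iff, uIcc_of_le huv.le]
    simp [huv.ne, hx.1, hx.2]
  apply hnot
  rw [intervalIntegrable_iff_integrableOn_Ioc_of_le huv.le]
  have hmul : IntegrableOn (fun t => k * (t - x)⁻¹) (Ioc u v) := by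
    refine ⟨by fun_prop, ?_⟩
    rw [hasFiniteIntegral_iff_norm]
    refine lt_of_le_of_lt (le_trans ?_ (lintegral_mono_set hsub)) (lt_top_iff_ne_top.2 hne)
    refine lintegral_mono_ae ?_
    filter_upwards [ae_restrict_mem measurableSet_Ioc,
      ae_restrict_of_ae (compl_mem_ae_iff.2 (measure_singleton x))] with t ht htx
    apply ENNReal.ofReal_le_ofReal
    have hpos : 0 < |t - x| := abs_pos.2 (sub_ne_zero.2 htx)
    have h1 : |t - x| ≤ 1 := abs_le.2 ⟨by linarith [ht.1, hx.2], by linarith [ht.2, hx.1]⟩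
    rw [norm_mul, Real.norm_of_nonneg hk.le, norm_inv, Real.norm_eq_abs, ← Real.rpow_neg_one]
    exact mul_le_mul (hβ t ht)
      (Real.rpow_le_rpow_of_exponent_ge hpos h1 (by linarith [hν t ht]))
      (Real.rpow_nonneg hpos.le _) (hk.le.trans (hβ t ht))
  simpa [IntegrableOn, hk.ne'] using hmul.const_mul k⁻¹

theorem exists_eventually_le_sq_add_sq {K : Set ℝ} (hK : IsCompact K) {p : ℝ × ℝ}
    (hp : ¬ (p.2 = 0 ∧ p.1 ∈ K)) :
    ∃ d : ℝ, 0 < d ∧ d ≤ 1 ∧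
      ∀ᶠ z : ℝ × ℝ in nhds p, ∀ t ∈ K, d ≤ (t - z.1) ^ 2 + z.2 ^ 2 := by
  have hpos : ∀ t ∈ K, 0 < (t - p.1) ^ 2 + p.2 ^ 2 := by
    intro t ht
    by_cases h2 : p.2 = 0
    · have : t - p.1 ≠ 0 := sub_ne_zero.2 fun h => hp ⟨h2, h ▸ ht⟩
      positivity
    · positivity
  obtain ⟨e, he, hle⟩ : ∃ e : ℝ, 0 < e ∧ ∀ t ∈ K, e ≤ (t - p.1) ^ 2 + p.2 ^ 2 := by
    rcases K.eq_empty_or_nonempty with rfl | hne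
    · exact ⟨1, one_pos, by simp⟩
    · obtain ⟨t, ht, hmin⟩ := hK.exists_isMinOn hne
        (f := fun t => (t - p.1) ^ 2 + p.2 ^ 2) (by fun_prop)
      exact ⟨_, hpos t ht, fun s hs => hmin hs⟩
  refine ⟨min (e / 2) 1, by positivity, min_le_right _ _, ?_⟩
  refine hK.eventually_forall_of_forall_eventually fun t ht => ?_
  have hcont : ContinuousAt (fun z : (ℝ × ℝ) × ℝ => (z.2 - z.1.1) ^ 2 + z.1.2 ^ 2) (p, t) := by
    fun_prop
  filter_upwards [hcont.eventually_const_lt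
    (show e / 2 < (t - p.1) ^ 2 + p.2 ^ 2 by linarith [hle t ht])] with z hz
  exact (min_le_left _ _).trans hz.le

theorem abs_integral_kernel_sub_le {m : Measure ℝ} {μ β ν : ℝ → ℝ} {p : ℝ × ℝ} {x a ε δ M C : ℝ}
    (hβ : Integrable β m) (hν0 : ∀ᵐ t ∂m, 1 < ν t)
    (hνM : ∀ᵐ t ∂m, ν t ≤ M) (hβ0 : ∀ᵐ t ∂m, 0 ≤ β t)
    (hkβ : Integrable (fun t => β t / (((t - p.1) ^ 2 + p.2 ^ 2) ^ (ν t / 2))) m)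
    (hkμ : Integrable (fun t => μ t * β t / (((t - p.1) ^ 2 + p.2 ^ 2) ^ (ν t / 2))) m)
    (hε : 0 ≤ ε) (hC : 0 ≤ C) (hδ : 0 < δ) (hδ1 : δ ≤ 1)
    (hnear : ∀ᵐ t ∂m, |t - x| < δ → |μ t - a| ≤ ε) (hfar : ∀ᵐ t ∂m, |μ t - a| ≤ C)
    (hp : |p.1 - x| ≤ δ / 2) :
    |(∫ t, μ t * β t / (((t - p.1) ^ 2 + p.2 ^ 2) ^ (ν t / 2)) ∂m) -
        a * ∫ t, β t / (((t - p.1) ^ 2 + p.2 ^ 2) ^ (ν t / 2)) ∂m| ≤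
      ε * (∫ t, β t / (((t - p.1) ^ 2 + p.2 ^ 2) ^ (ν t / 2)) ∂m) +
        C * ((∫ t, β t ∂m) / ((δ / 2) ^ 2) ^ (M / 2)) := by
  rw [← integral_const_mul, ← integral_sub hkμ (hkβ.const_mul a), ← integral_const_mul,
    ← integral_div, ← integral_const_mul,
    ← integral_add (hkβ.const_mul ε) ((hβ.div_const _).const_mul C), ← Real.norm_eq_abs]
  refine norm_integral_le_of_norm_le ((hkβ.const_mul ε).add ((hβ.div_const _).const_mul C)) ?_
  filter_upwards [hν0, hνM, hβ0, hnear, hfar] with t h1 hM h0 hn hf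
  have hk : 0 ≤ β t / (((t - p.1) ^ 2 + p.2 ^ 2) ^ (ν t / 2)) := by positivity
  have hb : 0 ≤ β t / ((δ / 2) ^ 2) ^ (M / 2) := by positivity
  have heq : μ t * β t / (((t - p.1) ^ 2 + p.2 ^ 2) ^ (ν t / 2)) -
      a * (β t / (((t - p.1) ^ 2 + p.2 ^ 2) ^ (ν t / 2))) =
      (μ t - a) * (β t / (((t - p.1) ^ 2 + p.2 ^ 2) ^ (ν t / 2))) := by ring
  rw [heq, norm_mul, Real.norm_eq_abs, Real.norm_of_nonneg hk]
  by_cases ht : |t - x| < δ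
  · exact (mul_le_mul_of_nonneg_right (hn ht) hk).trans (le_add_of_nonneg_right (by positivity))
  · have hdist : δ / 2 ≤ |t - p.1| := by
      have := abs_sub_le t p.1 x
      linarith [not_lt.1 ht]
    have hq : (δ / 2) ^ 2 ≤ (t - p.1) ^ 2 + p.2 ^ 2 := by
      rw [← sq_abs (t - p.1)]
      exact (pow_le_pow_left₀ (by positivity) hdist 2).trans
        (le_add_of_nonneg_right (sq_nonneg _))
    have hkle := norm_div_rpow_le (g := β t) (s := ν t / 2) (M := M / 2)
      (by positivity : 0 < (δ / 2) ^ 2) (by nlinarith) hq (by linarith) (by linarith)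
    rw [Real.norm_of_nonneg hk, abs_of_nonneg h0] at hkle
    exact (mul_le_mul hf hkle hk hC).trans (le_add_of_nonneg_left (by positivity))

/-- Lemma 3.2 (continuity of ω): with
`k₁(x,r) = ∫_b^c μ(t) β(t) / ((t-x)² + r²)^{ν(t)/2} dt` and
`k₂(x,r) = ∫_b^c β(t) / ((t-x)² + r²)^{ν(t)/2} dt`, the function `ω`
defined by `ω(x,r) = k₁(x,r)/k₂(x,r)` when `r > 0` or `x ∉ [b,c]`, and
`ω(x,0) = μ(x)` when `x ∈ [b,c]`, is continuous at every point of `ℝ × [0,∞)`. -/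
theorem stmt0 (b c : ℝ) (hb : b ≤ 0) (hc : 0 < c)
    (μ β ν : ℝ → ℝ)
    (hμcont : ContinuousOn μ (Icc b c))
    (hβcont : ContinuousOn β (Icc b c \ {0}))
    (hνcont : ContinuousOn ν (Icc b c \ {0}))
    (hνbdd : ∃ M : ℝ, ∀ t ∈ Icc b c \ {0}, ν t ≤ M)
    (hν1 : ∀ t ∈ Icc b c \ {0}, 1 < ν t)
    (hβpos : ∀ t ∈ Icc b c \ {0}, 0 < β t)
    (hβint : IntegrableOn β (Icc b c))
    (hdiv : ∫⁻ t in Icc b c, ENNReal.ofReal (β t * |t| ^ (-(ν t))) = ⊤) :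
    ContinuousOn
      (fun p : ℝ × ℝ =>
        if p.2 = 0 ∧ p.1 ∈ Icc b c then μ p.1
        else
          (∫ t in Icc b c, μ t * β t / (((t - p.1) ^ 2 + p.2 ^ 2) ^ (ν t / 2))) /
            (∫ t in Icc b c, β t / (((t - p.1) ^ 2 + p.2 ^ 2) ^ (ν t / 2))))
      {p : ℝ × ℝ | 0 ≤ p.2} := by
  set S : Set ℝ := Icc b c \ {0} with hSdef
  have hSm : MeasurableSet S := measurableSet_Icc.diff (measurableSet_singleton 0)
  have hSae : (S : Set ℝ) =ᵐ[volume] Icc b c := sdiff_null_ae_eq_self (measure_singleton 0)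
  have hres : volume.restrict (Icc b c) = volume.restrict S :=
    (Measure.restrict_congr_set hSae).symm
  obtain ⟨M, hM⟩ := hνbdd
  obtain ⟨A, hA⟩ := isCompact_Icc.exists_bound_of_continuousOn hμcont
  have hνmeas : AEMeasurable ν (volume.restrict S) := hνcont.aemeasurable hSm
  have hμβint : IntegrableOn (fun t => μ t * β t) (Icc b c) :=
    hβint.continuousOn_mul hμcont isCompact_Icc
  unfold IntegrableOn at hβint hμβint
  rw [hres] at hβint hμβint hdiv
  simp only [hres]
  have hmem : ∀ᵐ t ∂volume.restrict S, t ∈ S := ae_restrict_mem hSm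
  have hν0 : ∀ᵐ t ∂volume.restrict S, 1 < ν t := hmem.mono hν1
  have hνM : ∀ᵐ t ∂volume.restrict S, ν t ≤ M := hmem.mono hM
  have hβ0 : ∀ᵐ t ∂volume.restrict S, 0 ≤ β t := hmem.mono fun t ht => (hβpos t ht).le
  have hkβ0 (p : ℝ × ℝ) : ∀ᵐ t ∂volume.restrict S,
      0 ≤ β t / (((t - p.1) ^ 2 + p.2 ^ 2) ^ (ν t / 2)) := by
    filter_upwards [hβ0] with t ht
    positivity
  have hkint (g : ℝ → ℝ) (hg : Integrable g (volume.restrict S)) (p : ℝ × ℝ)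
      (hp : ¬ (p.2 = 0 ∧ p.1 ∈ Icc b c)) :
      Integrable (fun t => g t / (((t - p.1) ^ 2 + p.2 ^ 2) ^ (ν t / 2)))
        (volume.restrict S) := by
    obtain ⟨d, hd, hd1, hq⟩ := exists_eventually_le_sq_add_sq isCompact_Icc hp
    exact integrable_kernel hg hνmeas hν0 hνM hd hd1
      (hmem.mono fun t ht => hq.self_of_nhds t ht.1)
  have htop (x : ℝ) (hx : x ∈ Icc b c) :
      ∫⁻ t in S, ENNReal.ofReal (β t * |t - x| ^ (-(ν t))) = ⊤ := by
    rcases eq_or_ne x 0 with rfl | hx0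
    · simpa using hdiv
    have hxS : x ∈ S := ⟨hx, hx0⟩
    have hk : 0 < β x := hβpos x hxS
    have hnhds : nhdsWithin x S = nhdsWithin x (Icc b c) := by
      rw [hSdef, sdiff_eq]
      exact nhdsWithin_inter_of_mem' (mem_nhdsWithin_of_mem_nhds
        (isOpen_compl_singleton.mem_nhds hx0))
    have hev : ∀ᶠ t in nhdsWithin x (Icc b c), t ∈ S ∧ β x / 2 < β t := by
      rw [← hnhds]
      exact (eventually_mem_nhdsWithin).and
        ((hβcont x hxS).eventually_const_lt (half_lt_self hk))
    obtain ⟨δ, hδ, hsub⟩ := Metric.mem_nhdsWithin_iff.1 hev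
    have hη : 0 < min δ 1 := lt_min hδ one_pos
    have hηδ : min δ 1 ≤ δ := min_le_left _ _
    have hη1 : min δ 1 ≤ 1 := min_le_right _ _
    set η := min δ 1
    have hbu : b ≤ max b (x - η / 2) := le_max_left _ _
    have hxu : x - η / 2 ≤ max b (x - η / 2) := le_max_right _ _
    have hvc : min c (x + η / 2) ≤ c := min_le_left _ _
    have hvx : min c (x + η / 2) ≤ x + η / 2 := min_le_right _ _
    have hgood : ∀ t ∈ Ioc (max b (x - η / 2)) (min c (x + η / 2)), t ∈ S ∧ β x / 2 < β t := by
      intro t ht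
      refine hsub ⟨?_, by linarith [ht.1], by linarith [ht.2]⟩
      rw [Metric.mem_ball, Real.dist_eq, abs_lt]
      constructor <;> linarith [ht.1, ht.2]
    refine lintegral_rpow_neg_eq_top (k := β x / 2) ?_
      ⟨max_le hx.1 (by linarith), le_min hx.2 (by linarith)⟩ (fun t ht => (hgood t ht).1)
      (by linarith) (by positivity) (fun t ht => (hgood t ht).2.le)
      (fun t ht => (hν1 t (hgood t ht).1).le)
    exact max_lt (lt_min (by linarith) (by linarith [hx.1]))
      (lt_min (by linarith [hx.2]) (by linarith))
  have hk2large (x : ℝ) (hx : x ∈ Icc b c) (N : ℝ) :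
      ∀ᶠ p : ℝ × ℝ in nhds (x, 0), ¬ (p.2 = 0 ∧ p.1 ∈ Icc b c) →
        N < ∫ t in S, β t / (((t - p.1) ^ 2 + p.2 ^ 2) ^ (ν t / 2)) := by
    filter_upwards [eventually_lt_lintegral_kernel hβint.aemeasurable hνmeas (htop x hx)
      (ENNReal.ofReal_lt_top (r := N))] with p hp hpU
    rw [← ofReal_integral_eq_lintegral_ofReal (hkint β hβint p hpU) (hkβ0 p)] at hp
    exact (ENNReal.ofReal_lt_ofReal_iff'.1 hp).1
  refine Continuous.continuousOn (continuous_iff_continuousAt.2 fun p => ?_)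
  by_cases hp : p.2 = 0 ∧ p.1 ∈ Icc b c
  · obtain ⟨x, r⟩ := p
    obtain ⟨rfl, hx⟩ : r = 0 ∧ x ∈ Icc b c := hp
    rw [Metric.continuousAt_iff']
    intro ε hε
    obtain ⟨δ₀, hδ₀, hδμ⟩ := Metric.continuousWithinAt_iff.1 (hμcont x hx) (ε / 2) (half_pos hε)
    have hδ : 0 < min δ₀ 1 := lt_min hδ₀ one_pos
    have hδδ₀ : min δ₀ 1 ≤ δ₀ := min_le_left _ _
    have hδ1 : min δ₀ 1 ≤ 1 := min_le_right _ _
    set δ := min δ₀ 1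
    have hA0 : 0 ≤ A := (norm_nonneg _).trans (hA x hx)
    set B : ℝ := 2 * A * ((∫ t in S, β t) / ((δ / 2) ^ 2) ^ (M / 2)) with hB
    have hB0 : 0 ≤ B := by
      have : 0 ≤ ∫ t in S, β t := integral_nonneg_of_ae hβ0
      positivity
    have hclose : ∀ᶠ p : ℝ × ℝ in nhds (x, 0), |p.1 - x| < δ / 2 :=
      (continuous_fst.tendsto (x, (0 : ℝ))).eventually_mem
        (Metric.ball_mem_nhds x (half_pos hδ))
    filter_upwards [hclose, hk2large x hx (2 * B / ε)] with p hpx hN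
    simp only [hx, and_self, if_true]
    rw [Real.dist_eq]
    split_ifs with hpU
    · have := hδμ hpU.2 (by rw [Real.dist_eq]; linarith)
      rw [Real.dist_eq] at this
      linarith
    · have hlt := hN hpU
      have hkpos : 0 < ∫ t in S, β t / (((t - p.1) ^ 2 + p.2 ^ 2) ^ (ν t / 2)) :=
        lt_of_le_of_lt (by positivity) hlt
      have hmain := abs_integral_kernel_sub_le (x := x) (a := μ x) (ε := ε / 2) (C := 2 * A)
        hβint hν0 hνM hβ0 (hkint β hβint p hpU) (hkint _ hμβint p hpU) (half_pos hε).le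
        (by positivity) hδ hδ1 (hmem.mono fun t ht htx => by
          have := hδμ ht.1 (by rw [Real.dist_eq]; linarith)
          rw [Real.dist_eq] at this
          exact this.le)
        (hmem.mono fun t ht => by
          have h1 := hA t ht.1
          have h2 := hA x hx
          rw [Real.norm_eq_abs] at h1 h2
          linarith [abs_sub (μ t) (μ x)])
        hpx.le
      rw [← hB] at hmain
      rw [div_lt_iff₀ hε] at hlt
      rw [div_sub' hkpos.ne', abs_div, abs_of_pos hkpos, div_lt_iff₀ hkpos,
        mul_comm _ (μ x)]
      linarith
  · obtain ⟨d, hd, hd1, hq⟩ := exists_eventually_le_sq_add_sq isCompact_Icc hp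
    have hq' : ∀ᶠ z : ℝ × ℝ in nhds p,
        ∀ᵐ t ∂volume.restrict S, d ≤ (t - z.1) ^ 2 + z.2 ^ 2 :=
      hq.mono fun z hz => hmem.mono fun t ht => hz t ht.1
    have hkpos : 0 < ∫ t in S, β t / (((t - p.1) ^ 2 + p.2 ^ 2) ^ (ν t / 2)) := by
      rw [setIntegral_pos_iff_support_of_nonneg_ae (hkβ0 p) (hkint β hβint p hp)]
      have hvol : 0 < volume S := by
        rw [measure_congr hSae, Real.volume_Icc]
        exact ENNReal.ofReal_pos.2 (by linarith)
      refine hvol.trans_le (measure_mono fun t ht => ⟨?_, ht⟩)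
      exact (div_pos (hβpos t ht)
        (Real.rpow_pos_of_pos (hd.trans_le (hq.self_of_nhds t ht.1)) _)).ne'
    refine ContinuousAt.congr
      ((continuousAt_integral_kernel hμβint hνmeas hν0 hνM hd hd1 hq').div
        (continuousAt_integral_kernel hβint hνmeas hν0 hνM hd hd1 hq') hkpos.ne') ?_
    filter_upwards [hq] with z hz
    refine (if_neg fun h => ?_).symm
    have := hz z.1 h.2
    simp only [sub_self, h.1] at this
    linarith
end

section
/- For every x₀ ∈ [b,c], the integral k₂(x,r) = ∫_b^c β(t)/[(t−x)² + r²]^{ν(t)/2} dt tends to ∞ as (x,r) → (x₀,0): for every M > 0 there exists δ > 0 such that whenever |x − x₀| < δ, 0 ≤ r < δ, and either r > 0 or x ∉ [b,c], one has k₂(x,r) ≥ M. -/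
open MeasureTheory Set Filter

theorem ae_mem_Icc_diff_singleton (b c p : ℝ) :
    ∀ᵐ t ∂(volume.restrict (Icc b c)), t ∈ Icc b c \ {p} := by
  have h : ∀ᵐ t ∂(volume.restrict (Icc b c)), t ≠ p :=
    ae_restrict_of_ae (Measure.ae_ne volume p)
  filter_upwards [h, ae_restrict_mem measurableSet_Icc] with t h1 h2 using ⟨h2, h1⟩

theorem aemeasurable_of_continuousOn_Icc_diff_singleton {b c p : ℝ} {f : ℝ → ℝ}
    (hf : ContinuousOn f (Icc b c \ {p})) : AEMeasurable f (volume.restrict (Icc b c)) := by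
  have h : volume.restrict (Icc b c \ {p}) = volume.restrict (Icc b c) :=
    Measure.restrict_congr_set (sdiff_null_ae_eq_self (measure_singleton p))
  rw [← h]
  exact hf.aemeasurable (measurableSet_Icc.diff (measurableSet_singleton p))

theorem integrableOn_div_rpow {b c : ℝ} {β ν : ℝ → ℝ}
    (hνcont : ContinuousOn ν (Icc b c \ {0}))
    (hνbdd : ∃ M : ℝ, ∀ t ∈ Icc b c \ {0}, ν t ≤ M)
    (hν1 : ∀ t ∈ Icc b c \ {0}, 1 < ν t)
    (hβint : IntegrableOn β (Icc b c)) {x r : ℝ} (h : r ≠ 0 ∨ x ∉ Icc b c) :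
    IntegrableOn (fun t => β t / (((t - x) ^ 2 + r ^ 2) ^ (ν t / 2))) (Icc b c) := by
  obtain ⟨N, hN⟩ := hνbdd
  obtain ⟨m, hm0, hm1, hm⟩ : ∃ m : ℝ, 0 < m ∧ m ≤ 1 ∧
      ∀ t ∈ Icc b c, m ≤ (t - x) ^ 2 + r ^ 2 := by
    have hpos : ∀ t ∈ Icc b c, 0 < (t - x) ^ 2 + r ^ 2 := by
      intro t ht
      rcases h with h | h
      · positivity
      · have : t - x ≠ 0 := fun h0 => h (by rwa [← sub_eq_zero.mp h0])
        positivity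
    obtain ⟨m, hm0, hm⟩ := isCompact_Icc.exists_forall_le'
      (f := fun t : ℝ => (t - x) ^ 2 + r ^ 2) (by fun_prop) hpos
    exact ⟨min m 1, lt_min hm0 one_pos, min_le_right _ _,
      fun t ht => (min_le_left _ _).trans (hm t ht)⟩
  have hmeas : AEMeasurable (fun t => (((t - x) ^ 2 + r ^ 2) ^ (ν t / 2))⁻¹)
      (volume.restrict (Icc b c)) := by
    have := aemeasurable_of_continuousOn_Icc_diff_singleton hνcont
    exact (AEMeasurable.pow (by fun_prop) (this.div_const 2)).inv
  simp only [div_eq_mul_inv (β _)]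
  refine Integrable.mul_bdd (c := m ^ (-(N / 2))) hβint hmeas.aestronglyMeasurable ?_
  filter_upwards [ae_mem_Icc_diff_singleton b c 0] with t ht
  have hD := hm t ht.1
  have hν0 := hν1 t ht
  rw [Real.norm_of_nonneg (by positivity), ← Real.rpow_neg (by positivity)]
  calc _ ≤ m ^ (-(ν t / 2)) :=
        Real.rpow_le_rpow_of_nonpos hm0 hD (by linarith)
    _ ≤ _ := Real.rpow_le_rpow_of_exponent_ge hm0 hm1 (by linarith [hN t ht])

theorem lintegral_mul_abs_sub_rpow_eq_top {b c : ℝ} (hbc : b < c) {β ν : ℝ → ℝ}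
    (hβcont : ContinuousOn β (Icc b c \ {0}))
    (hν1 : ∀ t ∈ Icc b c \ {0}, 1 < ν t)
    (hβpos : ∀ t ∈ Icc b c \ {0}, 0 < β t)
    {x₀ : ℝ} (hx₀ : x₀ ∈ Icc b c) (h0 : x₀ ≠ 0) :
    ∫⁻ t in Icc b c, ENNReal.ofReal (β t * |t - x₀| ^ (-(ν t))) = ⊤ := by
  by_contra hfin
  have hx : x₀ ∈ Icc b c \ {0} := ⟨hx₀, h0⟩
  have hβ0 := hβpos x₀ hx
  obtain ⟨ε, hε, hball⟩ := Metric.mem_nhdsWithin_iff.mp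
    ((hβcont x₀ hx).eventually (lt_mem_nhds (half_lt_self hβ0)))
  obtain ⟨e, he0, he1, heε⟩ : ∃ e : ℝ, 0 < e ∧ e ≤ 1 ∧ e < ε :=
    ⟨min 1 (ε / 2), by positivity, min_le_left _ _, (min_le_right _ _).trans_lt (by linarith)⟩
  have hlt : max b (x₀ - e) < min c (x₀ + e) := by
    rw [max_lt_iff, lt_min_iff, lt_min_iff]
    refine ⟨⟨hbc, by linarith [hx₀.1]⟩, by linarith [hx₀.2], by linarith⟩
  have hsub : Icc (max b (x₀ - e)) (min c (x₀ + e)) ⊆ Icc b c :=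
    Icc_subset_Icc (le_max_left _ _) (min_le_left _ _)
  refine absurd (intervalIntegrable_sub_inv_iff (a := max b (x₀ - e)) (b := min c (x₀ + e))
    (c := x₀) |>.mp ?_) ?_
  · rw [intervalIntegrable_iff_integrableOn_Icc_of_le hlt.le]
    refine ⟨(by fun_prop : Measurable fun t : ℝ => (t - x₀)⁻¹).aestronglyMeasurable, ?_⟩
    have hbound : ∀ᵐ t ∂(volume.restrict (Icc (max b (x₀ - e)) (min c (x₀ + e)))),
        ‖(t - x₀)⁻¹‖ₑ ≤ ENNReal.ofReal (2 / β x₀) *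
          ENNReal.ofReal (β t * |t - x₀| ^ (-(ν t))) := by
      filter_upwards [ae_mem_Icc_diff_singleton _ _ 0, ae_mem_Icc_diff_singleton _ _ x₀]
        with t ht htx
      have htm : t ∈ Icc b c \ {0} := ⟨hsub ht.1, ht.2⟩
      have habs : |t - x₀| ≤ e := by
        rw [abs_le]
        have h1 := (le_max_right _ _).trans ht.1.1
        have h2 := ht.1.2.trans (min_le_right _ _)
        constructor <;> linarith
      have hp : 0 < |t - x₀| := abs_pos.mpr (sub_ne_zero.mpr htx.2)
      have hβt : β x₀ / 2 < β t :=
        hball ⟨by rw [Metric.mem_ball, Real.dist_eq]; linarith, htm⟩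
      rw [← ENNReal.ofReal_mul (by positivity), ← ofReal_norm]
      apply ENNReal.ofReal_le_ofReal
      have hpow : |t - x₀| ^ (-1 : ℝ) ≤ |t - x₀| ^ (-(ν t)) :=
        Real.rpow_le_rpow_of_exponent_ge hp (habs.trans he1) (by linarith [hν1 t htm])
      rw [Real.rpow_neg_one] at hpow
      rw [norm_inv, Real.norm_eq_abs]
      calc |t - x₀|⁻¹ ≤ |t - x₀| ^ (-(ν t)) := hpow
        _ = 2 / β x₀ * (β x₀ / 2 * |t - x₀| ^ (-(ν t))) := by field_simp
        _ ≤ _ := by gcongr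
    calc _ ≤ _ := lintegral_mono_ae hbound
      _ = ENNReal.ofReal (2 / β x₀) * _ := lintegral_const_mul' _ _ ENNReal.ofReal_ne_top
      _ ≤ ENNReal.ofReal (2 / β x₀) *
          ∫⁻ t in Icc b c, ENNReal.ofReal (β t * |t - x₀| ^ (-(ν t))) := by
        gcongr
      _ < ⊤ := ENNReal.mul_lt_top ENNReal.ofReal_lt_top (lt_top_iff_ne_top.mpr hfin)
  · rw [not_or, not_not, uIcc_of_le hlt.le]
    exact ⟨hlt.ne, max_le hx₀.1 (by linarith), le_min hx₀.2 (by linarith)⟩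

/-- For every `x₀ ∈ [b,c]`, the integral
`k₂(x,r) = ∫_b^c β(t) / ((t-x)² + r²)^{ν(t)/2} dt` tends to `∞` as `(x,r) → (x₀,0)`:
for every `M > 0` there is `δ > 0` such that whenever `|x - x₀| < δ`, `0 ≤ r < δ`,
and either `r > 0` or `x ∉ [b,c]`, one has `k₂(x,r) ≥ M`. -/
theorem stmt1 (b c : ℝ) (hb : b ≤ 0) (hc : 0 < c)
    (β ν : ℝ → ℝ)
    (hβcont : ContinuousOn β (Icc b c \ {0}))
    (hνcont : ContinuousOn ν (Icc b c \ {0}))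
    (hνbdd : ∃ M : ℝ, ∀ t ∈ Icc b c \ {0}, ν t ≤ M)
    (hν1 : ∀ t ∈ Icc b c \ {0}, 1 < ν t)
    (hβpos : ∀ t ∈ Icc b c \ {0}, 0 < β t)
    (hβint : IntegrableOn β (Icc b c))
    (hdiv : ∫⁻ t in Icc b c, ENNReal.ofReal (β t * |t| ^ (-(ν t))) = ⊤)
    (x₀ : ℝ) (hx₀ : x₀ ∈ Icc b c) (M : ℝ) (hM : 0 < M) :
    ∃ δ > 0, ∀ x r : ℝ, |x - x₀| < δ → 0 ≤ r → r < δ → (0 < r ∨ x ∉ Icc b c) →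
      M ≤ ∫ t in Icc b c, β t / (((t - x) ^ 2 + r ^ 2) ^ (ν t / 2)) := by
  by_contra! hcon
  choose! x r hx hr0 hr hxr hlt using fun n : ℕ => hcon (1 / ((n : ℝ) + 1)) (by positivity)
  have hxlim : Tendsto x atTop (nhds x₀) := by
    rw [tendsto_iff_dist_tendsto_zero]
    exact squeeze_zero (fun _ => dist_nonneg) (fun n => (hx n).le)
      tendsto_one_div_add_atTop_nhds_zero_nat
  have hrlim : Tendsto r atTop (nhds 0) :=
    squeeze_zero hr0 (fun n => (hr n).le) tendsto_one_div_add_atTop_nhds_zero_nat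
  have hint (n : ℕ) := integrableOn_div_rpow hνcont hνbdd hν1 hβint
    ((hxr n).imp_left ne_of_gt)
  have htop : ∫⁻ t in Icc b c, ENNReal.ofReal (β t * |t - x₀| ^ (-(ν t))) = ⊤ := by
    rcases eq_or_ne x₀ 0 with rfl | h0
    · simpa using hdiv
    · exact lintegral_mul_abs_sub_rpow_eq_top (hb.trans_lt hc) hβcont hν1 hβpos hx₀ h0
  have hlimit : ∀ᵐ t ∂(volume.restrict (Icc b c)),
      ENNReal.ofReal (β t * |t - x₀| ^ (-(ν t))) =
        liminf (fun n => ENNReal.ofReal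
          (β t / (((t - x n) ^ 2 + r n ^ 2) ^ (ν t / 2)))) atTop := by
    filter_upwards [ae_mem_Icc_diff_singleton b c x₀] with t ht
    have hne : t - x₀ ≠ 0 := sub_ne_zero.mpr ht.2
    have hbase : Tendsto (fun n => (t - x n) ^ 2 + r n ^ 2) atTop (nhds (|t - x₀| ^ 2)) := by
      simpa using ((hxlim.const_sub t).pow 2).add (hrlim.pow 2)
    have hsq : (|t - x₀| ^ 2) ^ (ν t / 2) = |t - x₀| ^ ν t := by
      rw [← Real.rpow_natCast_mul (abs_nonneg _)]
      congr 1
      push_cast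
      ring
    have hdenom := hbase.rpow_const (p := ν t / 2) (Or.inl (by positivity))
    rw [hsq] at hdenom
    rw [Real.rpow_neg (abs_nonneg _), ← div_eq_mul_inv]
    exact (ENNReal.tendsto_ofReal (tendsto_const_nhds.div hdenom (by positivity))).liminf_eq.symm
  have hfatou := lintegral_liminf_le' (u := atTop) fun n => (hint n).aemeasurable.ennreal_ofReal
  rw [← lintegral_congr_ae hlimit, htop, top_le_iff] at hfatou
  refine (ENNReal.ofReal_ne_top (r := M)) (top_le_iff.mp (hfatou.ge.trans ?_))
  refine liminf_le_of_frequently_le' (Frequently.of_forall fun n => ?_)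
  rw [← ofReal_integral_eq_lintegral_ofReal (hint n)]
  · exact ENNReal.ofReal_le_ofReal (hlt n).le
  · filter_upwards [ae_mem_Icc_diff_singleton b c 0] with t ht
    have := hβpos t ht
    simp only [Pi.zero_apply]
    positivity
end

section
/- For every x ∈ ℝ and r > 0, the partial derivative ∂u/∂r (x,r) exists and equals −r ∫_b^c μ(t)|t|^{μ(t)} h(t)/[(t−x)² + r²]^{1+μ(t)/2} dt, and the second partial derivatives ∂²u/∂x² (x,r) and ∂²u/∂r² (x,r) exist and satisfy ∂²u/∂x² (x,r) + ∂²u/∂r² (x,r) = ∫_b^c μ(t)² |t|^{μ(t)} h(t)/[(t−x)² + r²]^{1+μ(t)/2} dt. -/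
open MeasureTheory Set Filter

open scoped Topology

/-- A power with exponent in `[-K, 0]` of a number bounded below by `δ ∈ (0, 1]` is at most
`δ ^ (-K)`. -/
lemma rpow_neg_le_of_le {δ q k K : ℝ} (hδ : 0 < δ) (hδ1 : δ ≤ 1) (hq : δ ≤ q)
    (hk : 0 ≤ k) (hkK : k ≤ K) : q ^ (-k) ≤ δ ^ (-K) :=
  (Real.rpow_le_rpow_of_nonpos hδ hq (by linarith)).trans
    (Real.rpow_le_rpow_of_exponent_ge hδ hδ1 (by linarith))

lemma integrable_mul_rpow_neg {α : Type*} [MeasurableSpace α] {ν : Measure α}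
    {w κ q : α → ℝ} {K δ : ℝ} (hw : Integrable w ν) (hκ : Measurable κ)
    (hκK : ∀ᵐ t ∂ν, 0 ≤ κ t ∧ κ t ≤ K) (hδ : 0 < δ) (hδ1 : δ ≤ 1)
    (hq : Measurable q) (hδq : ∀ t, δ ≤ q t) :
    Integrable (fun t => w t * q t ^ (-κ t)) ν := by
  refine hw.mul_bdd (c := δ ^ (-K)) (hq.pow hκ.neg).aestronglyMeasurable ?_
  filter_upwards [hκK] with t ht
  rw [Real.norm_of_nonneg (Real.rpow_nonneg (hδ.le.trans (hδq t)) _)]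
  exact rpow_neg_le_of_le hδ hδ1 (hδq t) ht.1 ht.2

/-- Differentiation under the integral sign for `s ↦ ∫ w * q s ^ (-κ)`. -/
lemma hasDerivAt_integral_mul_rpow_neg {α : Type*} [MeasurableSpace α] {ν : Measure α}
    {w κ : α → ℝ} {q q' : ℝ → α → ℝ} {K δ C s₀ : ℝ} {S : Set ℝ}
    (hw : Integrable w ν) (hκ : Measurable κ)
    (hκK : ∀ᵐ t ∂ν, 0 ≤ κ t ∧ κ t ≤ K) (hδ : 0 < δ) (hδ1 : δ ≤ 1) (hS : S ∈ 𝓝 s₀)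
    (hq : ∀ s, Measurable (q s)) (hq' : Measurable (q' s₀))
    (hδq : ∀ s ∈ S, ∀ t, δ ≤ q s t) (hC : ∀ᵐ t ∂ν, ∀ s ∈ S, |q' s t| ≤ C)
    (hd : ∀ s t, HasDerivAt (fun s => q s t) (q' s t) s) :
    Integrable (fun t => w t * (q' s₀ t * -κ t * q s₀ t ^ (-κ t - 1))) ν ∧
    HasDerivAt (fun s => ∫ t, w t * q s t ^ (-κ t) ∂ν)
      (∫ t, w t * (q' s₀ t * -κ t * q s₀ t ^ (-κ t - 1)) ∂ν) s₀ := by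
  refine hasDerivAt_integral_of_dominated_loc_of_deriv_le
    (F' := fun s t => w t * (q' s t * -κ t * q s t ^ (-κ t - 1)))
    (bound := fun t => |w t| * (C * K * δ ^ (-(K + 1)))) hS ?_ ?_ ?_ ?_ ?_ ?_
  · exact Eventually.of_forall fun s =>
      hw.aestronglyMeasurable.mul ((hq s).pow hκ.neg).aestronglyMeasurable
  · exact integrable_mul_rpow_neg hw hκ hκK hδ hδ1 (hq s₀) (hδq s₀ (mem_of_mem_nhds hS))
  · exact hw.aestronglyMeasurable.mul
      ((hq'.mul hκ.neg).mul ((hq s₀).pow (hκ.neg.sub_const 1))).aestronglyMeasurable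
  · filter_upwards [hκK, hC] with t ht hCt s hs
    have hpow : q s t ^ (-κ t - 1) ≤ δ ^ (-(K + 1)) := by
      rw [← neg_add']
      exact rpow_neg_le_of_le hδ hδ1 (hδq s hs t) (by linarith [ht.1]) (by linarith [ht.2])
    have hpos : 0 ≤ q s t ^ (-κ t - 1) := Real.rpow_nonneg (hδ.le.trans (hδq s hs t)) _
    have hC0 : 0 ≤ C := (abs_nonneg _).trans (hCt s hs)
    rw [Real.norm_eq_abs, abs_mul, abs_mul, abs_mul, abs_neg, abs_of_nonneg ht.1,
      abs_of_nonneg hpos]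
    have hK : 0 ≤ K := ht.1.trans ht.2
    gcongr
    · exact ht.1
    · exact hCt s hs
    · exact ht.2
  · exact hw.abs.mul_const _
  · refine Eventually.of_forall fun t s hs => ?_
    exact ((hd s t).rpow_const (Or.inl (hδ.trans_le (hδq s hs t)).ne')).const_mul (w t)

section

variable {ν : Measure ℝ} {w κ : ℝ → ℝ} {K T : ℝ}

lemma integrable_mul_sq_add_sq_rpow_neg (hw : Integrable w ν) (hκ : Measurable κ)
    (hκK : ∀ᵐ t ∂ν, 0 ≤ κ t ∧ κ t ≤ K) (x : ℝ) {r : ℝ} (hr : 0 < r) :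
    Integrable (fun t => w t * ((t - x) ^ 2 + r ^ 2) ^ (-κ t)) ν := by
  refine integrable_mul_rpow_neg (δ := min (r ^ 2) 1) hw hκ hκK (by positivity)
    (min_le_right _ _) (by fun_prop) fun t => ?_
  exact (min_le_left _ _).trans (by nlinarith [sq_nonneg (t - x)])

lemma hasDerivAt_left_integral_mul_sq_add_sq_rpow_neg (hw : Integrable w ν)
    (hκ : Measurable κ) (hκK : ∀ᵐ t ∂ν, 0 ≤ κ t ∧ κ t ≤ K) (hT : ∀ᵐ t ∂ν, |t| ≤ T)
    (x : ℝ) {r : ℝ} (hr : 0 < r) :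
    Integrable (fun t =>
      w t * (-(2 * (t - x)) * -κ t * ((t - x) ^ 2 + r ^ 2) ^ (-κ t - 1))) ν ∧
    HasDerivAt (fun y => ∫ t, w t * ((t - y) ^ 2 + r ^ 2) ^ (-κ t) ∂ν)
      (∫ t, w t * (-(2 * (t - x)) * -κ t * ((t - x) ^ 2 + r ^ 2) ^ (-κ t - 1)) ∂ν) x := by
  refine hasDerivAt_integral_mul_rpow_neg (q := fun y t => (t - y) ^ 2 + r ^ 2)
    (q' := fun y t => -(2 * (t - y))) (δ := min (r ^ 2) 1) (C := 2 * (T + (|x| + 1)))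
    (S := Metric.ball x 1) hw hκ hκK (by positivity)
    (min_le_right _ _) (Metric.ball_mem_nhds x one_pos) (by fun_prop) (by fun_prop)
    (fun y _ t => (min_le_left _ _).trans (by nlinarith [sq_nonneg (t - y)])) ?_ ?_
  · filter_upwards [hT] with t ht y hy
    rw [Metric.mem_ball, Real.dist_eq] at hy
    have h₁ : |y| ≤ |x| + 1 := by linarith [abs_sub_abs_le_abs_sub y x]
    rw [abs_neg, abs_mul, abs_two]
    linarith [abs_sub t y]
  · intro y t
    refine ((((hasDerivAt_id y).const_sub t).pow 2).add_const (r ^ 2)).congr_deriv ?_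
    simp

lemma hasDerivAt_right_integral_mul_sq_add_sq_rpow_neg (hw : Integrable w ν)
    (hκ : Measurable κ) (hκK : ∀ᵐ t ∂ν, 0 ≤ κ t ∧ κ t ≤ K) (x : ℝ) {r : ℝ} (hr : 0 < r) :
    Integrable (fun t => w t * (2 * r * -κ t * ((t - x) ^ 2 + r ^ 2) ^ (-κ t - 1))) ν ∧
    HasDerivAt (fun s => ∫ t, w t * ((t - x) ^ 2 + s ^ 2) ^ (-κ t) ∂ν)
      (∫ t, w t * (2 * r * -κ t * ((t - x) ^ 2 + r ^ 2) ^ (-κ t - 1)) ∂ν) r := by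
  refine hasDerivAt_integral_mul_rpow_neg (q := fun s t => (t - x) ^ 2 + s ^ 2)
    (q' := fun s t => 2 * s) (δ := min ((r / 2) ^ 2) 1) (C := 2 * (2 * r))
    (S := Ioo (r / 2) (2 * r)) hw hκ hκK (by positivity)
    (min_le_right _ _) (Ioo_mem_nhds (by linarith) (by linarith)) (by fun_prop) (by fun_prop)
    (fun s hs t => (min_le_left _ _).trans ?_) ?_ ?_
  · nlinarith [sq_nonneg (t - x), hs.1]
  · refine Eventually.of_forall fun t s hs => ?_
    rw [abs_of_pos (by linarith [hs.1])]
    linarith [hs.2]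
  · intro s t
    refine (((hasDerivAt_id s).pow 2).const_add ((t - x) ^ 2)).congr_deriv ?_
    simp

end

/-- For every `x ∈ ℝ` and `r > 0`, the partial derivative `∂u/∂r (x,r)` exists and equals
`-r ∫_b^c μ(t)|t|^{μ(t)} h(t) / ((t-x)² + r²)^{1+μ(t)/2} dt`, and the second partial
derivatives `∂²u/∂x²` and `∂²u/∂r²` exist and satisfy
`∂²u/∂x² (x,r) + ∂²u/∂r² (x,r) = ∫_b^c μ(t)² |t|^{μ(t)} h(t) / ((t-x)² + r²)^{1+μ(t)/2} dt`. -/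
theorem stmt2 (b c : ℝ) (hb : b ≤ 0) (hc : 0 < c)
    (μ h : ℝ → ℝ)
    (hμmeas : Measurable μ) (hhmeas : Measurable h)
    (hμ0 : ∀ t ∈ Icc b c, 0 ≤ μ t) (hh0 : ∀ t ∈ Icc b c, 0 ≤ h t)
    (hμbdd : ∃ M : ℝ, ∀ t ∈ Icc b c, μ t ≤ M)
    (hint : IntegrableOn (fun t => |t| ^ μ t * h t) (Icc b c))
    (u : ℝ → ℝ → ℝ)
    (hu : ∀ x r : ℝ, u x r =
      ∫ t in Icc b c, |t| ^ μ t * h t / (((t - x) ^ 2 + r ^ 2) ^ (μ t / 2)))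
    (x r : ℝ) (hr : 0 < r) :
    HasDerivAt (fun s => u x s)
        (-(r * ∫ t in Icc b c,
            μ t * |t| ^ μ t * h t / (((t - x) ^ 2 + r ^ 2) ^ (1 + μ t / 2)))) r ∧
      ∃ A B : ℝ,
        HasDerivAt (fun y => deriv (fun z => u z r) y) A x ∧
        HasDerivAt (fun s => deriv (fun q => u x q) s) B r ∧
        A + B = ∫ t in Icc b c,
          (μ t) ^ 2 * |t| ^ μ t * h t / (((t - x) ^ 2 + r ^ 2) ^ (1 + μ t / 2)) := by
  obtain ⟨M, hM⟩ := hμbdd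
  set ν := volume.restrict (Icc b c) with hν
  have hae : ∀ᵐ t ∂ν, t ∈ Icc b c := ae_restrict_mem measurableSet_Icc
  set w : ℝ → ℝ := fun t => |t| ^ μ t * h t with hw_def
  have hw : Integrable w ν := hint
  have hT : ∀ᵐ t ∂ν, |t| ≤ max |b| |c| :=
    hae.mono fun t ht => abs_le_max_abs_abs ht.1 ht.2
  have hκ : Measurable fun t => μ t / 2 := hμmeas.div_const 2
  have hκ' : Measurable fun t => μ t / 2 + 1 := hκ.add_const 1
  have hκK : ∀ᵐ t ∂ν, 0 ≤ μ t / 2 ∧ μ t / 2 ≤ M / 2 :=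
    hae.mono fun t ht => ⟨by linarith [hμ0 t ht], by linarith [hM t ht]⟩
  have hκK' : ∀ᵐ t ∂ν, 0 ≤ μ t / 2 + 1 ∧ μ t / 2 + 1 ≤ M / 2 + 1 :=
    hκK.mono fun t ht => ⟨by linarith [ht.1], by linarith [ht.2]⟩
  have hwμ : Integrable (fun t => w t * μ t) ν :=
    hw.mul_bdd (c := M) hμmeas.aestronglyMeasurable <| hae.mono fun t ht => by
      rw [Real.norm_of_nonneg (hμ0 t ht)]; exact hM t ht
  have hwμt : Integrable (fun t => w t * μ t * t) ν :=
    hwμ.mul_bdd (c := max |b| |c|) measurable_id.aestronglyMeasurable hT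
  have hq : ∀ y s t : ℝ, 0 < s → 0 < (t - y) ^ 2 + s ^ 2 := fun y s t hs => by positivity
  have hu' : ∀ y s, 0 < s →
      u y s = ∫ t, w t * ((t - y) ^ 2 + s ^ 2) ^ (-(μ t / 2)) ∂ν := by
    intro y s hs
    rw [hu]
    congr 1 with t
    rw [Real.rpow_neg (hq y s t hs).le, div_eq_mul_inv]
  -- the kernel integrals with exponent `μ / 2 + 1`
  set J : (ℝ → ℝ) → ℝ → ℝ → ℝ := fun v y s =>
    ∫ t, v t * ((t - y) ^ 2 + s ^ 2) ^ (-(μ t / 2 + 1)) ∂ν with hJ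
  have hJint : ∀ {v : ℝ → ℝ}, Integrable v ν → ∀ y {s : ℝ}, 0 < s →
      Integrable (fun t => v t * ((t - y) ^ 2 + s ^ 2) ^ (-(μ t / 2 + 1))) ν :=
    fun hv y s hs => integrable_mul_sq_add_sq_rpow_neg hv hκ' hκK' y hs
  have hur : ∀ s, 0 < s →
      HasDerivAt (fun s => u x s) (-(s * J (fun t => w t * μ t) x s)) s := by
    intro s hs
    have hd := hasDerivAt_right_integral_mul_sq_add_sq_rpow_neg hw hκ hκK x hs |>.2
    refine (hd.congr_of_eventuallyEq ?_).congr_deriv ?_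
    · filter_upwards [Ioi_mem_nhds hs] with s' hs' using hu' x s' hs'
    · rw [hJ, ← integral_const_mul, ← integral_neg]
      congr 1 with t
      rw [neg_add']
      ring
  have hux : ∀ y, HasDerivAt (fun z => u z r)
      (J (fun t => w t * μ t * t) y r - y * J (fun t => w t * μ t) y r) y := by
    intro y
    have hd := hasDerivAt_left_integral_mul_sq_add_sq_rpow_neg hw hκ hκK hT y hr |>.2
    refine (hd.congr_of_eventuallyEq
      (Eventually.of_forall fun z => hu' z r hr)).congr_deriv ?_
    rw [hJ, ← integral_const_mul, ← integral_sub (hJint hwμt y hr) ((hJint hwμ y hr).const_mul y)]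
    congr 1 with t
    rw [neg_add']
    ring
  obtain ⟨hIr, hJr⟩ := hasDerivAt_right_integral_mul_sq_add_sq_rpow_neg hwμ hκ' hκK' x hr
  obtain ⟨hIx, hJx⟩ := hasDerivAt_left_integral_mul_sq_add_sq_rpow_neg hwμ hκ' hκK' hT x hr
  obtain ⟨hIxt, hJxt⟩ := hasDerivAt_left_integral_mul_sq_add_sq_rpow_neg hwμt hκ' hκK' hT x hr
  have hdenom : ∀ t, ((t - x) ^ 2 + r ^ 2) ^ (-(μ t / 2 + 1)) =
      (((t - x) ^ 2 + r ^ 2) ^ (1 + μ t / 2))⁻¹ := fun t => by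
    rw [Real.rpow_neg (hq x r t hr).le, add_comm (μ t / 2)]
  have hA := (hJxt.sub ((hasDerivAt_id x).mul hJx)).congr_of_eventuallyEq
    (f₁ := fun y => deriv (fun z => u z r) y)
    (Eventually.of_forall fun y => (hux y).deriv)
  have hB := ((hasDerivAt_id r).mul hJr).neg.congr_of_eventuallyEq
    (f₁ := fun s => deriv (fun q => u x q) s) (by
      filter_upwards [Ioi_mem_nhds hr] with s hs using (hur s hs).deriv)
  refine ⟨(hur r hr).congr_deriv ?_, _, _, hA, hB, ?_⟩
  · rw [hJ]
    congr 2
    refine integral_congr_ae (Eventually.of_forall fun t => ?_)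
    beta_reduce
    rw [hdenom, hw_def]
    ring
  have hJ₀ := hJint hwμ x hr
  simp only [id, one_mul]
  have hsplit : ∀ a b c d : ℝ, a - (d + x * b) + -(d + r * c) = a - x * b - r * c - 2 * d :=
    fun a b c d => by ring
  rw [hsplit, ← integral_const_mul, ← integral_const_mul, ← integral_const_mul,
    ← integral_sub hIxt (hIx.const_mul x),
    ← integral_sub (by exact hIxt.sub (hIx.const_mul x)) (hIr.const_mul r),
    ← integral_sub (by exact (hIxt.sub (hIx.const_mul x)).sub (hIr.const_mul r))
      (hJ₀.const_mul 2)]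
  congr 1 with t
  have hpow : ((t - x) ^ 2 + r ^ 2) ^ (-(μ t / 2 + 1)) =
      ((t - x) ^ 2 + r ^ 2) * ((t - x) ^ 2 + r ^ 2) ^ (-(μ t / 2 + 1) - 1) := by
    rw [Real.rpow_sub_one (hq x r t hr).ne', mul_div_cancel₀ _ (hq x r t hr).ne']
  rw [div_eq_mul_inv _ (_ ^ (1 + μ t / 2)), ← hdenom, hpow]
  generalize ((t - x) ^ 2 + r ^ 2) ^ (-(μ t / 2 + 1) - 1) = P
  simp only [hw_def]
  ring
end

section
/- For every x ∈ ℝ and r > 0 the equation ∂²u/∂x² (x,r) + ∂²u/∂r² (x,r) + (ω(x,r)/r) ∂u/∂r (x,r) = 0 holds, where ω(x,r) = k₁(x,r)/k₂(x,r) with k₁(x,r) = ∫_b^c μ(t)·β(t)/[(t−x)² + r²]^{(μ(t)+2)/2} dt, k₂(x,r) = ∫_b^c β(t)/[(t−x)² + r²]^{(μ(t)+2)/2} dt, and β(t) = μ(t)|t|^{μ(t)} h(t). -/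
open MeasureTheory Set Filter

/-- Differentiation under the integral of a power whose base is bounded away from `0` and whose
exponent is bounded and nonpositive. -/
theorem hasDerivAt_integral_mul_rpow {α : Type*} [MeasurableSpace α] {ν : Measure α}
    {w p : α → ℝ} (hw : Integrable w ν) (hp : Measurable p) {B : ℝ}
    (hpB : ∀ᵐ t ∂ν, p t ∈ Icc (-B) 0) {d d' : ℝ → α → ℝ} {s₀ m C : ℝ} {s : Set ℝ}
    (hs : s ∈ nhds s₀) (hm : 0 < m) (hm1 : m ≤ 1)
    (hd : ∀ y, Measurable (d y)) (hd' : Measurable (d' s₀))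
    (hdm : ∀ᵐ t ∂ν, ∀ y ∈ s, m ≤ d y t) (hd'C : ∀ᵐ t ∂ν, ∀ y ∈ s, |d' y t| ≤ C)
    (hderiv : ∀ y t, HasDerivAt (fun z => d z t) (d' y t) y) :
    HasDerivAt (fun y => ∫ t, w t * d y t ^ p t ∂ν)
      (∫ t, w t * (d' s₀ t * p t * d s₀ t ^ (p t - 1)) ∂ν) s₀ := by
  have hbase : ∀ q : ℝ, ∀ E : ℝ, q ∈ Icc (-E) 0 → ∀ z, m ≤ z → |z ^ q| ≤ m ^ (-E) := by
    intro q E hq z hz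
    rw [abs_of_nonneg (Real.rpow_nonneg (hm.le.trans hz) _)]
    exact (Real.rpow_le_rpow_of_nonpos hm hz hq.2).trans
      (Real.rpow_le_rpow_of_exponent_ge hm hm1 hq.1)
  have hmeas : ∀ y, AEStronglyMeasurable (fun t => w t * d y t ^ p t) ν := fun y =>
    hw.aestronglyMeasurable.mul ((hd y).pow hp).aestronglyMeasurable
  refine (hasDerivAt_integral_of_dominated_loc_of_deriv_le
    (F' := fun y t => w t * (d' y t * p t * d y t ^ (p t - 1)))
    (bound := fun t => |w t| * (C * B * m ^ (-(B + 1)))) hs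
    (Eventually.of_forall hmeas) ?_ ?_ ?_ ?_ ?_).2
  · refine (hw.abs.mul_const (m ^ (-B))).mono' (hmeas s₀) ?_
    filter_upwards [hpB, hdm] with t ht htm
    rw [Real.norm_eq_abs, abs_mul]
    gcongr
    exact hbase _ _ ht _ (htm _ (mem_of_mem_nhds hs))
  · exact hw.aestronglyMeasurable.mul
      ((hd'.mul hp).mul ((hd s₀).pow (hp.sub_const 1))).aestronglyMeasurable
  · filter_upwards [hpB, hdm, hd'C] with t ht htm htC y hy
    rw [Real.norm_eq_abs, abs_mul, abs_mul, abs_mul]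
    have hC : 0 ≤ C := (abs_nonneg _).trans (htC y hy)
    have hpa : |p t| ≤ B := abs_le.2 ⟨ht.1, ht.2.trans (by linarith [ht.1, ht.2])⟩
    have hB : 0 ≤ B := (abs_nonneg _).trans hpa
    gcongr
    · exact htC y hy
    · exact hbase _ _ ⟨by linarith [ht.1], by linarith [ht.2]⟩ _ (htm y hy)
  · exact hw.abs.mul_const _
  · filter_upwards [hdm] with t htm y hy
    exact ((hderiv y t).rpow_const (Or.inl (hm.trans_le (htm y hy)).ne')).const_mul _

/-- The potential with weight `w` and exponent `p` at the point `(x, r)`. -/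
noncomputable def axialPotential (b c : ℝ) (w p : ℝ → ℝ) (x r : ℝ) : ℝ :=
  ∫ t in Icc b c, w t * ((t - x) ^ 2 + r ^ 2) ^ p t

section axialPotential

variable {b c B : ℝ} {w p : ℝ → ℝ}

theorem integrableOn_mul_axial_rpow (hw : IntegrableOn w (Icc b c)) (hp : Measurable p)
    (hpB : ∀ t ∈ Icc b c, p t ∈ Icc (-B) 0) (x : ℝ) {r : ℝ} (hr : 0 < r) :
    IntegrableOn (fun t => w t * ((t - x) ^ 2 + r ^ 2) ^ p t) (Icc b c) := by
  refine (Integrable.mul_const hw.abs (min 1 (r ^ 2) ^ (-B))).mono'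
    (hw.aestronglyMeasurable.mul (Measurable.aestronglyMeasurable (by fun_prop))) ?_
  filter_upwards [ae_restrict_mem measurableSet_Icc] with t ht
  have hm : 0 < min 1 (r ^ 2) := lt_min one_pos (by positivity)
  rw [Real.norm_eq_abs, abs_mul, abs_of_nonneg (a := _ ^ _) (by positivity)]
  gcongr
  exact (Real.rpow_le_rpow_of_nonpos hm
    ((min_le_right _ _).trans (by nlinarith [sq_nonneg (t - x)])) (hpB t ht).2).trans
    (Real.rpow_le_rpow_of_exponent_ge hm (min_le_left _ _) (hpB t ht).1)

theorem integrableOn_bdd_mul (hw : IntegrableOn w (Icc b c)) (hp : Measurable p) {C : ℝ}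
    (hpC : ∀ t ∈ Icc b c, |p t| ≤ C) : IntegrableOn (fun t => p t * w t) (Icc b c) := by
  refine Integrable.bdd_mul (c := C) hw hp.aestronglyMeasurable ?_
  filter_upwards [ae_restrict_mem measurableSet_Icc] with t ht
  exact hpC t ht

theorem integrableOn_exponent_mul (hw : IntegrableOn w (Icc b c)) (hp : Measurable p)
    (hpB : ∀ t ∈ Icc b c, p t ∈ Icc (-B) 0) :
    IntegrableOn (fun t => p t * w t) (Icc b c) :=
  integrableOn_bdd_mul hw hp (C := B) fun t ht =>
    abs_le.2 ⟨(hpB t ht).1, by linarith [(hpB t ht).1, (hpB t ht).2]⟩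

theorem integrableOn_id_mul (hw : IntegrableOn w (Icc b c)) :
    IntegrableOn (fun t => t * w t) (Icc b c) :=
  integrableOn_bdd_mul hw measurable_id (C := max |b| |c|) fun _ ht =>
    abs_le_max_abs_abs ht.1 ht.2

theorem hasDerivAt_axialPotential_left (hw : IntegrableOn w (Icc b c)) (hp : Measurable p)
    (hpB : ∀ t ∈ Icc b c, p t ∈ Icc (-B) 0) (x : ℝ) {r : ℝ} (hr : 0 < r) :
    HasDerivAt (fun y => axialPotential b c w p y r)
      (-2 * (axialPotential b c (fun t => t * (p t * w t)) (fun t => p t - 1) x r -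
        x * axialPotential b c (fun t => p t * w t) (fun t => p t - 1) x r)) x := by
  have hpw := integrableOn_exponent_mul hw hp hpB
  have hp1 : ∀ t ∈ Icc b c, p t - 1 ∈ Icc (-(B + 1)) 0 := fun t ht =>
    ⟨by linarith [(hpB t ht).1], by linarith [(hpB t ht).2]⟩
  have hm : 0 < min 1 (r ^ 2) := lt_min one_pos (by positivity)
  have key := hasDerivAt_integral_mul_rpow (s₀ := x) (d := fun y t => (t - y) ^ 2 + r ^ 2)
    (d' := fun y t => -2 * (t - y)) (C := 2 * (max |b| |c| + (|x| + 1))) hw hp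
    (ae_restrict_of_forall_mem measurableSet_Icc hpB)
    (Metric.ball_mem_nhds x one_pos) hm (min_le_left _ _) (fun y => by fun_prop) (by fun_prop)
    (Eventually.of_forall fun t y _ =>
      (min_le_right _ _).trans (by nlinarith [sq_nonneg (t - y)]))
    (ae_restrict_of_forall_mem measurableSet_Icc fun t ht y hy => by
      rw [Metric.mem_ball, Real.dist_eq] at hy
      have h1 := abs_le_max_abs_abs ht.1 ht.2
      have h2 : |y| ≤ |x| + 1 := by linarith [abs_sub_abs_le_abs_sub y x]
      have h3 := abs_sub t y
      rw [abs_mul, abs_neg, abs_two]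
      linarith)
    (fun y t => by
      have h := (((hasDerivAt_id y).const_sub t).pow 2).add_const (r ^ 2)
      exact h.congr_deriv (by simp))
  refine key.congr_deriv ?_
  unfold axialPotential
  rw [← integral_const_mul, ← integral_sub
    (integrableOn_mul_axial_rpow (integrableOn_id_mul hpw) (hp.sub_const 1) hp1 x hr)
    ((integrableOn_mul_axial_rpow hpw (hp.sub_const 1) hp1 x hr).const_mul x),
    ← integral_const_mul]
  congr 1 with t
  ring

theorem hasDerivAt_axialPotential_right (hw : IntegrableOn w (Icc b c)) (hp : Measurable p)
    (hpB : ∀ t ∈ Icc b c, p t ∈ Icc (-B) 0) (x : ℝ) {r : ℝ} (hr : 0 < r) :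
    HasDerivAt (fun s => axialPotential b c w p x s)
      (2 * r * axialPotential b c (fun t => p t * w t) (fun t => p t - 1) x r) r := by
  have hm : 0 < min 1 ((r / 2) ^ 2) := lt_min one_pos (by positivity)
  have key := hasDerivAt_integral_mul_rpow (s₀ := r) (d := fun y t => (t - x) ^ 2 + y ^ 2)
    (d' := fun y t => 2 * y) (C := 2 * (2 * r)) hw hp
    (ae_restrict_of_forall_mem measurableSet_Icc hpB)
    (Ioo_mem_nhds (half_lt_self hr) (by linarith : r < 2 * r)) hm (min_le_left _ _)
    (fun y => by fun_prop) (by fun_prop)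
    (Eventually.of_forall fun t y hy =>
      (min_le_right _ _).trans (by nlinarith [sq_nonneg (t - x), hy.1]))
    (Eventually.of_forall fun t y hy => by
      rw [abs_of_pos (by linarith [hy.1])]
      linarith [hy.2])
    (fun y t => by
      have h := (((hasDerivAt_id y).pow 2)).const_add ((t - x) ^ 2)
      exact h.congr_deriv (by simp))
  refine key.congr_deriv ?_
  unfold axialPotential
  rw [← integral_const_mul]
  congr 1 with t
  ring

/-- The Laplacian of a potential in the half-plane `r > 0`. -/
theorem laplacian_axialPotential (hw : IntegrableOn w (Icc b c)) (hp : Measurable p)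
    (hpB : ∀ t ∈ Icc b c, p t ∈ Icc (-B) 0) (x : ℝ) {r : ℝ} (hr : 0 < r) :
    deriv (fun y => deriv (fun z => axialPotential b c w p z r) y) x +
      deriv (fun s => deriv (fun q => axialPotential b c w p x q) s) r =
    4 * axialPotential b c (fun t => p t * (p t * w t)) (fun t => p t - 1) x r := by
  have hpw := integrableOn_exponent_mul hw hp hpB
  have hpm := hp.sub_const 1
  have hp1 : ∀ t ∈ Icc b c, p t - 1 ∈ Icc (-(B + 1)) 0 := fun t ht =>
    ⟨by linarith [(hpB t ht).1], by linarith [(hpB t ht).2]⟩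
  have hp2 : ∀ t ∈ Icc b c, p t - 1 - 1 ∈ Icc (-(B + 1 + 1)) 0 := fun t ht =>
    ⟨by linarith [(hp1 t ht).1], by linarith [(hp1 t ht).2]⟩
  have hxx := ((hasDerivAt_axialPotential_left (integrableOn_id_mul hpw) hpm hp1 x hr).sub
    ((hasDerivAt_id x).mul (hasDerivAt_axialPotential_left hpw hpm hp1 x hr))).const_mul (-2)
  have hrr := ((hasDerivAt_id r).const_mul 2).mul
    (hasDerivAt_axialPotential_right hpw hpm hp1 x hr)
  have hx : (fun y => deriv (fun z => axialPotential b c w p z r) y) = _ :=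
    funext fun y => (hasDerivAt_axialPotential_left hw hp hpB y hr).deriv
  have hr' : (fun s => deriv (fun q => axialPotential b c w p x q) s) =ᶠ[nhds r] _ :=
    (eventually_gt_nhds hr).mono fun s hs =>
      (hasDerivAt_axialPotential_right hw hp hpB x hs).deriv
  rw [hx, hr'.deriv_eq]
  refine (congrArg₂ (· + ·) hxx.deriv hrr.deriv).trans ?_
  have hppw := integrableOn_exponent_mul hpw hpm hp1
  have htppw := integrableOn_exponent_mul (integrableOn_id_mul hpw) hpm hp1
  have i1 := integrableOn_mul_axial_rpow (integrableOn_id_mul htppw) (hpm.sub_const 1) hp2 x hr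
  have i2 := integrableOn_mul_axial_rpow htppw (hpm.sub_const 1) hp2 x hr
  have i3 := integrableOn_mul_axial_rpow (integrableOn_id_mul hppw) (hpm.sub_const 1) hp2 x hr
  have i4 := integrableOn_mul_axial_rpow hppw (hpm.sub_const 1) hp2 x hr
  have i5 := integrableOn_mul_axial_rpow hpw hpm hp1 x hr
  have key : axialPotential b c (fun t => p t * (p t * w t)) (fun t => p t - 1) x r =
      axialPotential b c (fun t => t * ((p t - 1) * (t * (p t * w t))))
        (fun t => p t - 1 - 1) x r -
      x * axialPotential b c (fun t => (p t - 1) * (t * (p t * w t)))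
        (fun t => p t - 1 - 1) x r -
      x * axialPotential b c (fun t => t * ((p t - 1) * (p t * w t)))
        (fun t => p t - 1 - 1) x r +
      (x ^ 2 + r ^ 2) * axialPotential b c (fun t => (p t - 1) * (p t * w t))
        (fun t => p t - 1 - 1) x r +
      axialPotential b c (fun t => p t * w t) (fun t => p t - 1) x r := by
    have j₁ := i1.sub (i2.const_mul x)
    have j₂ := j₁.sub (i3.const_mul x)
    have j₃ := j₂.add (i4.const_mul (x ^ 2 + r ^ 2))
    simp only [axialPotential]
    rw [← integral_const_mul, ← integral_const_mul, ← integral_const_mul,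
      ← integral_sub i1 (i2.const_mul x)]
    erw [← integral_sub j₁ (i3.const_mul x), ← integral_add j₂ (i4.const_mul (x ^ 2 + r ^ 2)),
      ← integral_add j₃ i5]
    congr 1 with t
    have hD : 0 < (t - x) ^ 2 + r ^ 2 := by positivity
    simp only [Pi.add_apply, Pi.sub_apply]
    rw [Real.rpow_sub_one hD.ne' (p t - 1)]
    field_simp
    ring
  rw [key]
  simp only [id]
  ring

end axialPotential

/-- Lemma 4.10.1: for every `x ∈ ℝ` and `r > 0` the equation
`∂²u/∂x² (x,r) + ∂²u/∂r² (x,r) + (ω(x,r)/r) ∂u/∂r (x,r) = 0` holds, where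
`ω(x,r) = k₁(x,r)/k₂(x,r)` with `β(t) = μ(t)|t|^{μ(t)} h(t)`,
`k₁(x,r) = ∫_b^c μ(t) β(t) / ((t-x)² + r²)^{(μ(t)+2)/2} dt` and
`k₂(x,r) = ∫_b^c β(t) / ((t-x)² + r²)^{(μ(t)+2)/2} dt`. -/
theorem stmt3 (b c : ℝ) (hb : b ≤ 0) (hc : 0 < c)
    (μ h : ℝ → ℝ)
    (hμmeas : Measurable μ) (hhmeas : Measurable h)
    (hμ0 : ∀ t ∈ Icc b c, 0 ≤ μ t) (hh0 : ∀ t ∈ Icc b c, 0 ≤ h t)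
    (hμbdd : ∃ M : ℝ, ∀ t ∈ Icc b c, μ t ≤ M)
    (hint : IntegrableOn (fun t => |t| ^ μ t * h t) (Icc b c))
    (hpos : 0 < volume {t | t ∈ Icc b c ∧ 0 < μ t * h t * |t| ^ μ t})
    (u : ℝ → ℝ → ℝ)
    (hu : ∀ x r : ℝ, u x r =
      ∫ t in Icc b c, |t| ^ μ t * h t / (((t - x) ^ 2 + r ^ 2) ^ (μ t / 2)))
    (x r : ℝ) (hr : 0 < r) :
    deriv (fun y => deriv (fun z => u z r) y) x +
      deriv (fun s => deriv (fun q => u x q) s) r +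
      (((∫ t in Icc b c,
            μ t * (μ t * |t| ^ μ t * h t) / (((t - x) ^ 2 + r ^ 2) ^ ((μ t + 2) / 2))) /
          (∫ t in Icc b c,
            (μ t * |t| ^ μ t * h t) / (((t - x) ^ 2 + r ^ 2) ^ ((μ t + 2) / 2)))) / r) *
        deriv (fun q => u x q) r = 0 := by
  obtain ⟨M, hM⟩ := hμbdd
  set g : ℝ → ℝ := fun t => |t| ^ μ t * h t with hg
  set p : ℝ → ℝ := fun t => -(μ t / 2) with hp
  have hpm : Measurable p := (hμmeas.div_const 2).neg
  have hpB : ∀ t ∈ Icc b c, p t ∈ Icc (-(M / 2)) 0 := fun t ht =>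
    ⟨by simp only [hp]; linarith [hM t ht], by simp only [hp]; linarith [hμ0 t ht]⟩
  have hpow : ∀ t, ((t - x) ^ 2 + r ^ 2) ^ (p t - 1) =
      (((t - x) ^ 2 + r ^ 2) ^ ((μ t + 2) / 2))⁻¹ := fun t => by
    rw [← Real.rpow_neg (by positivity)]
    congr 1
    simp only [hp]
    ring
  have hU : u = axialPotential b c g p := by
    funext y s
    rw [hu, axialPotential]
    congr 1 with t
    rw [Real.rpow_neg (by positivity), div_eq_mul_inv]
  have hk₁ : ∫ t in Icc b c,
      μ t * (μ t * |t| ^ μ t * h t) / (((t - x) ^ 2 + r ^ 2) ^ ((μ t + 2) / 2)) =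
      4 * axialPotential b c (fun t => p t * (p t * g t)) (fun t => p t - 1) x r := by
    rw [axialPotential, ← integral_const_mul]
    congr 1 with t
    rw [hpow]
    simp only [hp, hg]
    ring
  have hk₂ : ∫ t in Icc b c,
      (μ t * |t| ^ μ t * h t) / (((t - x) ^ 2 + r ^ 2) ^ ((μ t + 2) / 2)) =
      -2 * axialPotential b c (fun t => p t * g t) (fun t => p t - 1) x r := by
    rw [axialPotential, ← integral_const_mul]
    congr 1 with t
    rw [hpow]
    simp only [hp, hg]
    ring
  have hk₂_ne : ∫ t in Icc b c,
      (μ t * |t| ^ μ t * h t) / (((t - x) ^ 2 + r ^ 2) ^ ((μ t + 2) / 2)) ≠ 0 := by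
    have hi := (integrableOn_mul_axial_rpow (integrableOn_exponent_mul hint hpm hpB)
      (hpm.sub_const 1) (B := M / 2 + 1) (fun t ht =>
        ⟨by linarith [(hpB t ht).1], by linarith [(hpB t ht).2]⟩) x hr).const_mul (-2)
    refine ((setIntegral_pos_iff_support_of_nonneg_ae
      (ae_restrict_of_forall_mem measurableSet_Icc fun t ht => ?_) (hi.congr ?_)).2
      (hpos.trans_le (measure_mono ?_))).ne'
    · have := hμ0 t ht
      have := hh0 t ht
      simp only [Pi.zero_apply]
      positivity
    · refine Eventually.of_forall fun t => ?_
      simp only [hpow]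
      simp only [hp, hg]
      ring
    · rintro t ⟨ht, h0⟩
      have hD : 0 < (t - x) ^ 2 + r ^ 2 := by positivity
      refine ⟨(div_pos ?_ (Real.rpow_pos_of_pos hD _)).ne', ht⟩
      linarith [mul_right_comm (μ t) (h t) (|t| ^ μ t)]
  rw [hk₂] at hk₂_ne
  rw [hk₁, hk₂, hU, laplacian_axialPotential hint hpm hpB x hr,
    (hasDerivAt_axialPotential_right hint hpm hpB x hr).deriv]
  have hA := right_ne_zero_of_mul hk₂_ne
  have hr0 := hr.ne'
  field_simp
  ring
end

section
/- Suppose in addition that μ is nondecreasing on (0,c], h is nonincreasing on (0,c], and μ(x) > 1 for all x ∈ (0,c]. Then for all x, r with 0 < r ≤ x and 2x ≤ c one has u(x,r) ≥ 2^{−μ(c)} · r · (x/r)^{μ(x)} · h(2x) · (μ(x)−1)^{−1} · (1 − (r/x)^{μ(x)−1}). -/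
open MeasureTheory Set Filter

lemma integrableOn_div_rpow_sq_add_sq {b c : ℝ} {μ f : ℝ → ℝ} (hμmeas : Measurable μ)
    (hμ0 : ∀ t ∈ Icc b c, 0 ≤ μ t) (hμbdd : ∃ M : ℝ, ∀ t ∈ Icc b c, μ t ≤ M)
    (hf : IntegrableOn f (Icc b c)) (x : ℝ) {r : ℝ} (hr : 0 < r) :
    IntegrableOn (fun t => f t / (((t - x) ^ 2 + r ^ 2) ^ (μ t / 2))) (Icc b c) := by
  obtain ⟨M, hM⟩ := hμbdd
  have hd : 0 < min 1 (r ^ 2) := lt_min one_pos (by positivity)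
  simp only [div_eq_mul_inv (f _)]
  refine Integrable.mul_bdd (c := ((min 1 (r ^ 2)) ^ (M / 2))⁻¹) hf ?_ ?_
  · exact Measurable.aestronglyMeasurable (by fun_prop)
  · filter_upwards [ae_restrict_mem measurableSet_Icc] with t ht
    rw [Real.norm_of_nonneg (by positivity)]
    refine inv_anti₀ (by positivity) ?_
    calc (min 1 (r ^ 2)) ^ (M / 2) ≤ (min 1 (r ^ 2)) ^ (μ t / 2) :=
          Real.rpow_le_rpow_of_exponent_ge hd (min_le_left _ _) (by linarith [hM t ht])
      _ ≤ ((t - x) ^ 2 + r ^ 2) ^ (μ t / 2) := by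
          refine Real.rpow_le_rpow hd.le ?_ (by linarith [hμ0 t ht])
          exact (min_le_right _ _).trans (by nlinarith [sq_nonneg (t - x)])

lemma integral_rpow_neg_eq {x r m : ℝ} (hr : 0 < r) (hrx : r ≤ x) (hm : 1 < m) :
    x ^ m * ∫ s in r..x, s ^ (-m) =
      r * (x / r) ^ m * (m - 1)⁻¹ * (1 - (r / x) ^ (m - 1)) := by
  have hx : 0 < x := hr.trans_le hrx
  have h0 : (0 : ℝ) ∉ uIcc r x := by
    rw [uIcc_of_le hrx]
    exact fun h => absurd h.1 (not_le.2 hr)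
  have hm1 : m - 1 ≠ 0 := by linarith
  have hm2 : -m + 1 ≠ 0 := fun h => hm1 (by linarith)
  rw [integral_rpow (Or.inr ⟨by intro h; linarith, h0⟩), Real.div_rpow hx.le hr.le,
    Real.div_rpow hr.le hx.le, Real.rpow_add hx, Real.rpow_add hr, Real.rpow_sub hx,
    Real.rpow_sub hr, Real.rpow_neg hx.le, Real.rpow_neg hr.le, Real.rpow_one, Real.rpow_one]
  have hxm : x ^ m ≠ 0 := by positivity
  have hrm : r ^ m ≠ 0 := by positivity
  rw [show -m + 1 = -(m - 1) by ring]
  field_simp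
  ring

lemma mul_rpow_neg_le_rpow_div {m p q x r t : ℝ} (hm : 0 ≤ m) (hmp : m ≤ p) (hpq : p ≤ q)
    (hr : 0 < r) (hrt : r ≤ t - x) (htx : t ≤ 2 * x) :
    (2 : ℝ) ^ (-q) * (x ^ m * (t - x) ^ (-m)) ≤
      |t| ^ p / (((t - x) ^ 2 + r ^ 2) ^ (p / 2)) := by
  have hs : 0 < t - x := hr.trans_le hrt
  have hx : 0 < x := by linarith
  have hp : 0 ≤ p := hm.trans hmp
  have hden : ((t - x) ^ 2 + r ^ 2) ^ (p / 2) ≤ (2 * (t - x)) ^ p := by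
    calc ((t - x) ^ 2 + r ^ 2) ^ (p / 2) ≤ ((2 * (t - x)) ^ (2 : ℝ)) ^ (p / 2) := by
          refine Real.rpow_le_rpow (by positivity) ?_ (by linarith)
          rw [Real.rpow_two]
          nlinarith
      _ = (2 * (t - x)) ^ p := by
          rw [← Real.rpow_mul (by positivity)]
          congr 1
          ring
  calc (2 : ℝ) ^ (-q) * (x ^ m * (t - x) ^ (-m)) = (2 : ℝ) ^ (-q) * (x / (t - x)) ^ m := by
        rw [Real.div_rpow hx.le hs.le, Real.rpow_neg hs.le, div_eq_mul_inv]
    _ ≤ (2 : ℝ) ^ (-p) * (x / (t - x)) ^ p := by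
        gcongr
        · norm_num
        · rw [le_div_iff₀ hs]
          linarith
    _ = x ^ p / (2 * (t - x)) ^ p := by
        rw [Real.div_rpow hx.le hs.le, Real.mul_rpow two_pos.le hs.le,
          Real.rpow_neg two_pos.le]
        field_simp
    _ ≤ |t| ^ p / (((t - x) ^ 2 + r ^ 2) ^ (p / 2)) := by
        have : x ≤ |t| := by
          rw [abs_of_pos (by linarith)]
          linarith
        gcongr

/-- If `μ` is nondecreasing on `(0,c]`, `h` is nonincreasing on `(0,c]`, and `μ > 1`
on `(0,c]`, then for all `0 < r ≤ x` with `2x ≤ c` one has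
`u(x,r) ≥ 2^{-μ(c)} r (x/r)^{μ(x)} h(2x) (μ(x)-1)⁻¹ (1 - (r/x)^{μ(x)-1})`. -/
theorem stmt5 (b c : ℝ) (hb : b ≤ 0) (hc : 0 < c)
    (μ h : ℝ → ℝ)
    (hμmeas : Measurable μ) (hhmeas : Measurable h)
    (hμ0 : ∀ t ∈ Icc b c, 0 ≤ μ t) (hh0 : ∀ t ∈ Icc b c, 0 ≤ h t)
    (hμbdd : ∃ M : ℝ, ∀ t ∈ Icc b c, μ t ≤ M)
    (hint : IntegrableOn (fun t => |t| ^ μ t * h t) (Icc b c))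
    (u : ℝ → ℝ → ℝ)
    (hu : ∀ x r : ℝ, u x r =
      ∫ t in Icc b c, |t| ^ μ t * h t / (((t - x) ^ 2 + r ^ 2) ^ (μ t / 2)))
    (hμmono : MonotoneOn μ (Ioc 0 c))
    (hhanti : AntitoneOn h (Ioc 0 c))
    (hμ1 : ∀ x ∈ Ioc 0 c, 1 < μ x)
    (x r : ℝ) (hr : 0 < r) (hrx : r ≤ x) (hxc : 2 * x ≤ c) :
    (2 : ℝ) ^ (-μ c) * r * (x / r) ^ μ x * h (2 * x) * (μ x - 1)⁻¹ *
        (1 - (r / x) ^ (μ x - 1)) ≤ u x r := by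
  have hx : 0 < x := hr.trans_le hrx
  have hxm : x ∈ Ioc 0 c := ⟨hx, by linarith⟩
  have h2x : 2 * x ∈ Ioc 0 c := ⟨by linarith, hxc⟩
  have hsub : Ioc (x + r) (2 * x) ⊆ Icc b c := fun t ht =>
    ⟨by linarith [ht.1], by linarith [ht.2]⟩
  have hF := integrableOn_div_rpow_sq_add_sq hμmeas hμ0 hμbdd hint x hr
  have hle : x + r ≤ 2 * x := by linarith
  have hG : IntervalIntegrable
      (fun t => (2 : ℝ) ^ (-μ c) * h (2 * x) * x ^ μ x * (t - x) ^ (-μ x))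
      volume (x + r) (2 * x) := by
    refine ContinuousOn.intervalIntegrable (continuousOn_const.mul ?_)
    refine ContinuousOn.rpow_const (by fun_prop) fun t ht => Or.inl ?_
    rw [uIcc_of_le hle] at ht
    linarith [ht.1]
  rw [hu]
  calc _ = ∫ t in (x + r)..(2 * x),
          (2 : ℝ) ^ (-μ c) * h (2 * x) * x ^ μ x * (t - x) ^ (-μ x) := by
        rw [intervalIntegral.integral_const_mul,
          intervalIntegral.integral_comp_sub_right (fun s => s ^ (-μ x)) x,
          show x + r - x = r by ring, show 2 * x - x = x by ring, mul_assoc _ (x ^ μ x),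
          integral_rpow_neg_eq hr hrx (hμ1 x hxm)]
        ring
    _ = ∫ t in Ioc (x + r) (2 * x),
          (2 : ℝ) ^ (-μ c) * h (2 * x) * x ^ μ x * (t - x) ^ (-μ x) :=
        intervalIntegral.integral_of_le hle
    _ ≤ ∫ t in Ioc (x + r) (2 * x),
          |t| ^ μ t * h t / (((t - x) ^ 2 + r ^ 2) ^ (μ t / 2)) := by
        refine setIntegral_mono_on ((intervalIntegrable_iff_integrableOn_Ioc_of_le hle).1 hG)
          (hF.mono_set hsub) measurableSet_Ioc fun t ht => ?_
        have htm : t ∈ Ioc 0 c := ⟨by linarith [ht.1], by linarith [ht.2]⟩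
        have key := mul_rpow_neg_le_rpow_div (by linarith [hμ1 x hxm])
          (hμmono hxm htm (by linarith [ht.1])) (hμmono htm ⟨hc, le_rfl⟩ htm.2) hr
          (by linarith [ht.1]) ht.2
        have hh2 : 0 ≤ h (2 * x) := hh0 _ ⟨by linarith, hxc⟩
        calc _ = (2 : ℝ) ^ (-μ c) * (x ^ μ x * (t - x) ^ (-μ x)) * h (2 * x) := by ring
          _ ≤ |t| ^ μ t / (((t - x) ^ 2 + r ^ 2) ^ (μ t / 2)) * h t :=
              mul_le_mul key (hhanti htm h2x ht.2) hh2 (by positivity)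
          _ = _ := by ring
    _ ≤ _ := by
        refine setIntegral_mono_set hF ?_ hsub.eventuallyLE
        filter_upwards [ae_restrict_mem measurableSet_Icc] with t ht
        have := hh0 t ht
        simp only [Pi.zero_apply]
        positivity
end

section
/- If μ > 1, there exist a constant N > 0 and x₀ ∈ (0, c/2) such that for all x with 0 < |x| ≤ x₀ and all r > 0, u₁(x,r) ≤ N·|ln|x||^{−γ}·(|x|/r)^{μ−1}. -/
open MeasureTheory Set Filter

/-- The one-dimensional Japanese-bracket integral `∫ (1 + s²)^(-μ/2)`. -/
noncomputable def japaneseIntegral (μ : ℝ) : ℝ := ∫ s : ℝ, (1 + ‖s‖ ^ 2) ^ (-μ / 2)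

lemma japaneseIntegral_nonneg (μ : ℝ) : 0 ≤ japaneseIntegral μ :=
  integral_nonneg fun s => by positivity

lemma sq_add_sq_rpow_neg_eq {r : ℝ} (hr : 0 < r) (μ x t : ℝ) :
    ((t - x) ^ 2 + r ^ 2) ^ (-μ / 2) =
      r ^ (-μ) * (1 + ‖(t - x) / r‖ ^ 2) ^ (-μ / 2) := by
  have h : (t - x) ^ 2 + r ^ 2 = r ^ 2 * (1 + ‖(t - x) / r‖ ^ 2) := by
    rw [Real.norm_eq_abs, sq_abs]
    field_simp
    ring
  rw [h, Real.mul_rpow (by positivity) (by positivity), ← Real.rpow_natCast r 2,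
    ← Real.rpow_mul hr.le]
  congr 2
  push_cast
  ring

lemma integrable_sq_add_sq_rpow_neg {r μ : ℝ} (hr : 0 < r) (hμ : 1 < μ) (x : ℝ) :
    Integrable fun t : ℝ => ((t - x) ^ 2 + r ^ 2) ^ (-μ / 2) := by
  have h : Integrable fun s : ℝ => (1 + ‖s‖ ^ 2) ^ (-μ / 2) :=
    integrable_rpow_neg_one_add_norm_sq (by simpa using hμ)
  simp_rw [sq_add_sq_rpow_neg_eq hr μ x]
  exact ((h.comp_div hr.ne').comp_sub_right x).const_mul _

lemma integral_sq_add_sq_rpow_neg {r : ℝ} (hr : 0 < r) (μ x : ℝ) :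
    ∫ t : ℝ, ((t - x) ^ 2 + r ^ 2) ^ (-μ / 2) = r ^ (1 - μ) * japaneseIntegral μ := by
  simp_rw [sq_add_sq_rpow_neg_eq hr μ x]
  rw [integral_const_mul,
    integral_sub_right_eq_self (fun t : ℝ => (1 + ‖t / r‖ ^ 2) ^ (-μ / 2)) x,
    Measure.integral_comp_div (fun s : ℝ => (1 + ‖s‖ ^ 2) ^ (-μ / 2)) r, abs_of_pos hr,
    smul_eq_mul, sub_eq_neg_add, Real.rpow_add hr, Real.rpow_one, japaneseIntegral]
  ring

lemma half_abs_log_le_abs_log {x t : ℝ} (hx : |x| ≤ 1 / 4) (ht : t ≠ 0) (htx : |t| ≤ 2 * |x|) :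
    abs (Real.log |x|) / 2 ≤ abs (Real.log |t|) := by
  have ht0 : 0 < |t| := abs_pos.mpr ht
  have hx0 : 0 < |x| := by linarith
  have h1 : Real.log |t| ≤ Real.log 2 + Real.log |x| := by
    rw [← Real.log_mul two_ne_zero hx0.ne']
    exact Real.log_le_log ht0 htx
  have h2 : Real.log |x| ≤ -(2 * Real.log 2) := by
    have h3 := Real.log_le_log hx0 hx
    rwa [show (1 / 4 : ℝ) = (2 ^ 2)⁻¹ by norm_num, Real.log_inv, Real.log_pow,
      Nat.cast_ofNat] at h3
  have h4 : 0 < Real.log 2 := Real.log_pos one_lt_two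
  rw [abs_of_neg (by linarith : Real.log |x| < 0), abs_of_neg (by linarith : Real.log |t| < 0)]
  linarith

lemma abs_rpow_mul_weight_le {γ μ x t : ℝ} (hγ : 0 ≤ γ) (hμ : 1 < μ) (hx0 : x ≠ 0)
    (hx : |x| ≤ 1 / 4) (htx : |t| ≤ 2 * |x|) :
    |t| ^ μ * (|t|⁻¹ * abs (Real.log |t|) ^ (-γ)) ≤
      2 ^ γ * 2 ^ (μ - 1) * |x| ^ (μ - 1) * abs (Real.log |x|) ^ (-γ) := by
  rcases eq_or_ne t 0 with rfl | ht
  · rw [abs_zero, Real.zero_rpow (by linarith), zero_mul]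
    positivity
  have ht0 : 0 < |t| := abs_pos.mpr ht
  have hlog : 0 < abs (Real.log |x|) :=
    abs_pos.mpr (Real.log_neg (abs_pos.mpr hx0) (by linarith)).ne
  have h1 : |t| ^ μ * |t|⁻¹ ≤ 2 ^ (μ - 1) * |x| ^ (μ - 1) := by
    rw [← div_eq_mul_inv, ← Real.rpow_sub_one ht0.ne', ← Real.mul_rpow zero_le_two (abs_nonneg x)]
    exact Real.rpow_le_rpow ht0.le htx (by linarith)
  have h2 : abs (Real.log |t|) ^ (-γ) ≤ 2 ^ γ * abs (Real.log |x|) ^ (-γ) := by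
    calc abs (Real.log |t|) ^ (-γ) ≤ (abs (Real.log |x|) / 2) ^ (-γ) :=
          Real.rpow_le_rpow_of_nonpos (by positivity) (half_abs_log_le_abs_log hx ht htx)
            (by linarith)
      _ = 2 ^ γ * abs (Real.log |x|) ^ (-γ) := by
          rw [Real.div_rpow hlog.le zero_le_two, Real.rpow_neg zero_le_two, div_inv_eq_mul,
            mul_comm]
  calc |t| ^ μ * (|t|⁻¹ * abs (Real.log |t|) ^ (-γ))
      = |t| ^ μ * |t|⁻¹ * abs (Real.log |t|) ^ (-γ) := by ring
    _ ≤ (2 ^ (μ - 1) * |x| ^ (μ - 1)) * (2 ^ γ * abs (Real.log |x|) ^ (-γ)) := by gcongr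
    _ = _ := by ring

/-- Lemma 7.1 (i), case `μ > 1`: there exist `N > 0` and `x₀ ∈ (0, c/2)` such that for
all `x ≠ 0` with `|x| ≤ x₀` and all `r > 0`,
`u₁(x,r) ≤ N |ln|x||^{-γ} (|x|/r)^{μ-1}`, where `u₁(x,r)` is the integral of
`|t|^μ h(t) / ((t-x)² + r²)^{μ/2}` over `[-2|x|, 2|x|]` with
`h(t) = |t|⁻¹ |ln|t||^{-γ}`. -/
theorem stmt6 (c γ μ : ℝ) (hc : c ∈ Ioo (0 : ℝ) 1) (hγ : 1 < γ) (hμ : 1 < μ) :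
    ∃ N > (0 : ℝ), ∃ x₀ ∈ Ioo 0 (c / 2), ∀ x r : ℝ, x ≠ 0 → |x| ≤ x₀ → 0 < r →
      (∫ t in Icc (-(2 * |x|)) (2 * |x|),
          |t| ^ μ * (|t|⁻¹ * (abs (Real.log |t|)) ^ (-γ)) / (((t - x) ^ 2 + r ^ 2) ^ (μ / 2)))
        ≤ N * (abs (Real.log |x|)) ^ (-γ) * (|x| / r) ^ (μ - 1) := by
  have hJ := japaneseIntegral_nonneg μ
  refine ⟨2 ^ γ * 2 ^ (μ - 1) * (japaneseIntegral μ + 1), by positivity, c / 4,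
    ⟨by linarith [hc.1], by linarith [hc.1]⟩, fun x r hx0 hx hr => ?_⟩
  have hx4 : |x| ≤ 1 / 4 := by linarith [hc.2]
  set K : ℝ := 2 ^ γ * 2 ^ (μ - 1) * |x| ^ (μ - 1) * abs (Real.log |x|) ^ (-γ) with hK
  have hint := (integrable_sq_add_sq_rpow_neg hr hμ x).const_mul K
  calc _ ≤ ∫ t in Icc (-(2 * |x|)) (2 * |x|), K * ((t - x) ^ 2 + r ^ 2) ^ (-μ / 2) := by
        refine integral_mono_of_nonneg (ae_of_all _ fun t => by dsimp only; positivity)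
          hint.integrableOn ((ae_restrict_mem measurableSet_Icc).mono fun t ht => ?_)
        dsimp only
        have hq : 0 ≤ (t - x) ^ 2 + r ^ 2 := by positivity
        rw [neg_div, Real.rpow_neg hq, ← div_eq_mul_inv K]
        gcongr
        exact abs_rpow_mul_weight_le (by linarith) hμ hx0 hx4 (abs_le.mpr ht)
    _ ≤ ∫ t, K * ((t - x) ^ 2 + r ^ 2) ^ (-μ / 2) :=
        setIntegral_le_integral hint (ae_of_all _ fun t => by
          dsimp only [Pi.zero_apply]; positivity)
    _ = K * (r ^ (1 - μ) * japaneseIntegral μ) := by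
        rw [integral_const_mul, integral_sq_add_sq_rpow_neg hr]
    _ ≤ K * (r ^ (1 - μ) * (japaneseIntegral μ + 1)) := by
        gcongr
        linarith
    _ = _ := by
        rw [hK, Real.div_rpow (abs_nonneg x) hr.le, ← neg_sub μ 1, Real.rpow_neg hr.le]
        ring
end

section
/- If μ = 1, there exist a constant N > 0 and x₀ ∈ (0, c/2) such that for all x with 0 < |x| ≤ x₀ and all r with 0 < 2r ≤ |x|, u₁(x,r) ≤ N·|ln|x||^{−γ}·ln(|x|/r). -/
open MeasureTheory Set Filter

lemma continuous_inv_abs_sub_add (x : ℝ) {r : ℝ} (hr : 0 < r) :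
    Continuous fun t : ℝ => (|t - x| + r)⁻¹ :=
  Continuous.inv₀ (by fun_prop) fun t => by positivity

lemma integral_inv_abs_add {a r : ℝ} (ha : 0 ≤ a) (hr : 0 < r) :
    ∫ s in (-a)..a, (|s| + r)⁻¹ = 2 * Real.log ((a + r) / r) := by
  have hcont : Continuous fun s : ℝ => (|s| + r)⁻¹ := by
    simpa using continuous_inv_abs_sub_add 0 hr
  have hpos : ∫ s in (0 : ℝ)..a, (|s| + r)⁻¹ = Real.log ((a + r) / r) := by
    have h : ∫ s in (0 : ℝ)..a, (|s| + r)⁻¹ = ∫ s in (0 : ℝ)..a, (s + r)⁻¹ := by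
      refine intervalIntegral.integral_congr fun s hs => ?_
      rw [uIcc_of_le ha] at hs
      simp only [abs_of_nonneg hs.1]
    rw [h, intervalIntegral.integral_comp_add_right (fun u : ℝ => u⁻¹) r,
      integral_inv_of_pos (by linarith) (by linarith), zero_add]
  have hneg : ∫ s in (-a)..0, (|s| + r)⁻¹ = ∫ s in (0 : ℝ)..a, (|s| + r)⁻¹ := by
    simpa using (intervalIntegral.integral_comp_neg (a := 0) (b := a)
      (fun s : ℝ => (|s| + r)⁻¹)).symm
  rw [← intervalIntegral.integral_add_adjacent_intervals (b := 0)
    (hcont.intervalIntegrable _ _) (hcont.intervalIntegrable _ _), hneg, hpos]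
  ring

lemma setIntegral_inv_abs_sub_add_le {x r : ℝ} (hr : 0 < r) (hrx : 2 * r ≤ |x|) :
    ∫ t in Icc (-(2 * |x|)) (2 * |x|), (|t - x| + r)⁻¹ ≤ 6 * Real.log (|x| / r) := by
  have hcont := continuous_inv_abs_sub_add x hr
  have hsub : Icc (-(2 * |x|)) (2 * |x|) ⊆ Icc (-(3 * |x|) + x) (3 * |x| + x) := by
    have h1 := neg_abs_le x
    have h2 := le_abs_self x
    exact Icc_subset_Icc (by linarith) (by linarith)
  have hx := abs_nonneg x
  calc ∫ t in Icc (-(2 * |x|)) (2 * |x|), (|t - x| + r)⁻¹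
      ≤ ∫ t in Icc (-(3 * |x|) + x) (3 * |x| + x), (|t - x| + r)⁻¹ :=
        setIntegral_mono_set hcont.continuousOn.integrableOn_Icc
          (Eventually.of_forall fun t => by positivity) hsub.eventuallyLE
    _ = 2 * Real.log ((3 * |x| + r) / r) := by
        rw [integral_Icc_eq_integral_Ioc, ← intervalIntegral.integral_of_le (by linarith),
          intervalIntegral.integral_comp_sub_right (fun s : ℝ => (|s| + r)⁻¹) x,
          add_sub_cancel_right, add_sub_cancel_right, integral_inv_abs_add (by positivity) hr]
    _ ≤ 2 * Real.log ((|x| / r) ^ 3) := by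
        have h2 : 2 ≤ |x| / r := (le_div_iff₀ hr).2 hrx
        have h3 : (3 * |x| + r) / r = 3 * (|x| / r) + 1 := by field_simp
        rw [h3]
        gcongr
        nlinarith [mul_nonneg (sub_nonneg.2 h2) (sq_nonneg (|x| / r))]
    _ = 6 * Real.log (|x| / r) := by
        rw [Real.log_pow]
        push_cast
        ring

lemma abs_log_rpow_neg_le {x t γ : ℝ} (hγ : 0 ≤ γ) (hx : x ≠ 0) (hx4 : |x| ≤ 1 / 4)
    (ht : t ≠ 0) (htx : |t| ≤ 2 * |x|) :
    (abs (Real.log |t|)) ^ (-γ) ≤ 2 ^ γ * (abs (Real.log |x|)) ^ (-γ) := by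
  have hx0 : 0 < |x| := abs_pos.2 hx
  have ht0 : 0 < |t| := abs_pos.2 ht
  have hlx : Real.log |x| < 0 := Real.log_neg hx0 (by linarith)
  have hlt : Real.log |t| < 0 := Real.log_neg ht0 (by linarith)
  have hlog : 2 * Real.log |t| ≤ Real.log |x| := by
    have h := Real.log_le_log (pow_pos ht0 2) (show |t| ^ 2 ≤ |x| by nlinarith)
    rw [Real.log_pow] at h
    exact_mod_cast h
  have hhalf : (2 : ℝ) ^ γ * (abs (Real.log |x|)) ^ (-γ) = (2⁻¹ * abs (Real.log |x|)) ^ (-γ) := by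
    rw [Real.mul_rpow (by norm_num) (abs_nonneg _), Real.inv_rpow (by norm_num),
      ← Real.rpow_neg (by norm_num : (0 : ℝ) ≤ 2), neg_neg]
  rw [hhalf, abs_of_neg hlx, abs_of_neg hlt]
  exact Real.rpow_le_rpow_of_nonpos (by linarith) (by linarith) (by linarith)

/-- Lemma 7.1 (i), case `μ = 1`: there exist `N > 0` and `x₀ ∈ (0, c/2)` such that for
all `x ≠ 0` with `|x| ≤ x₀` and all `r` with `0 < 2r ≤ |x|`,
`u₁(x,r) ≤ N |ln|x||^{-γ} ln(|x|/r)`, where `u₁(x,r)` is the integral of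
`|t|^μ h(t) / ((t-x)² + r²)^{μ/2}` over `[-2|x|, 2|x|]` with
`h(t) = |t|⁻¹ |ln|t||^{-γ}`. -/
theorem stmt7 (c γ μ : ℝ) (hc : c ∈ Ioo (0 : ℝ) 1) (hγ : 1 < γ) (hμ : μ = 1) :
    ∃ N > (0 : ℝ), ∃ x₀ ∈ Ioo 0 (c / 2), ∀ x r : ℝ, x ≠ 0 → |x| ≤ x₀ →
      0 < r → 2 * r ≤ |x| →
      (∫ t in Icc (-(2 * |x|)) (2 * |x|),
          |t| ^ μ * (|t|⁻¹ * (abs (Real.log |t|)) ^ (-γ)) / (((t - x) ^ 2 + r ^ 2) ^ (μ / 2)))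
        ≤ N * (abs (Real.log |x|)) ^ (-γ) * Real.log (|x| / r) := by
  obtain ⟨hc0, hc1⟩ := hc
  subst hμ
  refine ⟨12 * 2 ^ γ, by positivity, c / 4, ⟨by linarith, by linarith⟩, ?_⟩
  intro x r hx hxc hr hrx
  set K : ℝ := 2 ^ γ * (abs (Real.log |x|)) ^ (-γ) with hK
  have hK0 : 0 ≤ K := by positivity
  calc _ ≤ ∫ t in Icc (-(2 * |x|)) (2 * |x|), 2 * K * (|t - x| + r)⁻¹ := by
        refine integral_mono_of_nonneg (Eventually.of_forall fun t => by positivity)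
          ((continuous_inv_abs_sub_add x hr).const_mul
            (2 * K)).continuousOn.integrableOn_Icc ?_
        refine (ae_restrict_mem measurableSet_Icc).mono fun t ht => ?_
        rcases eq_or_ne t 0 with rfl | ht0
        · simp only [abs_zero, Real.zero_rpow one_ne_zero, zero_mul, zero_div]
          positivity
        have hlog := abs_log_rpow_neg_le (zero_le_one.trans hγ.le) hx (by linarith) ht0 (abs_le.2 ht)
        have hsqrt : (|t - x| + r) / 2 ≤ √((t - x) ^ 2 + r ^ 2) := by
          refine Real.le_sqrt_of_sq_le ?_
          rw [← sq_abs (t - x)]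
          nlinarith [sq_nonneg (|t - x| - r), sq_nonneg (|t - x|)]
        have hden : 2 * K * (|t - x| + r)⁻¹ = K / ((|t - x| + r) / 2) := by
          field_simp
        simp only [Real.rpow_one, ← Real.sqrt_eq_rpow]
        rw [hden, mul_inv_cancel_left₀ (abs_ne_zero.2 ht0)]
        gcongr
    _ = 2 * K * ∫ t in Icc (-(2 * |x|)) (2 * |x|), (|t - x| + r)⁻¹ :=
        integral_const_mul _ _
    _ ≤ 2 * K * (6 * Real.log (|x| / r)) := by
        gcongr
        exact setIntegral_inv_abs_sub_add_le hr hrx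
    _ = _ := by
        rw [hK]
        ring
end

section
/- Let r : (0,∞) → [0,∞) be a differentiable function with |r′(x)| ≤ 1 for all x and r(x)/x → 0 as x ↓ 0. Then there exists a real number ρ with −∞ < ρ < 0 such that lim_{x↓0} x·|ln x|^{γ} · (d/dx)[u₂(x, r(x))] = ρ. -/
open MeasureTheory Set Filter

theorem hasDerivAt_integral_moving {g : ℝ → ℝ → ℝ} {b : ℝ → ℝ} {b' x : ℝ}
    (hb : HasDerivAt b b' x) (hg : ContinuousAt (Function.uncurry g) (b x, x))
    (hint : ∀ᶠ y in nhds x, IntervalIntegrable (fun t => g t y) volume (b x) (b y)) :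
    HasDerivAt (fun y => ∫ t in b x..b y, g t y) (b' * g (b x) x) x := by
  set C := g (b x) x with hC
  have h0 : HasDerivAt (fun y => ∫ t in b x..b y, (g t y - C)) 0 x := by
    rw [hasDerivAt_iff_isLittleO]
    simp only [intervalIntegral.integral_same, sub_zero, smul_zero]
    refine Asymptotics.IsLittleO.trans_isBigO ?_ hb.isBigO_sub
    rw [Asymptotics.isLittleO_iff]
    intro ε hε
    obtain ⟨δ, hδ, hd⟩ := Metric.continuousAt_iff.1 hg ε hε
    have h1 : ∀ᶠ y in nhds x, dist (b y) (b x) < δ :=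
      hb.continuousAt.eventually (Metric.ball_mem_nhds _ hδ)
    filter_upwards [h1, Metric.ball_mem_nhds x hδ] with y hy1 hy2
    rw [Real.norm_eq_abs (b y - b x)]
    refine intervalIntegral.norm_integral_le_of_norm_le_const fun t ht => ?_
    have : dist (t, y) (b x, x) < δ := by
      rw [Prod.dist_eq]
      refine max_lt (lt_of_le_of_lt ?_ hy1) hy2
      rw [Real.dist_eq, Real.dist_eq]
      exact abs_sub_left_of_mem_uIcc (uIoc_subset_uIcc ht)
    exact (hd this).le
  have h2 : HasDerivAt (fun y => (∫ t in b x..b y, (g t y - C)) + (b y - b x) * C)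
      (0 + b' * C) x := h0.add ((hb.sub_const _).mul_const C)
  rw [zero_add] at h2
  refine h2.congr_of_eventuallyEq ?_
  filter_upwards [hint] with y hy
  rw [intervalIntegral.integral_sub hy intervalIntegrable_const]
  simp

/-- The weight `|t| ^ μ * h t`, where `h t = |t|⁻¹ * |log |t|| ^ (-γ)`. -/
noncomputable def weight (μ γ t : ℝ) : ℝ := |t| ^ μ * (|t|⁻¹ * abs (Real.log |t|) ^ (-γ))

theorem continuousOn_weight (μ γ : ℝ) : ContinuousOn (weight μ γ) (Ioo 0 1) := by
  intro t ht
  apply ContinuousAt.continuousWithinAt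
  have h1 : |t| ≠ 0 := abs_ne_zero.2 ht.1.ne'
  have h2 : abs (Real.log |t|) ≠ 0 := by
    rw [abs_of_pos ht.1]
    exact abs_ne_zero.2 (Real.log_neg ht.1 ht.2).ne
  unfold weight
  exact (continuousAt_id.abs.rpow_const (Or.inl h1)).mul ((continuousAt_id.abs.inv₀ h1).mul
    ((continuousAt_id.abs.log h1).abs.rpow_const (Or.inl h2)))

theorem mul_weight_mul (μ γ : ℝ) {x s : ℝ} (hx : 0 < x) (hs : 0 < s) :
    x * |Real.log x| ^ γ * weight μ γ (x * s) =
      x ^ μ * (s ^ (μ - 1) * (|Real.log x| / |Real.log (x * s)|) ^ γ) := by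
  have hxs := mul_pos hx hs
  rw [weight, abs_of_pos hxs, Real.div_rpow (abs_nonneg _) (abs_nonneg _),
    Real.rpow_neg (abs_nonneg _), Real.mul_rpow hx.le hs.le, Real.rpow_sub_one hs.ne']
  field_simp

theorem tendsto_abs_log_div (s : ℝ) (hs : 0 < s) :
    Tendsto (fun x => |Real.log x| / |Real.log (x * s)|) (nhdsWithin 0 (Ioi 0)) (nhds 1) := by
  have h1 : Tendsto (fun x => Real.log s / Real.log x) (nhdsWithin 0 (Ioi 0)) (nhds 0) :=
    Real.tendsto_log_nhdsGT_zero.const_div_atBot _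
  have h2 : Tendsto (fun x => |(1 + Real.log s / Real.log x)⁻¹|) (nhdsWithin 0 (Ioi 0))
      (nhds 1) := by
    have := ((h1.const_add 1).inv₀ (by norm_num)).abs
    simpa using this
  refine h2.congr' ?_
  filter_upwards [self_mem_nhdsWithin, Ioo_mem_nhdsGT (zero_lt_one (α := ℝ))] with x hx hx1
  have hl := (Real.log_neg hx hx1.2).ne
  rw [← abs_div, Real.log_mul (ne_of_gt hx) hs.ne', one_add_div hl, inv_div]

theorem sub_abs_le_sub_mul {σ t y : ℝ} (hσ : |σ| ≤ 1) : t - |y| ≤ t - σ * y := by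
  have h1 : |σ * y| ≤ |y| := by
    rw [abs_mul]
    exact mul_le_of_le_one_left (abs_nonneg y) hσ
  linarith [le_abs_self (σ * y)]

theorem sq_add_sq_pos {σ t y v : ℝ} (hσ : |σ| ≤ 1) (h : |y| < t) :
    0 < (t - σ * y) ^ 2 + v ^ 2 := by
  have h1 : 0 < t - σ * y := (sub_pos.2 h).trans_le (sub_abs_le_sub_mul hσ)
  positivity

theorem hasDerivAt_div_rpow {σ μ t y a : ℝ} {r : ℝ → ℝ} (hσ : |σ| ≤ 1) (h : |y| < t)
    (hr : DifferentiableAt ℝ r y) :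
    HasDerivAt (fun z => a / ((t - σ * z) ^ 2 + r z ^ 2) ^ (μ / 2))
      (a * (μ * (σ * (t - σ * y) - r y * deriv r y) /
        ((t - σ * y) ^ 2 + r y ^ 2) ^ (μ / 2 + 1))) y := by
  have hD := sq_add_sq_pos (v := r y) hσ h
  have h1 : HasDerivAt (fun z => (t - σ * z) ^ 2 + r z ^ 2)
      (2 * (t - σ * y) * (-σ) + 2 * r y * deriv r y) y := by
    have h2 : HasDerivAt (fun z => t - σ * z) (-σ) y := by
      simpa using ((hasDerivAt_id y).const_mul σ).const_sub t
    simpa using (h2.fun_pow 2).fun_add (hr.hasDerivAt.fun_pow 2)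
  have h3 := (h1.rpow_const (p := -(μ / 2)) (Or.inl hD.ne')).const_mul a
  have h4 : (fun z => a / ((t - σ * z) ^ 2 + r z ^ 2) ^ (μ / 2)) =
      fun z => a * ((t - σ * z) ^ 2 + r z ^ 2) ^ (-(μ / 2)) := by
    funext z
    rw [Real.rpow_neg (by positivity), div_eq_mul_inv]
  rw [h4]
  refine h3.congr_deriv ?_
  rw [show -(μ / 2) - 1 = -(μ / 2 + 1) by ring, Real.rpow_neg hD.le]
  ring

theorem continuousOn_weight_div {σ γ a c y : ℝ} (μ v : ℝ) (hσ : |σ| ≤ 1) (hc : c < 1)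
    (ha : |y| < a) :
    ContinuousOn (fun t => weight μ γ t / ((t - σ * y) ^ 2 + v ^ 2) ^ (μ / 2)) (Icc a c) := by
  have hpos : ∀ t ∈ Icc a c, 0 < (t - σ * y) ^ 2 + v ^ 2 := fun t ht =>
    sq_add_sq_pos hσ (ha.trans_le ht.1)
  refine ((continuousOn_weight μ γ).mono fun t ht =>
    ⟨(abs_nonneg y).trans_lt (ha.trans_le ht.1), ht.2.trans_lt hc⟩).div ?_ fun t ht =>
      (Real.rpow_pos_of_pos (hpos t ht) _).ne'
  exact ContinuousOn.rpow_const (by fun_prop) fun t ht => Or.inl (hpos t ht).ne'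

theorem hasDerivAt_integral_weight {σ μ γ c x : ℝ} {r : ℝ → ℝ} (hσ : |σ| ≤ 1) (hc : c < 1)
    (hμ : 0 ≤ μ) (hx : 0 < x) (hxc : 2 * x < c) (hr0 : ∀ y, 0 < y → 0 ≤ r y)
    (hrd : ∀ y, 0 < y → DifferentiableAt ℝ r y) (hr' : ∀ y, 0 < y → |deriv r y| ≤ 1) :
    HasDerivAt (fun y => ∫ t in (2 * y)..c,
        weight μ γ t / ((t - σ * y) ^ 2 + r y ^ 2) ^ (μ / 2))
      ((∫ t in (2 * x)..c, weight μ γ t * (μ * (σ * (t - σ * x) - r x * deriv r x) /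
          ((t - σ * x) ^ 2 + r x ^ 2) ^ (μ / 2 + 1))) -
        2 * (weight μ γ (2 * x) / ((2 * x - σ * x) ^ 2 + r x ^ 2) ^ (μ / 2))) x := by
  have hnear : Ioo (3 / 4 * x) (5 / 4 * x) ∈ nhds x := Ioo_mem_nhds (by linarith) (by linarith)
  have hcont : ∀ y ∈ Ioo (3 / 4 * x) (5 / 4 * x), ContinuousOn
      (fun t => weight μ γ t / ((t - σ * y) ^ 2 + r y ^ 2) ^ (μ / 2)) (Icc (3 / 2 * x) c) := fun y hy =>
    continuousOn_weight_div _ _ hσ hc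
      (by rw [abs_of_pos (by linarith [hy.1])]; linarith [hy.2])
  have hint : ∀ y ∈ Ioo (3 / 4 * x) (5 / 4 * x), ∀ a ∈ Icc (3 / 2 * x) c, ∀ b ∈ Icc (3 / 2 * x) c,
      IntervalIntegrable (fun t => weight μ γ t / ((t - σ * y) ^ 2 + r y ^ 2) ^ (μ / 2))
        volume a b := fun y hy a ha b hb =>
    ((hcont y hy).mono (uIcc_subset_Icc ha hb)).intervalIntegrable
  have hxm : x ∈ Ioo (3 / 4 * x) (5 / 4 * x) := mem_of_mem_nhds hnear
  have h2x : 2 * x ∈ Icc (3 / 2 * x) c := ⟨by linarith, hxc.le⟩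
  have hcm : c ∈ Icc (3 / 2 * x) c := ⟨by linarith, le_rfl⟩
  have h2y : ∀ᶠ y in nhds x, 2 * y ∈ Icc (3 / 2 * x) c := by
    filter_upwards [hnear, Iio_mem_nhds (show x < c / 2 by linarith)] with y hy hy2
    exact ⟨by linarith [hy.1], by linarith [mem_Iio.1 hy2]⟩
  have hmoving := hasDerivAt_integral_moving (b := fun y : ℝ => 2 * y) (b' := 2) (x := x)
    (g := fun t y => weight μ γ t / ((t - σ * y) ^ 2 + r y ^ 2) ^ (μ / 2))
    (by simpa using (hasDerivAt_id x).const_mul 2) (by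
      have hpos : 0 < (2 * x - σ * x) ^ 2 + r x ^ 2 :=
        sq_add_sq_pos hσ (by rw [abs_of_pos hx]; linarith)
      have hw : ContinuousAt (weight μ γ) (2 * x) :=
        (continuousOn_weight μ γ).continuousAt (Ioo_mem_nhds (by linarith) (by linarith))
      have hw' : ContinuousAt (fun p : ℝ × ℝ => weight μ γ p.1) (2 * x, x) :=
        ContinuousAt.comp' (f := Prod.fst) (g := weight μ γ) hw continuousAt_fst
      have hrc : ContinuousAt (fun p : ℝ × ℝ => r p.2) (2 * x, x) :=
        ContinuousAt.comp' (f := Prod.snd) (g := r) (hrd x hx).continuousAt continuousAt_snd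
      have hd : ContinuousAt (fun p : ℝ × ℝ => (p.1 - σ * p.2) ^ 2) (2 * x, x) := by fun_prop
      refine hw'.div (ContinuousAt.rpow_const (hd.add (hrc.pow 2)) (Or.inl hpos.ne'))
        (Real.rpow_pos_of_pos hpos _).ne')
    (by
      filter_upwards [hnear, h2y] with y hy hy2
      exact hint y hy _ h2x _ hy2)
  have hrx1 : ∀ᶠ y in nhds x, r y < r x + 1 :=
    (hrd x hx).continuousAt.eventually (Iio_mem_nhds (by linarith))
  have hfixed := (intervalIntegral.hasDerivAt_integral_of_dominated_loc_of_deriv_le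
    (μ := volume) (a := 2 * x) (b := c) (x₀ := x)
    (F := fun y t => weight μ γ t / ((t - σ * y) ^ 2 + r y ^ 2) ^ (μ / 2))
    (F' := fun y t => weight μ γ t * (μ * (σ * (t - σ * y) - r y * deriv r y) /
          ((t - σ * y) ^ 2 + r y ^ 2) ^ (μ / 2 + 1)))
    (bound := fun t => |weight μ γ t| * (μ * (4 + r x) / ((x / 4) ^ 2) ^ (μ / 2 + 1)))
    (inter_mem hnear hrx1) ?_ (hint x hxm _ h2x _ hcm) ?_ ?_ ?_ ?_).2
  · have := hfixed.sub hmoving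
    refine this.congr_of_eventuallyEq ?_
    filter_upwards [hnear, h2y] with y hy hy2
    rw [Pi.sub_apply, intervalIntegral.integral_interval_sub_left (hint y hy _ h2x _ hcm)
      (hint y hy _ h2x _ hy2)]
  · filter_upwards [hnear] with y hy
    exact (intervalIntegrable_iff.1 (hint y hy _ h2x _ hcm)).aestronglyMeasurable
  · have hpos : ∀ t ∈ uIoc (2 * x) c, 0 < (t - σ * x) ^ 2 + r x ^ 2 := fun t ht =>
      sq_add_sq_pos hσ (by
        rw [uIoc_of_le hxc.le] at ht
        rw [abs_of_pos hx]; linarith [ht.1])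
    refine ContinuousOn.aestronglyMeasurable ?_ measurableSet_uIoc
    refine ((continuousOn_weight μ γ).mono fun t ht => ?_).mul
      (ContinuousOn.div (by fun_prop) (ContinuousOn.rpow_const (by fun_prop) fun t ht =>
        Or.inl (hpos t ht).ne') fun t ht => (Real.rpow_pos_of_pos (hpos t ht) _).ne')
    rw [uIoc_of_le hxc.le] at ht
    exact ⟨by linarith [ht.1], by linarith [ht.2]⟩
  · refine ae_of_all _ fun t ht y hy => ?_
    rw [uIoc_of_le hxc.le] at ht
    obtain ⟨⟨hy1, hy2⟩, hy3⟩ := hy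
    have hy0 : 0 < y := by linarith
    rw [Real.norm_eq_abs, abs_mul]
    refine mul_le_mul_of_nonneg_left ?_ (abs_nonneg _)
    have hle : x / 4 ≤ t - σ * y := by
      have := sub_abs_le_sub_mul (t := t) (y := y) hσ
      rw [abs_of_pos hy0] at this
      linarith [ht.1]
    have hD : (x / 4) ^ 2 ≤ (t - σ * y) ^ 2 + r y ^ 2 := by
      have := pow_le_pow_left₀ (by linarith) hle 2
      linarith [sq_nonneg (r y)]
    rw [abs_div, abs_mul, abs_of_nonneg hμ, abs_of_nonneg (Real.rpow_nonneg (by positivity) _)]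
    have hnum : |σ * (t - σ * y) - r y * deriv r y| ≤ 4 + r x := by
      have h1 : |σ * (t - σ * y)| ≤ t - σ * y := by
        rw [abs_mul, abs_of_nonneg (show 0 ≤ t - σ * y by linarith)]
        exact mul_le_of_le_one_left (by linarith) hσ
      have h2 : |r y * deriv r y| ≤ r y := by
        rw [abs_mul, abs_of_nonneg (hr0 y hy0)]
        exact mul_le_of_le_one_right (hr0 y hy0) (hr' y hy0)
      have h3 : -(σ * y) ≤ y := by
        have : -σ * y ≤ 1 * y := mul_le_mul_of_nonneg_right (by linarith [(abs_le.1 hσ).1]) hy0.le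
        linarith
      have := abs_sub (σ * (t - σ * y)) (r y * deriv r y)
      have hy4 : r y < r x + 1 := hy3
      linarith [ht.2]
    have := hr0 x hx
    gcongr
  · refine IntervalIntegrable.mul_const ?_ _
    refine ContinuousOn.intervalIntegrable ?_
    rw [uIcc_of_le hxc.le]
    exact ((continuousOn_weight μ γ).mono fun t ht =>
      ⟨by linarith [ht.1], by linarith [ht.2]⟩).abs
  · refine ae_of_all _ fun t ht y hy => ?_
    rw [uIoc_of_le hxc.le] at ht
    obtain ⟨⟨hy1, hy2⟩, -⟩ := hy
    have hy0 : 0 < y := by linarith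
    exact hasDerivAt_div_rpow hσ (by rw [abs_of_pos hy0]; linarith [ht.1]) (hrd y hy0)

/-- The rescaled `x`-derivative of `|t| ^ (μ - 1) / ((t - σ x) ^ 2 + r x ^ 2) ^ (μ / 2)`, where
`t = x s`, `r x = x v` and `q = v r'(x)`. -/
noncomputable def scaledKernel (σ μ v q s : ℝ) : ℝ :=
  s ^ (μ - 1) * (μ * (σ * (s - σ) - q) / ((s - σ) ^ 2 + v ^ 2) ^ (μ / 2 + 1))

theorem scale_sq_add_sq_rpow {σ x s v : ℝ} (p : ℝ) (hx : 0 < x) :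
    ((x * s - σ * x) ^ 2 + v ^ 2) ^ p = x ^ (2 * p) * ((s - σ) ^ 2 + (v / x) ^ 2) ^ p := by
  have h : (x * s - σ * x) ^ 2 + v ^ 2 = x ^ 2 * ((s - σ) ^ 2 + (v / x) ^ 2) := by
    field_simp
  rw [h, Real.mul_rpow (by positivity) (by positivity), Real.rpow_mul hx.le, Real.rpow_two]

theorem scale_integrand (σ μ γ v p : ℝ) {x s : ℝ} (hx : 0 < x) (hs : 0 < s) :
    x * |Real.log x| ^ γ * (x * (weight μ γ (x * s) * (μ * (σ * (x * s - σ * x) - v * p) /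
      ((x * s - σ * x) ^ 2 + v ^ 2) ^ (μ / 2 + 1)))) =
    (|Real.log x| / |Real.log (x * s)|) ^ γ * scaledKernel σ μ (v / x) (v / x * p) s := by
  have h1 : x ^ (2 * (μ / 2 + 1)) = x ^ μ * x ^ 2 := by
    rw [← Real.rpow_two, ← Real.rpow_add hx]; ring_nf
  have hxμ : x ^ μ ≠ 0 := (Real.rpow_pos_of_pos hx _).ne'
  rw [scale_sq_add_sq_rpow _ hx, h1, scaledKernel]
  calc _ = (x * |Real.log x| ^ γ * weight μ γ (x * s)) *
        (x * (μ * (σ * (x * s - σ * x) - v * p) /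
          (x ^ μ * x ^ 2 * ((s - σ) ^ 2 + (v / x) ^ 2) ^ (μ / 2 + 1)))) := by ring
    _ = _ := by
      rw [mul_weight_mul μ γ hx hs,
        show σ * (x * s - σ * x) - v * p = x * (σ * (s - σ) - v / x * p) by field_simp]
      generalize ((s - σ) ^ 2 + (v / x) ^ 2) ^ (μ / 2 + 1) = D
      generalize σ * (s - σ) - v / x * p = N
      field_simp

theorem tendsto_boundary_term {σ μ γ : ℝ} {r : ℝ → ℝ} (hσ : |σ| ≤ 1)
    (hr : Tendsto (fun x => r x / x) (nhdsWithin 0 (Ioi 0)) (nhds 0)) :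
    Tendsto (fun x => x * |Real.log x| ^ γ *
        (2 * (weight μ γ (2 * x) / ((2 * x - σ * x) ^ 2 + r x ^ 2) ^ (μ / 2))))
      (nhdsWithin 0 (Ioi 0)) (nhds ((2 / (2 - σ)) ^ μ)) := by
  have hσ2 : 0 < 2 - σ := by linarith [(abs_le.1 hσ).2]
  have h1 : Tendsto (fun x => 2 ^ μ * (|Real.log x| / |Real.log (x * 2)|) ^ γ /
      ((2 - σ) ^ 2 + (r x / x) ^ 2) ^ (μ / 2)) (nhdsWithin 0 (Ioi 0))
      (nhds (2 ^ μ * 1 ^ γ / ((2 - σ) ^ 2 + 0 ^ 2) ^ (μ / 2))) := by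
    refine (((tendsto_abs_log_div 2 two_pos).rpow_const (Or.inl one_ne_zero)).const_mul _).div
      (((hr.pow 2).const_add _).rpow_const (Or.inl (by positivity)))
      (Real.rpow_pos_of_pos (by positivity) _).ne'
  have h2 : (2 : ℝ) ^ μ * 1 ^ γ / ((2 - σ) ^ 2 + 0 ^ 2) ^ (μ / 2) = (2 / (2 - σ)) ^ μ := by
    rw [Real.one_rpow, mul_one, Real.div_rpow two_pos.le hσ2.le, zero_pow two_ne_zero, add_zero,
      ← Real.rpow_two, ← Real.rpow_mul hσ2.le, mul_div_cancel₀ μ two_ne_zero]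
  rw [← h2]
  refine h1.congr' ?_
  filter_upwards [self_mem_nhdsWithin] with x hx
  have hx : 0 < x := hx
  have hxμ : x ^ μ ≠ 0 := (Real.rpow_pos_of_pos hx _).ne'
  rw [mul_comm 2 x, scale_sq_add_sq_rpow _ hx, mul_div_cancel₀ μ two_ne_zero]
  have h3 := mul_weight_mul μ γ hx two_pos
  rw [Real.rpow_sub_one two_ne_zero] at h3
  generalize ((2 - σ) ^ 2 + (r x / x) ^ 2) ^ (μ / 2) = D
  calc _ = 2 * (x ^ μ * (2 ^ μ / 2 * (|Real.log x| / |Real.log (x * 2)|) ^ γ)) / (x ^ μ * D) := by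
        field_simp
    _ = _ := by rw [← h3]; ring

theorem abs_scaledKernel_le {σ μ v q s : ℝ} (hσ : |σ| ≤ 1) (hμ : 0 ≤ μ) (hq : |q| ≤ 1)
    (hs : 2 ≤ s) : |scaledKernel σ μ v q s| ≤ μ * 2 ^ (μ + 3) * s ^ (-2 : ℝ) := by
  have hs0 : 0 < s := by linarith
  have hσ1 := abs_le.1 hσ
  have h1 : s / 2 ≤ s - σ := by linarith
  have hD : (s / 2) ^ 2 ≤ (s - σ) ^ 2 + v ^ 2 := by
    have := pow_le_pow_left₀ (by linarith) h1 2
    linarith [sq_nonneg v]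
  have hN : |σ * (s - σ) - q| ≤ 2 * s := by
    have h2 : |σ * (s - σ)| ≤ s - σ := by
      rw [abs_mul, abs_of_nonneg (show 0 ≤ s - σ by linarith)]
      exact mul_le_of_le_one_left (by linarith) hσ
    linarith [abs_sub (σ * (s - σ)) q]
  rw [scaledKernel, abs_mul, abs_of_nonneg (Real.rpow_nonneg hs0.le _), abs_div, abs_mul,
    abs_of_nonneg hμ, abs_of_nonneg (Real.rpow_nonneg (by positivity) _)]
  calc _ ≤ s ^ (μ - 1) * (μ * (2 * s) / ((s / 2) ^ 2) ^ (μ / 2 + 1)) := by gcongr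
    _ = μ * 2 ^ (μ + 3) * s ^ (-2 : ℝ) := by
      have h3 : ((s / 2) ^ 2) ^ (μ / 2 + 1) = s ^ (μ + 2) / 2 ^ (μ + 2) := by
        rw [← Real.div_rpow hs0.le two_pos.le, ← Real.rpow_two, ← Real.rpow_mul (by positivity)]
        ring_nf
      have h4 : s ^ (μ - 1) * s = s ^ (-2 : ℝ) * s ^ (μ + 2) := by
        rw [← Real.rpow_add_one hs0.ne', ← Real.rpow_add hs0]
        ring_nf
      have h5 := (Real.rpow_pos_of_pos hs0 (μ + 2)).ne'
      rw [h3, show μ + 3 = (μ + 2) + 1 by ring, Real.rpow_add_one two_ne_zero]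
      calc _ = (s ^ (μ - 1) * s) * (μ * 2 * 2 ^ (μ + 2)) / s ^ (μ + 2) := by
            generalize s ^ (μ - 1) = A
            field_simp
        _ = _ := by
            rw [h4]
            generalize s ^ (-2 : ℝ) = A
            field_simp

theorem measurable_scaledKernel (σ μ v q : ℝ) : Measurable (scaledKernel σ μ v q) := by
  unfold scaledKernel
  fun_prop

theorem integral_scaledKernel {σ μ : ℝ} (hσ : |σ| ≤ 1) (hμ : 0 ≤ μ) :
    ∫ s in Ioi 2, scaledKernel σ μ 0 0 s = (2 / (2 - σ)) ^ μ - 1 := by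
  have hσ1 := abs_le.1 hσ
  have hint : IntegrableOn (scaledKernel σ μ 0 0) (Ioi 2) := by
    refine Integrable.mono' ((integrableOn_Ioi_rpow_of_lt (a := -2) (by norm_num)
      two_pos).const_mul (μ * 2 ^ (μ + 3))) (measurable_scaledKernel σ μ 0 0).aestronglyMeasurable ?_
    filter_upwards [ae_restrict_mem measurableSet_Ioi] with s hs
    exact abs_scaledKernel_le hσ hμ (by simp) (le_of_lt hs)
  have hlim : Tendsto (fun s : ℝ => -(s / (s - σ)) ^ μ) atTop (nhds (-1)) := by
    have h1 : Tendsto (fun s : ℝ => (1 - σ / s)⁻¹) atTop (nhds 1) := by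
      simpa using ((tendsto_const_nhds.div_atTop tendsto_id).const_sub 1).inv₀ (a := (1 - 0 : ℝ))
        (by norm_num)
    have h2 : Tendsto (fun s : ℝ => s / (s - σ)) atTop (nhds 1) := by
      refine h1.congr' ?_
      filter_upwards [eventually_gt_atTop 0] with s hs
      rw [one_sub_div hs.ne', inv_div]
    simpa using (h2.rpow_const (p := μ) (Or.inl one_ne_zero)).neg
  rw [integral_Ioi_of_hasDerivAt_of_tendsto' (fun s hs => ?_) hint hlim]
  · ring
  have hs2 : 2 ≤ s := hs
  have hs0 : 0 < s := by linarith
  have hA : 0 < s - σ := by linarith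
  have h1 : HasDerivAt (fun s => s / (s - σ)) ((1 * (s - σ) - s * 1) / (s - σ) ^ 2) s :=
    (hasDerivAt_id s).div ((hasDerivAt_id s).sub_const σ) hA.ne'
  refine (h1.rpow_const (p := μ) (Or.inl (div_pos hs0 hA).ne')).fun_neg.congr_deriv ?_
  have h2 : ((s - σ) ^ 2 + 0 ^ 2) ^ (μ / 2 + 1) = (s - σ) ^ (μ - 1) * (s - σ) ^ 3 := by
    rw [zero_pow two_ne_zero, add_zero, ← Real.rpow_two, ← Real.rpow_mul hA.le,
      ← Real.rpow_natCast (s - σ) 3, ← Real.rpow_add hA]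
    congr 1
    push_cast
    ring
  have hA' := (Real.rpow_pos_of_pos hA (μ - 1)).ne'
  rw [scaledKernel, h2, Real.div_rpow hs0.le hA.le]
  field_simp
  ring

theorem abs_log_div_rpow_le {c γ x s : ℝ} (hc0 : 0 < c) (hc1 : c < 1) (hγ : 0 < γ) (hx : 0 < x)
    (hs : 1 ≤ s) (hxs : x * s ≤ c) :
    (|Real.log x| / |Real.log (x * s)|) ^ γ ≤
      (1 + 2 * γ / (-Real.log c)) ^ γ * s ^ (1 / 2 : ℝ) := by
  have hs0 : 0 < s := by linarith
  have hd : 0 < -Real.log c := neg_pos.2 (Real.log_neg hc0 hc1)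
  have h1 : Real.log (x * s) ≤ Real.log c := Real.log_le_log (by positivity) hxs
  have h2 : Real.log (x * s) = Real.log x + Real.log s := Real.log_mul hx.ne' hs0.ne'
  have h3 : 0 ≤ Real.log s := Real.log_nonneg hs
  have h4 : |Real.log x| / |Real.log (x * s)| ≤ 1 + Real.log s / (-Real.log c) := by
    rw [abs_of_neg (show Real.log (x * s) < 0 by linarith),
      abs_of_neg (show Real.log x < 0 by linarith)]
    calc _ = 1 + Real.log s / (-Real.log (x * s)) := by
          rw [one_add_div (by linarith), h2]; congr 1; ring
      _ ≤ _ := by gcongr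
  have h5 : Real.log s ≤ s ^ (1 / (2 * γ)) / (1 / (2 * γ)) :=
    Real.log_le_rpow_div hs0.le (by positivity)
  have h6 : (1 : ℝ) ≤ s ^ (1 / (2 * γ)) := Real.one_le_rpow hs (by positivity)
  have h7 : 1 + Real.log s / (-Real.log c) ≤
      (1 + 2 * γ / (-Real.log c)) * s ^ (1 / (2 * γ)) := by
    calc _ ≤ s ^ (1 / (2 * γ)) + (s ^ (1 / (2 * γ)) / (1 / (2 * γ))) / (-Real.log c) := by gcongr
      _ = _ := by field_simp
  calc _ ≤ ((1 + 2 * γ / (-Real.log c)) * s ^ (1 / (2 * γ))) ^ γ :=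
        Real.rpow_le_rpow (by positivity) (h4.trans h7) hγ.le
    _ = _ := by
      rw [Real.mul_rpow (by positivity) (by positivity), ← Real.rpow_mul hs0.le]
      congr 2
      field_simp

theorem tendsto_integral_term {σ μ γ c : ℝ} {r r' : ℝ → ℝ} (hσ : |σ| ≤ 1) (hc0 : 0 < c)
    (hc1 : c < 1) (hγ : 0 < γ) (hμ : 0 ≤ μ) (hr' : ∀ y, 0 < y → |r' y| ≤ 1)
    (hr : Tendsto (fun x => r x / x) (nhdsWithin 0 (Ioi 0)) (nhds 0)) :
    Tendsto (fun x => x * |Real.log x| ^ γ *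
        ∫ t in (2 * x)..c, weight μ γ t * (μ * (σ * (t - σ * x) - r x * r' x) /
          ((t - σ * x) ^ 2 + r x ^ 2) ^ (μ / 2 + 1)))
      (nhdsWithin 0 (Ioi 0)) (nhds ((2 / (2 - σ)) ^ μ - 1)) := by
  have hq : Tendsto (fun x => r x / x * r' x) (nhdsWithin 0 (Ioi 0)) (nhds 0) := by
    refine squeeze_zero_norm' (a := fun x => ‖r x / x‖) ?_ (by simpa using hr.norm)
    filter_upwards [self_mem_nhdsWithin] with x hx
    rw [norm_mul]
    exact mul_le_of_le_one_right (norm_nonneg _) (hr' x hx)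
  set F : ℝ → ℝ → ℝ := fun x => (Ioc 2 (c / x)).indicator fun s =>
    (|Real.log x| / |Real.log (x * s)|) ^ γ * scaledKernel σ μ (r x / x) (r x / x * r' x) s with hF
  have key : Tendsto (fun x => ∫ s in Ioi 2, F x s) (nhdsWithin 0 (Ioi 0))
      (nhds (∫ s in Ioi 2, scaledKernel σ μ 0 0 s)) := by
    refine tendsto_integral_filter_of_dominated_convergence
      (fun s => (1 + 2 * γ / (-Real.log c)) ^ γ * (μ * 2 ^ (μ + 3)) * s ^ (-3 / 2 : ℝ)) ?_ ?_ ?_ ?_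
    · refine Eventually.of_forall fun x => Measurable.aestronglyMeasurable ?_
      refine Measurable.indicator ?_ measurableSet_Ioc
      have := measurable_scaledKernel σ μ (r x / x) (r x / x * r' x)
      fun_prop
    · have hq1 : ∀ᶠ x in nhdsWithin 0 (Ioi 0), |r x / x * r' x| < 1 := by
        have := hq.abs
        rw [abs_zero] at this
        exact this.eventually (Iio_mem_nhds one_pos)
      filter_upwards [self_mem_nhdsWithin, hq1] with x hx hqx
      have hx : 0 < x := hx
      filter_upwards [ae_restrict_mem measurableSet_Ioi] with s hs
      have hs : 2 < s := hs
      have hs0 : 0 < s := by linarith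
      have hd : 0 < -Real.log c := neg_pos.2 (Real.log_neg hc0 hc1)
      simp only [hF]
      by_cases hsc : s ∈ Ioc 2 (c / x)
      · rw [indicator_of_mem hsc, Real.norm_eq_abs, abs_mul,
          abs_of_nonneg (Real.rpow_nonneg (by positivity) _)]
        have hxs : x * s ≤ c := by
          rw [mul_comm]; exact (le_div_iff₀ hx).1 hsc.2
        calc _ ≤ ((1 + 2 * γ / (-Real.log c)) ^ γ * s ^ (1 / 2 : ℝ)) *
              (μ * 2 ^ (μ + 3) * s ^ (-2 : ℝ)) :=
              mul_le_mul (abs_log_div_rpow_le hc0 hc1 hγ hx (by linarith) hxs)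
                (abs_scaledKernel_le hσ hμ hqx.le hs.le) (abs_nonneg _) (by positivity)
          _ = _ := by
              rw [show (-3 / 2 : ℝ) = 1 / 2 + -2 by norm_num, Real.rpow_add hs0]
              ring
      · rw [indicator_of_notMem hsc, norm_zero]
        positivity
    · exact (integrableOn_Ioi_rpow_of_lt (by norm_num) two_pos).const_mul _
    · filter_upwards [ae_restrict_mem measurableSet_Ioi] with s hs
      have hs : 2 < s := hs
      have hs0 : 0 < s := by linarith
      have hA : 0 < s - σ := by linarith [(abs_le.1 hσ).2]
      have h1 : Tendsto (fun x => scaledKernel σ μ (r x / x) (r x / x * r' x) s)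
          (nhdsWithin 0 (Ioi 0)) (nhds (scaledKernel σ μ 0 0 s)) := by
        unfold scaledKernel
        exact (((hq.const_sub _).const_mul _).div (((hr.pow 2).const_add _).rpow_const
          (Or.inl (by positivity))) (Real.rpow_pos_of_pos (by positivity) _).ne').const_mul _
      have h2 := ((tendsto_abs_log_div s hs0).rpow_const (p := γ) (Or.inl one_ne_zero)).mul h1
      rw [Real.one_rpow, one_mul] at h2
      refine h2.congr' ?_
      filter_upwards [Ioo_mem_nhdsGT (div_pos hc0 hs0)] with x hx
      have hsc : s ∈ Ioc 2 (c / x) := by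
        refine ⟨hs, (le_div_iff₀ hx.1).2 ?_⟩
        have := (lt_div_iff₀ hs0).1 hx.2
        linarith
      simp only [hF, indicator_of_mem hsc]
  rw [integral_scaledKernel hσ hμ] at key
  refine key.congr' ?_
  filter_upwards [Ioo_mem_nhdsGT (half_pos hc0)] with x hx
  have hx0 := hx.1
  have h2 : 2 ≤ c / x := (le_div_iff₀ hx0).2 (by linarith [hx.2])
  have hsub := intervalIntegral.mul_integral_comp_mul_left (a := 2) (b := c / x) (c := x)
    (f := fun t => weight μ γ t * (μ * (σ * (t - σ * x) - r x * r' x) /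
          ((t - σ * x) ^ 2 + r x ^ 2) ^ (μ / 2 + 1)))
  rw [mul_div_cancel₀ c hx0.ne', mul_comm x 2] at hsub
  rw [← hsub, ← intervalIntegral.integral_const_mul, ← intervalIntegral.integral_const_mul,
    intervalIntegral.integral_of_le h2, hF, setIntegral_indicator measurableSet_Ioc,
    inter_eq_right.2 Ioc_subset_Ioi_self]
  refine setIntegral_congr_fun measurableSet_Ioc fun s hs => ?_
  exact (scale_integrand σ μ γ (r x) (r' x) hx0 (by linarith [hs.1])).symm

theorem setIntegral_Icc_diff_Icc_neg {f : ℝ → ℝ} {a c : ℝ} (ha : 0 < a) (hac : a ≤ c)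
    (h1 : IntervalIntegrable f volume a c)
    (h2 : IntervalIntegrable (fun t => f (-t)) volume a c) :
    ∫ t in Icc (-c) c \ Icc (-a) a, f t = (∫ t in a..c, f t) + ∫ t in a..c, f (-t) := by
  have hset : Icc (-c) c \ Icc (-a) a = Ioc a c ∪ Ico (-c) (-a) := by
    ext t
    simp only [Set.mem_sdiff, mem_Icc, mem_union, mem_Ioc, mem_Ico]
    grind
  have hdisj : Disjoint (Ioc a c) (Ico (-c) (-a)) := by
    rw [Set.disjoint_left]
    intro t ht ht'
    linarith [ht.1, ht'.2]
  have h3 : IntervalIntegrable f volume (-c) (-a) := by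
    have := ((IntervalIntegrable.iff_comp_neg (f := fun t => f (-t))).1 h2).symm
    simpa using this
  rw [hset, setIntegral_union hdisj measurableSet_Ico
    ((intervalIntegrable_iff_integrableOn_Ioc_of_le hac).1 h1)
    ((intervalIntegrable_iff_integrableOn_Ico_of_le (neg_le_neg hac)).1 h3),
    intervalIntegral.integral_comp_neg, intervalIntegral.integral_of_le hac,
    intervalIntegral.integral_of_le (neg_le_neg hac), integral_Ico_eq_integral_Ioc]

theorem tendsto_deriv_integral_weight {σ μ γ c : ℝ} {r : ℝ → ℝ} (hσ : |σ| ≤ 1) (hc0 : 0 < c)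
    (hc1 : c < 1) (hγ : 0 < γ) (hμ : 0 ≤ μ) (hr0 : ∀ y, 0 < y → 0 ≤ r y)
    (hrd : ∀ y, 0 < y → DifferentiableAt ℝ r y) (hr' : ∀ y, 0 < y → |deriv r y| ≤ 1)
    (hr : Tendsto (fun x => r x / x) (nhdsWithin 0 (Ioi 0)) (nhds 0)) :
    Tendsto (fun x => x * |Real.log x| ^ γ * deriv (fun y => ∫ t in (2 * y)..c,
        weight μ γ t / ((t - σ * y) ^ 2 + r y ^ 2) ^ (μ / 2)) x)
      (nhdsWithin 0 (Ioi 0)) (nhds (-1)) := by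
  have h := (tendsto_integral_term hσ hc0 hc1 hγ hμ hr' hr).sub
    (tendsto_boundary_term (μ := μ) (γ := γ) hσ hr)
  rw [sub_sub_cancel_left] at h
  refine h.congr' ?_
  filter_upwards [Ioo_mem_nhdsGT (half_pos hc0)] with x hx
  rw [(hasDerivAt_integral_weight hσ hc1 hμ hx.1 (by linarith [hx.2]) hr0 hrd hr').deriv, mul_sub]

/-- Lemma 7.1 (ii): if `r : (0,∞) → [0,∞)` is differentiable with `|r'(x)| ≤ 1`
and `r(x)/x → 0` as `x ↓ 0`, then there exists `ρ ∈ (-∞, 0)` with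
`lim_{x↓0} x |ln x|^γ (d/dx)[u₂(x, r(x))] = ρ`, where `u₂(x,s)` is the integral of
`|t|^μ h(t) / ((t-x)² + s²)^{μ/2}` over `[-c,c] \ [-2|x|, 2|x|]` with
`h(t) = |t|⁻¹ |ln|t||^{-γ}`. -/
theorem stmt9 (c γ μ : ℝ) (hc : c ∈ Ioo (0 : ℝ) 1) (hγ : 1 < γ) (hμ : 1 ≤ μ)
    (r : ℝ → ℝ)
    (hr0 : ∀ x : ℝ, 0 < x → 0 ≤ r x)
    (hrdiff : ∀ x : ℝ, 0 < x → DifferentiableAt ℝ r x)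
    (hr' : ∀ x : ℝ, 0 < x → |deriv r x| ≤ 1)
    (hrlim : Tendsto (fun x => r x / x) (nhdsWithin 0 (Ioi 0)) (nhds 0)) :
    ∃ ρ : ℝ, ρ < 0 ∧
      Tendsto
        (fun x : ℝ => x * (abs (Real.log x)) ^ γ *
          deriv (fun y =>
            ∫ t in Icc (-c) c \ Icc (-(2 * |y|)) (2 * |y|),
              |t| ^ μ * (|t|⁻¹ * (abs (Real.log |t|)) ^ (-γ)) /
                (((t - y) ^ 2 + (r y) ^ 2) ^ (μ / 2))) x)
        (nhdsWithin 0 (Ioi 0)) (nhds ρ) := by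
  have hone : |(1 : ℝ)| ≤ 1 := by simp
  have hneg : |(-1 : ℝ)| ≤ 1 := by simp
  have hμ0 : 0 ≤ μ := by linarith
  have hγ0 : 0 < γ := by linarith
  refine ⟨-1 + -1, by norm_num, ?_⟩
  refine ((tendsto_deriv_integral_weight hone hc.1 hc.2 hγ0 hμ0 hr0 hrdiff hr'
    hrlim).add (tendsto_deriv_integral_weight hneg hc.1 hc.2 hγ0 hμ0 hr0 hrdiff hr'
    hrlim)).congr' ?_
  filter_upwards [Ioo_mem_nhdsGT (half_pos hc.1)] with x hx
  have hd1 := hasDerivAt_integral_weight (γ := γ) hone hc.2 hμ0 hx.1 (by linarith [hx.2]) hr0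
    hrdiff hr'
  have hd2 := hasDerivAt_integral_weight (γ := γ) hneg hc.2 hμ0 hx.1 (by linarith [hx.2]) hr0
    hrdiff hr'
  rw [← mul_add, hd1.deriv, hd2.deriv]
  congr 1
  refine ((hd1.fun_add hd2).congr_of_eventuallyEq ?_).deriv.symm
  filter_upwards [Ioo_mem_nhds hx.1 hx.2] with y hy
  have hy2 : |y| < 2 * y := by
    rw [abs_of_pos hy.1]
    linarith [hy.1]
  have hyc : 2 * y ≤ c := by linarith [hy.2]
  have hneg_eq : ∀ t, |(-t)| ^ μ * (|(-t)|⁻¹ * (abs (Real.log |(-t)|)) ^ (-γ)) /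
      (((-t) - y) ^ 2 + (r y) ^ 2) ^ (μ / 2) =
      weight μ γ t / ((t - (-1) * y) ^ 2 + r y ^ 2) ^ (μ / 2) := by
    intro t
    rw [weight, abs_neg, show (-t - y) ^ 2 = (t - (-1) * y) ^ 2 by ring]
  have hpos_eq : ∀ t, |t| ^ μ * (|t|⁻¹ * (abs (Real.log |t|)) ^ (-γ)) /
      ((t - y) ^ 2 + (r y) ^ 2) ^ (μ / 2) =
      weight μ γ t / ((t - 1 * y) ^ 2 + r y ^ 2) ^ (μ / 2) := by
    intro t
    rw [weight, one_mul]
  have hint : ∀ σ : ℝ, |σ| ≤ 1 → IntervalIntegrable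
      (fun t => weight μ γ t / ((t - σ * y) ^ 2 + r y ^ 2) ^ (μ / 2)) volume (2 * y) c := by
    intro σ hσ
    refine ContinuousOn.intervalIntegrable ?_
    rw [uIcc_of_le hyc]
    exact continuousOn_weight_div μ (r y) hσ hc.2 hy2
  rw [abs_of_pos hy.1, setIntegral_Icc_diff_Icc_neg (by linarith [hy.1]) hyc]
  · simp only [hneg_eq, hpos_eq]
  · simpa only [hpos_eq] using hint 1 hone
  · simpa only [hneg_eq] using hint (-1) hneg
end

section
/- Let ρ : (0, 1/2] → (0,∞) be any function such that x₁/ρ(x₁) → ∞ as x₁ ↓ 0. Then u(x₁, ρ(x₁)) − [1 + 2x₁·ln(1/ρ(x₁))] → 0 as x₁ ↓ 0. -/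
open MeasureTheory Set Filter

lemma Real.arsinh_div_eq_log (a : ℝ) {r : ℝ} (hr : 0 < r) :
    Real.arsinh (a / r) = Real.log (a + √(a ^ 2 + r ^ 2)) - Real.log r := by
  have hpos : 0 < a + √(a ^ 2 + r ^ 2) := by
    have : |a| < √(a ^ 2 + r ^ 2) := by
      rw [← Real.sqrt_sq_eq_abs]
      exact Real.sqrt_lt_sqrt (sq_nonneg a) (by nlinarith)
    linarith [neg_abs_le a]
  have hsqrt : √(1 + (a / r) ^ 2) = √(a ^ 2 + r ^ 2) / r := by
    rw [show 1 + (a / r) ^ 2 = (a ^ 2 + r ^ 2) / r ^ 2 by field_simp; ring,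
      Real.sqrt_div' _ (sq_nonneg r), Real.sqrt_sq hr.le]
  rw [Real.arsinh, hsqrt, ← add_div, Real.log_div hpos.ne' hr.ne']

lemma hasDerivAt_lebesguePotential_primitive (x : ℝ) {r : ℝ} (hr : 0 < r) (t : ℝ) :
    HasDerivAt (fun t => √((t - x) ^ 2 + r ^ 2) + x * Real.arsinh ((t - x) / r))
      (t / √((t - x) ^ 2 + r ^ 2)) t := by
  have hpos : 0 < (t - x) ^ 2 + r ^ 2 := by positivity
  have hs : 0 < √((t - x) ^ 2 + r ^ 2) := Real.sqrt_pos.mpr hpos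
  have hsub : HasDerivAt (fun t => t - x) 1 t := (hasDerivAt_id t).sub_const x
  have hsqrt := ((hsub.pow 2).add_const (r ^ 2)).sqrt hpos.ne'
  have harsinh := ((hsub.div_const r).arsinh).const_mul x
  refine (hsqrt.add harsinh).congr_deriv ?_
  rw [show 1 + ((t - x) / r) ^ 2 = ((t - x) ^ 2 + r ^ 2) / r ^ 2 by field_simp; ring,
    Real.sqrt_div' _ (sq_nonneg r), Real.sqrt_sq hr.le]
  simp only [smul_eq_mul, Pi.pow_apply]
  field_simp
  push_cast
  ring

lemma integral_lebesguePotential (x : ℝ) {r : ℝ} (hr : 0 < r) :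
    ∫ t in (0 : ℝ)..1, t / √((t - x) ^ 2 + r ^ 2) =
      √((1 - x) ^ 2 + r ^ 2) - √(x ^ 2 + r ^ 2)
        + x * Real.log (1 - x + √((1 - x) ^ 2 + r ^ 2))
        + x * Real.log (x + √(x ^ 2 + r ^ 2)) + 2 * x * Real.log (1 / r) := by
  have hcont : Continuous fun t : ℝ => t / √((t - x) ^ 2 + r ^ 2) := by
    refine continuous_id.div (by fun_prop) fun t => ?_
    positivity
  rw [intervalIntegral.integral_eq_sub_of_hasDerivAt
    (fun t _ => hasDerivAt_lebesguePotential_primitive x hr t)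
    (hcont.intervalIntegrable 0 1)]
  rw [zero_sub, neg_div, Real.arsinh_neg, neg_sq, Real.arsinh_div_eq_log _ hr,
    Real.arsinh_div_eq_log _ hr, one_div, Real.log_inv]
  ring

/-- Let `ρ : (0,1/2] → (0,∞)` satisfy `x₁/ρ(x₁) → ∞` as `x₁ ↓ 0`. Then, for the
Lebesgue potential `u(x₁,r) = ∫_0^1 t/√((t-x₁)² + r²) dt`, one has
`u(x₁, ρ(x₁)) - (1 + 2 x₁ ln(1/ρ(x₁))) → 0` as `x₁ ↓ 0`. -/
theorem stmt13 (ρ : ℝ → ℝ) (hρ : ∀ x ∈ Ioc (0 : ℝ) (1 / 2), 0 < ρ x)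
    (hlim : Tendsto (fun x => x / ρ x) (nhdsWithin 0 (Ioi 0)) atTop) :
    Tendsto
      (fun x : ℝ =>
        (∫ t in (0 : ℝ)..1, t / Real.sqrt ((t - x) ^ 2 + (ρ x) ^ 2)) -
          (1 + 2 * x * Real.log (1 / ρ x)))
      (nhdsWithin 0 (Ioi 0)) (nhds 0) := by
  have hmem : ∀ᶠ x : ℝ in nhdsWithin 0 (Ioi 0), x ∈ Ioc (0 : ℝ) (1 / 2) :=
    Ioc_mem_nhdsGT (by norm_num)
  have hx : Tendsto (fun x : ℝ => x) (nhdsWithin 0 (Ioi 0)) (nhds 0) :=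
    tendsto_nhdsWithin_of_tendsto_nhds tendsto_id
  have hr : Tendsto ρ (nhdsWithin 0 (Ioi 0)) (nhds 0) := by
    refine squeeze_zero' (hmem.mono fun x h => (hρ x h).le) ?_ hx
    filter_upwards [hmem, hlim.eventually_ge_atTop 1] with x h h1
    exact (one_le_div (hρ x h)).mp h1
  have hfar : Tendsto (fun x => √((1 - x) ^ 2 + ρ x ^ 2)) (nhdsWithin 0 (Ioi 0)) (nhds 1) := by
    simpa using ((((hx.const_sub 1).pow 2).add (hr.pow 2)).sqrt)
  have hnear : Tendsto (fun x => √(x ^ 2 + ρ x ^ 2)) (nhdsWithin 0 (Ioi 0)) (nhds 0) := by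
    simpa using (((hx.pow 2).add (hr.pow 2)).sqrt)
  have hlogfar : Tendsto (fun x => x * Real.log (1 - x + √((1 - x) ^ 2 + ρ x ^ 2)))
      (nhdsWithin 0 (Ioi 0)) (nhds 0) := by
    simpa using hx.mul (((hx.const_sub 1).add hfar).log (by norm_num))
  have hlognear : Tendsto (fun x => x * Real.log (x + √(x ^ 2 + ρ x ^ 2)))
      (nhdsWithin 0 (Ioi 0)) (nhds 0) := by
    have hy : Tendsto (fun x => x + √(x ^ 2 + ρ x ^ 2)) (nhdsWithin 0 (Ioi 0)) (nhds 0) := by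
      simpa using hx.add hnear
    have hylog := (Real.continuous_mul_log.tendsto 0).comp hy
    rw [zero_mul] at hylog
    refine squeeze_zero_norm' ?_ (tendsto_zero_iff_norm_tendsto_zero.mp hylog)
    filter_upwards [hmem] with x h
    simp only [Function.comp_apply, norm_mul, Real.norm_eq_abs]
    gcongr
    · exact h.1.le
    · linarith [Real.sqrt_nonneg (x ^ 2 + ρ x ^ 2)]
  have hsum := (((hfar.sub hnear).add hlogfar).add hlognear).sub_const 1
  norm_num at hsum
  refine hsum.congr' ?_
  filter_upwards [hmem] with x h
  rw [integral_lebesguePotential x (hρ x h)]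
  ring
end

section
/- Fix ε ∈ (0,1) and define φ(x₁) = u(x₁, e^{−ε/x₁}) for x₁ > 0. Then lim_{x₁↓0} φ(x₁) = 1 + 2ε. -/
open MeasureTheory Set Filter

lemma Real.sqrt_one_add_div_sq (s : ℝ) {r : ℝ} (hr : 0 < r) :
    Real.sqrt (1 + (s / r) ^ 2) = Real.sqrt (s ^ 2 + r ^ 2) / r := by
  rw [eq_div_iff hr.ne', ← Real.sqrt_sq hr.le, ← Real.sqrt_mul (by positivity), Real.sqrt_sq hr.le]
  congr 1
  field_simp
  ring

/-- The Lebesgue potential has an explicit value off the axis. -/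
lemma integral_div_sqrt_sub_sq_add_sq (x : ℝ) {r : ℝ} (hr : 0 < r) (a b : ℝ) :
    ∫ t in a..b, t / Real.sqrt ((t - x) ^ 2 + r ^ 2) =
      (Real.sqrt ((b - x) ^ 2 + r ^ 2) + x * Real.arsinh ((b - x) / r)) -
      (Real.sqrt ((a - x) ^ 2 + r ^ 2) + x * Real.arsinh ((a - x) / r)) := by
  have hpos (t : ℝ) : 0 < (t - x) ^ 2 + r ^ 2 := by positivity
  have hne (t : ℝ) : Real.sqrt ((t - x) ^ 2 + r ^ 2) ≠ 0 := (Real.sqrt_pos.2 (hpos t)).ne'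
  refine intervalIntegral.integral_eq_sub_of_hasDerivAt
    (f := fun t => Real.sqrt ((t - x) ^ 2 + r ^ 2) + x * Real.arsinh ((t - x) / r)) ?_ ?_
  · intro t _
    have hlin : HasDerivAt (fun t : ℝ => t - x) 1 t := (hasDerivAt_id t).sub_const x
    have hsqrt := ((hlin.pow 2).add_const (r ^ 2)).sqrt (hpos t).ne'
    have harsinh := ((hlin.div_const r).arsinh).const_mul x
    refine (hsqrt.add harsinh).congr_deriv ?_
    have := hne t
    simp only [Real.sqrt_one_add_div_sq _ hr, smul_eq_mul, Pi.pow_apply]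
    field_simp
    norm_num
    ring
  · refine Continuous.intervalIntegrable ?_ a b
    exact continuous_id.div (by fun_prop) hne

lemma Real.arsinh_div_eq_log_sub_log {s r : ℝ} (hs : 0 < s) (hr : 0 < r) :
    Real.arsinh (s / r) = Real.log (s + Real.sqrt (s ^ 2 + r ^ 2)) - Real.log r := by
  rw [Real.arsinh, Real.sqrt_one_add_div_sq s hr, ← add_div, Real.log_div (by positivity) hr.ne']

/-- Fix `ε ∈ (0,1)` and let `φ(x₁) = u(x₁, e^{-ε/x₁})` for `x₁ > 0`, where
`u(x₁,r) = ∫_0^1 t/√((t-x₁)² + r²) dt` is the Lebesgue potential. Then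
`lim_{x₁ ↓ 0} φ(x₁) = 1 + 2ε`. -/
theorem stmt14 (ε : ℝ) (hε : ε ∈ Ioo (0 : ℝ) 1) :
    Tendsto
      (fun x : ℝ =>
        ∫ t in (0 : ℝ)..1, t / Real.sqrt ((t - x) ^ 2 + (Real.exp (-ε / x)) ^ 2))
      (nhdsWithin 0 (Ioi 0)) (nhds (1 + 2 * ε)) := by
  have hx : Tendsto (fun x : ℝ => x) (nhdsWithin 0 (Ioi 0)) (nhds 0) :=
    tendsto_id.mono_left nhdsWithin_le_nhds
  have hr : Tendsto (fun x : ℝ => Real.exp (-ε / x)) (nhdsWithin 0 (Ioi 0)) (nhds 0) := by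
    refine Real.tendsto_exp_atBot.comp ?_
    exact tendsto_inv_nhdsGT_zero.const_mul_atTop_of_neg (neg_neg_of_pos hε.1)
  have hone : Tendsto (fun x : ℝ => Real.sqrt ((1 - x) ^ 2 + (Real.exp (-ε / x)) ^ 2))
      (nhdsWithin 0 (Ioi 0)) (nhds 1) := by
    simpa using (((hx.const_sub 1).pow 2).add (hr.pow 2)).sqrt
  have hzero : Tendsto (fun x : ℝ => Real.sqrt (x ^ 2 + (Real.exp (-ε / x)) ^ 2))
      (nhdsWithin 0 (Ioi 0)) (nhds 0) := by
    simpa using ((hx.pow 2).add (hr.pow 2)).sqrt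
  have hlog_one : Tendsto
      (fun x : ℝ => x * Real.log (1 - x + Real.sqrt ((1 - x) ^ 2 + (Real.exp (-ε / x)) ^ 2)))
      (nhdsWithin 0 (Ioi 0)) (nhds 0) := by
    simpa using hx.mul (((hx.const_sub 1).add hone).log (by norm_num))
  have hlog_zero : Tendsto
      (fun x : ℝ => x * Real.log (x + Real.sqrt (x ^ 2 + (Real.exp (-ε / x)) ^ 2)))
      (nhdsWithin 0 (Ioi 0)) (nhds 0) := by
    have hlower : Tendsto (fun x : ℝ => x * Real.log x) (nhdsWithin 0 (Ioi 0)) (nhds 0) := by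
      simpa using Real.continuous_mul_log.continuousAt.tendsto.mono_left
        (nhdsWithin_le_nhds (a := (0 : ℝ)) (s := Ioi 0))
    have hsmall : ∀ᶠ x in nhdsWithin (0 : ℝ) (Ioi 0),
        x + Real.sqrt (x ^ 2 + (Real.exp (-ε / x)) ^ 2) < 1 :=
      (hx.add hzero).eventually_lt_const (by norm_num)
    refine tendsto_of_tendsto_of_tendsto_of_le_of_le' hlower tendsto_const_nhds ?_ ?_
    · filter_upwards [self_mem_nhdsWithin] with x (hx0 : 0 < x)
      have := Real.sqrt_nonneg (x ^ 2 + (Real.exp (-ε / x)) ^ 2)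
      gcongr
      linarith
    · filter_upwards [self_mem_nhdsWithin, hsmall] with x (hx0 : 0 < x) hx1
      exact mul_nonpos_of_nonneg_of_nonpos hx0.le (Real.log_nonpos (by positivity) hx1.le)
  have hlim := (((hone.sub hzero).add hlog_one).add hlog_zero).add_const (2 * ε)
  simp only [sub_zero, add_zero] at hlim
  refine hlim.congr' ?_
  filter_upwards [self_mem_nhdsWithin, hx.eventually_lt_const one_pos] with x (hx0 : 0 < x) hx1
  rw [integral_div_sqrt_sub_sq_add_sq x (Real.exp_pos _), zero_sub, neg_sq, neg_div _ x,
    Real.arsinh_neg, Real.arsinh_div_eq_log_sub_log (sub_pos.2 hx1) (Real.exp_pos _),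
    Real.arsinh_div_eq_log_sub_log hx0 (Real.exp_pos _), Real.log_exp]
  field_simp
  ring
end

section
/- Define U : ℝ³ → ℝ by U(x) = ∫_0^1 t/√((t−x₁)² + x₂² + x₃²) dt. Then U is twice continuously differentiable on the open set Ω = ℝ³ \ {(t,0,0) : t ∈ [0,1]} and is harmonic there: for every x ∈ Ω, ∂²U/∂x₁²(x) + ∂²U/∂x₂²(x) + ∂²U/∂x₃²(x) = 0. -/
open MeasureTheory Set Filter

section ParametricIntegral

open Topology

universe u

variable {E G : Type u} [NormedAddCommGroup E] [NormedAddCommGroup G]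
  {V : Set (E × ℝ)} {F : E × ℝ → G} {a b : ℝ} {x : E}

/-- The points `x` whose vertical segment over `[a, b]` lies in `V`. -/
def segmentBase (V : Set (E × ℝ)) (a b : ℝ) : Set E :=
  {x | ∀ t ∈ uIcc a b, (x, t) ∈ V}

lemma eventually_forall_uIcc_mem (hV : IsOpen V) (hx : x ∈ segmentBase V a b) :
    ∀ᶠ y in 𝓝 x, y ∈ segmentBase V a b := by
  obtain ⟨u, v, hu, -, hxu, hv, huv⟩ := generalized_tube_lemma (isCompact_singleton (x := x))
    (isCompact_uIcc (a := a) (b := b)) hV (by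
      rintro ⟨y, t⟩ ⟨rfl, ht⟩
      exact hx t ht)
  filter_upwards [hu.mem_nhds (hxu rfl)] with y hy t ht
  exact huv ⟨hy, hv ht⟩

lemma isOpen_segmentBase (hV : IsOpen V) : IsOpen (segmentBase V a b) :=
  isOpen_iff_mem_nhds.2 fun _ hx => eventually_forall_uIcc_mem hV hx

lemma ContinuousOn.continuousOn_slice (hF : ContinuousOn F V) (hx : x ∈ segmentBase V a b) :
    ContinuousOn (fun t => F (x, t)) (uIcc a b) :=
  hF.comp (by fun_prop) hx

lemma ContinuousOn.aestronglyMeasurable_slice (hF : ContinuousOn F V)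
    (hx : x ∈ segmentBase V a b) :
    AEStronglyMeasurable (fun t => F (x, t)) (volume.restrict (uIoc a b)) :=
  ((hF.continuousOn_slice hx).mono uIoc_subset_uIcc).aestronglyMeasurable measurableSet_uIoc

lemma ContinuousOn.exists_eventually_norm_slice_le (hV : IsOpen V) (hF : ContinuousOn F V)
    (hx : x ∈ segmentBase V a b) :
    ∃ C, ∀ᶠ y in 𝓝 x, ∀ t ∈ uIcc a b, ‖F (y, t)‖ ≤ C := by
  obtain ⟨C, hC⟩ := isCompact_uIcc.exists_bound_of_continuousOn (hF.continuousOn_slice hx)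
  have hW : IsOpen (V ∩ (fun p => ‖F p‖) ⁻¹' Iio (C + 1)) :=
    hF.norm.isOpen_inter_preimage hV isOpen_Iio
  refine ⟨C + 1, ?_⟩
  filter_upwards [eventually_forall_uIcc_mem (a := a) (b := b) hW fun t ht =>
    ⟨hx t ht, (hC t ht).trans_lt (lt_add_one C)⟩] with y hy t ht
  exact (hy t ht).2.le

lemma ContinuousOn.continuousOn_intervalIntegral [NormedSpace ℝ G] (hV : IsOpen V)
    (hF : ContinuousOn F V) :
    ContinuousOn (fun x => ∫ t in a..b, F (x, t)) (segmentBase V a b) := by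
  intro x hx
  obtain ⟨C, hC⟩ := hF.exists_eventually_norm_slice_le hV hx
  refine (intervalIntegral.continuousAt_of_dominated_interval (bound := fun _ => C) ?_ ?_
    intervalIntegrable_const ?_).continuousWithinAt
  · filter_upwards [eventually_forall_uIcc_mem hV hx] with y hy
    exact hF.aestronglyMeasurable_slice hy
  · filter_upwards [hC] with y hy
    exact Eventually.of_forall fun t ht => hy t (uIoc_subset_uIcc ht)
  · refine Eventually.of_forall fun t ht => ?_
    exact ContinuousAt.comp (f := fun y => (y, t))
      (hF.continuousAt (hV.mem_nhds (hx t (uIoc_subset_uIcc ht)))) (by fun_prop)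

variable [NormedSpace ℝ E] [NormedSpace ℝ G]

/-- The derivative of a function on `E × ℝ` in the direction of the first factor. -/
noncomputable def partialFDeriv (F : E × ℝ → G) (p : E × ℝ) : E →L[ℝ] G :=
  (fderiv ℝ F p).comp (ContinuousLinearMap.inl ℝ E ℝ)

lemma ContDiffOn.contDiffOn_partialFDeriv {n : WithTop ℕ∞} (hV : IsOpen V)
    (hF : ContDiffOn ℝ (n + 1) F V) :
    ContDiffOn ℝ n (partialFDeriv F) V :=
  (hF.fderiv_of_isOpen hV le_rfl).clm_comp contDiffOn_const

lemma ContDiffOn.hasFDerivAt_intervalIntegral (hV : IsOpen V) (hF : ContDiffOn ℝ 1 F V)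
    (hx : x ∈ segmentBase V a b) :
    HasFDerivAt (fun x => ∫ t in a..b, F (x, t)) (∫ t in a..b, partialFDeriv F (x, t)) x := by
  have hF' : ContinuousOn (partialFDeriv F) V :=
    (ContDiffOn.contDiffOn_partialFDeriv (n := 0) hV (by simpa using hF)).continuousOn
  obtain ⟨C, hC⟩ := hF'.exists_eventually_norm_slice_le hV hx
  refine intervalIntegral.hasFDerivAt_integral_of_dominated_of_fderiv_le (bound := fun _ => C)
    (F' := fun x t => partialFDeriv F (x, t))
    (hC.and (eventually_forall_uIcc_mem hV hx)) ?_
    (hF.continuousOn.continuousOn_slice hx).intervalIntegrable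
    (hF'.aestronglyMeasurable_slice hx) ?_ intervalIntegrable_const ?_
  · filter_upwards [eventually_forall_uIcc_mem hV hx] with y hy
    exact hF.continuousOn.aestronglyMeasurable_slice hy
  · exact Eventually.of_forall fun t ht y hy => hy.1 t (uIoc_subset_uIcc ht)
  · refine Eventually.of_forall fun t ht y hy => ?_
    have h := ((hF.contDiffAt (hV.mem_nhds (hy.2 t (uIoc_subset_uIcc ht)))).differentiableAt
      one_ne_zero).hasFDerivAt
    exact h.comp y (hasFDerivAt_prodMk_left y t)

lemma ContDiffOn.contDiffOn_intervalIntegral (hV : IsOpen V) {n : ℕ} (hF : ContDiffOn ℝ n F V) :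
    ContDiffOn ℝ n (fun x => ∫ t in a..b, F (x, t)) (segmentBase V a b) := by
  induction n generalizing G with
  | zero =>
    exact contDiffOn_zero.2 (hF.continuousOn.continuousOn_intervalIntegral hV)
  | succ n ih =>
    push_cast at hF ⊢
    have hd : ∀ x ∈ segmentBase V a b, HasFDerivAt (fun x => ∫ t in a..b, F (x, t))
        (∫ t in a..b, partialFDeriv F (x, t)) x := fun x hx =>
      (hF.of_le (by simp)).hasFDerivAt_intervalIntegral hV hx
    refine (contDiffOn_succ_iff_fderiv_of_isOpen (isOpen_segmentBase hV)).2
      ⟨fun x hx => (hd x hx).differentiableAt.differentiableWithinAt, by simp, ?_⟩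
    exact (ih (hF.contDiffOn_partialFDeriv hV)).congr fun x hx => (hd x hx).fderiv

lemma ContDiffOn.fderiv_intervalIntegral_apply (hV : IsOpen V) (hF : ContDiffOn ℝ 1 F V)
    (hx : x ∈ segmentBase V a b) (v : E) :
    fderiv ℝ (fun x => ∫ t in a..b, F (x, t)) x v = ∫ t in a..b, fderiv ℝ F (x, t) (v, 0) := by
  rw [(hF.hasFDerivAt_intervalIntegral hV hx).fderiv,
    ContinuousLinearMap.intervalIntegral_apply]
  · simp [partialFDeriv]
  · exact ((ContDiffOn.contDiffOn_partialFDeriv (n := 0) hV (by simpa using hF)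
      ).continuousOn.continuousOn_slice hx).intervalIntegrable

/-- Second directional derivatives may be taken under the integral sign. -/
lemma ContDiffOn.fderiv_fderiv_intervalIntegral_apply (hV : IsOpen V) (hF : ContDiffOn ℝ 2 F V)
    (hx : x ∈ segmentBase V a b) (v w : E) :
    fderiv ℝ (fun y => fderiv ℝ (fun x => ∫ t in a..b, F (x, t)) y v) x w =
      ∫ t in a..b, fderiv ℝ (fun p => fderiv ℝ F p (v, 0)) (x, t) (w, 0) := by
  have h : (fun y => fderiv ℝ (fun x => ∫ t in a..b, F (x, t)) y v) =ᶠ[𝓝 x]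
      fun y => ∫ t in a..b, fderiv ℝ F (y, t) (v, 0) := by
    filter_upwards [eventually_forall_uIcc_mem hV hx] with y hy
    exact (hF.of_le one_le_two).fderiv_intervalIntegral_apply hV hy v
  rw [h.fderiv_eq]
  exact ContDiffOn.fderiv_intervalIntegral_apply (F := fun p => fderiv ℝ F p (v, 0)) hV
    ((hF.fderiv_of_isOpen hV (by norm_num [one_add_one_eq_two])).clm_apply contDiffOn_const) hx w

end ParametricIntegral

section NewtonKernel

variable {P : Type*} [NormedAddCommGroup P] [NormedSpace ℝ P]

/-- The kernel `τ / |w|` for linear coordinates `τ` and `w = (w₀, w₁, w₂)`. -/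
noncomputable def weightedKernel (τ : P →L[ℝ] ℝ) (w : Fin 3 → P →L[ℝ] ℝ) (p : P) : ℝ :=
  τ p / √(∑ i, w i p ^ 2)

variable {τ : P →L[ℝ] ℝ} {w : Fin 3 → P →L[ℝ] ℝ} {p : P}

lemma sqrt_sum_sq_ne_zero (hp : ∑ i, w i p ^ 2 ≠ 0) : √(∑ i, w i p ^ 2) ≠ 0 :=
  (Real.sqrt_pos.2 (lt_of_le_of_ne (by positivity) hp.symm)).ne'

lemma hasFDerivAt_sqrt_sum_sq (hp : ∑ i, w i p ^ 2 ≠ 0) :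
    HasFDerivAt (fun p => √(∑ i, w i p ^ 2))
      ((√(∑ i, w i p ^ 2))⁻¹ • ∑ i, w i p • w i) p := by
  have h : HasFDerivAt (fun p => ∑ i, w i p ^ 2) (∑ i, (2 * w i p) • w i) p :=
    HasFDerivAt.fun_sum fun i _ => by simpa using (w i).hasFDerivAt.pow 2
  convert h.sqrt hp using 1
  ext v
  simp [mul_assoc, ← Finset.mul_sum]

lemma fderiv_weightedKernel_apply (hp : ∑ i, w i p ^ 2 ≠ 0) {v : P} (hτ : τ v = 0) :
    fderiv ℝ (weightedKernel τ w) p v =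
      -(τ p * (∑ i, w i p * w i v) / √(∑ i, w i p ^ 2) ^ 3) := by
  have hN := sqrt_sum_sq_ne_zero hp
  have h := τ.hasFDerivAt (x := p) |>.mul
    ((hasDerivAt_inv hN).comp_hasFDerivAt p (hasFDerivAt_sqrt_sum_sq hp))
  have heq : weightedKernel τ w = τ * ((fun y => y⁻¹) ∘ fun p => √(∑ i, w i p ^ 2)) :=
    funext fun q => div_eq_mul_inv _ _
  rw [heq, h.fderiv]
  simp [hτ]
  field_simp

lemma isOpen_setOf_sum_sq_ne_zero : IsOpen {p | ∑ i, w i p ^ 2 ≠ 0} :=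
  isOpen_ne_fun (by fun_prop) continuous_const

lemma contDiffOn_weightedKernel {n : WithTop ℕ∞} :
    ContDiffOn ℝ n (weightedKernel τ w) {p | ∑ i, w i p ^ 2 ≠ 0} := by
  refine τ.contDiff.contDiffOn.div (ContDiffOn.sqrt ?_ fun _ hp => hp) fun p hp => ?_
  · exact (ContDiff.sum fun i _ => (w i).contDiff.pow 2).contDiffOn
  · exact sqrt_sum_sq_ne_zero hp

lemma fderiv_fderiv_weightedKernel_apply (hp : ∑ i, w i p ^ 2 ≠ 0) {v : P} (hτ : τ v = 0)
    {i : Fin 3} (hw : ∀ j, w j v = if j = i then 1 else 0) :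
    fderiv ℝ (fun q => fderiv ℝ (weightedKernel τ w) q v) p v =
      -(τ p * (1 / √(∑ i, w i p ^ 2) ^ 3 - 3 * w i p ^ 2 / √(∑ i, w i p ^ 2) ^ 5)) := by
  have hN := sqrt_sum_sq_ne_zero hp
  have heq : (fun q => fderiv ℝ (weightedKernel τ w) q v) =ᶠ[nhds p]
      fun q => -(τ q * w i q * ((fun y : ℝ => (y ^ 3)⁻¹) ∘ fun q => √(∑ i, w i q ^ 2)) q) := by
    filter_upwards [isOpen_setOf_sum_sq_ne_zero.mem_nhds hp] with q hq
    rw [fderiv_weightedKernel_apply hq hτ]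
    simp [hw, div_eq_mul_inv]
  have h := ((τ.hasFDerivAt (x := p)).fun_mul (w i).hasFDerivAt).fun_mul
    (((hasDerivAt_pow 3 (√(∑ i, w i p ^ 2))).fun_inv (pow_ne_zero 3 hN)).comp_hasFDerivAt p
      (hasFDerivAt_sqrt_sum_sq hp)) |>.fun_neg
  rw [heq.fderiv_eq]
  rw [h.fderiv]
  simp [hτ, hw]
  field_simp
  ring

/-- The weighted kernel is harmonic in the `w` coordinates away from its singularity. -/
lemma sum_fderiv_fderiv_weightedKernel_eq_zero (hp : ∑ i, w i p ^ 2 ≠ 0) {v : Fin 3 → P}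
    (hτ : ∀ i, τ (v i) = 0) (hw : ∀ i j, w j (v i) = if j = i then 1 else 0) :
    ∑ i, fderiv ℝ (fun q => fderiv ℝ (weightedKernel τ w) q (v i)) p (v i) = 0 := by
  have hN := sqrt_sum_sq_ne_zero hp
  have hsq : √(∑ i, w i p ^ 2) ^ 2 = ∑ i, w i p ^ 2 := Real.sq_sqrt (by positivity)
  simp_rw [fun i => fderiv_fderiv_weightedKernel_apply hp (hτ i) (hw i)]
  rw [Finset.sum_neg_distrib, ← Finset.mul_sum, Finset.sum_sub_distrib, ← Finset.sum_div,
    ← Finset.sum_div, ← Finset.mul_sum, ← hsq]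
  simp only [Real.sqrt_sq (Real.sqrt_nonneg _)]
  simp
  right
  field_simp
  ring

end NewtonKernel

/-- The coordinates `(x₁ - t, x₂, x₃)` as linear functions of `(x, t)`. -/
noncomputable def relativeCoord (i : Fin 3) : EuclideanSpace ℝ (Fin 3) × ℝ →L[ℝ] ℝ :=
  (EuclideanSpace.proj i).comp (ContinuousLinearMap.fst ℝ _ ℝ) -
    (if i = 0 then ContinuousLinearMap.snd ℝ _ ℝ else 0)

lemma sum_relativeCoord_sq (x : EuclideanSpace ℝ (Fin 3)) (t : ℝ) :
    ∑ i, relativeCoord i (x, t) ^ 2 = (t - x 0) ^ 2 + x 1 ^ 2 + x 2 ^ 2 := by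
  simp [relativeCoord, Fin.sum_univ_three, sub_sq_comm]

lemma segmentBase_relativeCoord :
    segmentBase {p | ∑ i, relativeCoord i p ^ 2 ≠ 0} 0 1 =
      {x | ¬ (x 0 ∈ Icc (0 : ℝ) 1 ∧ x 1 = 0 ∧ x 2 = 0)} := by
  ext x
  simp only [segmentBase, mem_ofPred_eq, sum_relativeCoord_sq, uIcc_of_le zero_le_one]
  constructor
  · rintro h ⟨h0, h1, h2⟩
    exact h _ h0 (by simp [h1, h2])
  · intro h t ht h0
    have ht0 : t - x 0 = 0 := by nlinarith [sq_nonneg (t - x 0), sq_nonneg (x 1), sq_nonneg (x 2)]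
    have h1 : x 1 = 0 := by nlinarith [sq_nonneg (t - x 0), sq_nonneg (x 1), sq_nonneg (x 2)]
    have h2 : x 2 = 0 := by nlinarith [sq_nonneg (t - x 0), sq_nonneg (x 1), sq_nonneg (x 2)]
    exact h ⟨sub_eq_zero.1 ht0 ▸ ht, h1, h2⟩

/-- Define `U : ℝ³ → ℝ` by `U(x) = ∫_0^1 t/√((t-x₁)² + x₂² + x₃²) dt`. Then `U` is
twice continuously differentiable on `Ω = ℝ³ \ {(t,0,0) : t ∈ [0,1]}` and harmonic
there: `∂²U/∂x₁² + ∂²U/∂x₂² + ∂²U/∂x₃² = 0` on `Ω`. -/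
theorem stmt15
    (U : EuclideanSpace ℝ (Fin 3) → ℝ)
    (hU : ∀ x, U x =
      ∫ t in (0 : ℝ)..1, t / Real.sqrt ((t - x 0) ^ 2 + (x 1) ^ 2 + (x 2) ^ 2))
    (Ω : Set (EuclideanSpace ℝ (Fin 3)))
    (hΩ : Ω = {x | ¬ (x 0 ∈ Icc (0 : ℝ) 1 ∧ x 1 = 0 ∧ x 2 = 0)}) :
    ContDiffOn ℝ 2 U Ω ∧
      ∀ x ∈ Ω,
        (∑ i : Fin 3,
          fderiv ℝ (fun y => fderiv ℝ U y (EuclideanSpace.single i 1)) x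
            (EuclideanSpace.single i 1)) = 0 := by
  have hU' : U = fun x => ∫ t in (0 : ℝ)..1,
      weightedKernel (ContinuousLinearMap.snd ℝ _ ℝ) relativeCoord (x, t) := by
    funext x
    simp_rw [hU, weightedKernel, sum_relativeCoord_sq, ContinuousLinearMap.coe_snd']
  have hV : IsOpen {p | ∑ i, relativeCoord i p ^ 2 ≠ 0} := isOpen_setOf_sum_sq_ne_zero
  have hF : ContDiffOn ℝ 2
      (weightedKernel (ContinuousLinearMap.snd ℝ (EuclideanSpace ℝ (Fin 3)) ℝ) relativeCoord)
      {p | ∑ i, relativeCoord i p ^ 2 ≠ 0} := contDiffOn_weightedKernel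
  rw [← segmentBase_relativeCoord] at hΩ
  subst hU' hΩ
  refine ⟨ContDiffOn.contDiffOn_intervalIntegral hV (n := 2) hF, fun x hx => ?_⟩
  simp_rw [fun i : Fin 3 => hF.fderiv_fderiv_intervalIntegral_apply hV hx
    (EuclideanSpace.single i 1) (EuclideanSpace.single i 1)]
  rw [← intervalIntegral.integral_finsetSum]
  · refine intervalIntegral.integral_zero_ae (Eventually.of_forall fun t ht => ?_)
    refine sum_fderiv_fderiv_weightedKernel_eq_zero (hx t (uIoc_subset_uIcc ht))
      (v := fun i => (EuclideanSpace.single i 1, 0)) (fun i => rfl) fun i j => ?_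
    by_cases hj : j = 0 <;> simp [relativeCoord, hj]
  · intro i _
    have h1 : ContDiffOn ℝ 1 (fun p => fderiv ℝ (weightedKernel
        (ContinuousLinearMap.snd ℝ (EuclideanSpace ℝ (Fin 3)) ℝ) relativeCoord) p
          (EuclideanSpace.single i 1, 0)) {p | ∑ i, relativeCoord i p ^ 2 ≠ 0} :=
      (hF.fderiv_of_isOpen hV (by norm_num [one_add_one_eq_two])).clm_apply contDiffOn_const
    exact (((h1.continuousOn_fderiv_of_isOpen hV le_rfl).clm_apply
      continuousOn_const).continuousOn_slice hx).intervalIntegrable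
end

section
/- Let ε ∈ (0, 1/(d−2)) and take λ ≡ ε constant. Define v : ℝ^d → ℝ by v(x) = |x′|^{1−ε(d−2)}. Then for every x with x′ ≠ 0, Σ_{i,j=1}^d ã_ε^{ij}(x) ∂²v/∂x_i ∂x_j (x) = 0. -/
open MeasureTheory Set Filter

/-- The matrix `ã_λ(x)`: `ã^{11} = 1`, `ã^{1j} = ã^{j1} = 0` for `j ≥ 2`, and
`ã^{ij}(x) = λ(x) δ^{ij} + (1-λ(x)) x_i x_j / |x'|²` for `i,j ≥ 2`, where
`x = (x₁, x')` and `|x'|² = ∑_{k ≥ 2} x_k²`. (The index `0` plays the role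
of the first coordinate `x₁`.) -/
noncomputable def aTilde (d : ℕ) (lam : EuclideanSpace ℝ (Fin d) → ℝ)
    (x : EuclideanSpace ℝ (Fin d)) (i j : Fin d) : ℝ :=
  if (i : ℕ) = 0 ∨ (j : ℕ) = 0 then (if i = j then 1 else 0)
  else lam x * (if i = j then 1 else 0) +
    (1 - lam x) * x i * x j /
      (∑ k ∈ Finset.univ.filter (fun k : Fin d => (k : ℕ) ≠ 0), (x k) ^ 2)

lemma hasFDerivAt_sum_sq {ι : Type*} [Fintype ι] (T : Finset ι) (y : EuclideanSpace ℝ ι) :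
    HasFDerivAt (fun z : EuclideanSpace ℝ ι => ∑ k ∈ T, (z k) ^ 2)
      (∑ k ∈ T, (2 * y k) • (EuclideanSpace.proj k : EuclideanSpace ℝ ι →L[ℝ] ℝ)) y := by
  refine HasFDerivAt.fun_sum fun k _ => ?_
  have h : HasFDerivAt (fun z : EuclideanSpace ℝ ι => z k)
      (EuclideanSpace.proj k : EuclideanSpace ℝ ι →L[ℝ] ℝ) y :=
    (EuclideanSpace.proj k : EuclideanSpace ℝ ι →L[ℝ] ℝ).hasFDerivAt
  simpa using h.pow 2

lemma sum_smul_proj_single {ι : Type*} [DecidableEq ι] (T : Finset ι) (y : EuclideanSpace ℝ ι) (j : ι) :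
    (∑ k ∈ T, (2 * y k) • (EuclideanSpace.proj k : EuclideanSpace ℝ ι →L[ℝ] ℝ))
      (EuclideanSpace.single j 1) = if j ∈ T then 2 * y j else 0 := by
  simp [sum_apply]

lemma fderiv_sum_sq_rpow_single {ι : Type*} [Fintype ι] [DecidableEq ι] (T : Finset ι) (q : ℝ)
    {y : EuclideanSpace ℝ ι}
    (hy : 0 < ∑ k ∈ T, (y k) ^ 2) (j : ι) :
    fderiv ℝ (fun z : EuclideanSpace ℝ ι => (∑ k ∈ T, (z k) ^ 2) ^ q) y
      (EuclideanSpace.single j 1) =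
      q * (∑ k ∈ T, (y k) ^ 2) ^ (q - 1) * (if j ∈ T then 2 * y j else 0) := by
  rw [((hasFDerivAt_sum_sq T y).rpow_const (Or.inl hy.ne')).fderiv,
    smul_apply, sum_smul_proj_single, smul_eq_mul]

lemma fderiv_fderiv_sum_sq_rpow_single {ι : Type*} [Fintype ι] [DecidableEq ι]
    (T : Finset ι) (q : ℝ) {x : EuclideanSpace ℝ ι}
    (hx : 0 < ∑ k ∈ T, (x k) ^ 2) (i j : ι) :
    fderiv ℝ (fun y => fderiv ℝ (fun z : EuclideanSpace ℝ ι => (∑ k ∈ T, (z k) ^ 2) ^ q) y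
      (EuclideanSpace.single j 1)) x (EuclideanSpace.single i 1) =
      if i ∈ T ∧ j ∈ T then
        2 * q * (∑ k ∈ T, (x k) ^ 2) ^ (q - 1) *
          (2 * (q - 1) * (x i * x j) / (∑ k ∈ T, (x k) ^ 2) + if i = j then 1 else 0)
      else 0 := by
  have hev : (fun y => fderiv ℝ (fun z : EuclideanSpace ℝ ι => (∑ k ∈ T, (z k) ^ 2) ^ q) y
      (EuclideanSpace.single j 1)) =ᶠ[nhds x]
      fun y => q * (∑ k ∈ T, (y k) ^ 2) ^ (q - 1) * (if j ∈ T then 2 * y j else 0) := by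
    filter_upwards [(hasFDerivAt_sum_sq T x).continuousAt.eventually (lt_mem_nhds hx)] with y hy
    exact fderiv_sum_sq_rpow_single T q hy j
  rw [hev.fderiv_eq]
  by_cases hj : j ∈ T
  · have h1 := ((hasFDerivAt_sum_sq T x).rpow_const (p := q - 1) (Or.inl hx.ne')).const_mul q
    have h2 : HasFDerivAt (fun z : EuclideanSpace ℝ ι => 2 * z j)
        ((2 : ℝ) • (EuclideanSpace.proj j : EuclideanSpace ℝ ι →L[ℝ] ℝ)) x :=
      (EuclideanSpace.proj j : EuclideanSpace ℝ ι →L[ℝ] ℝ).hasFDerivAt.const_mul 2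
    have hp : (EuclideanSpace.proj j : EuclideanSpace ℝ ι →L[ℝ] ℝ) (EuclideanSpace.single i 1) =
        if i = j then 1 else 0 := by
      simp [eq_comm]
    simp only [hj, if_true, and_true]
    rw [(h1.fun_mul h2).fderiv]
    simp only [add_apply, smul_apply,
      sum_smul_proj_single, smul_eq_mul, hp]
    rw [Real.rpow_sub_one hx.ne' (q - 1)]
    by_cases hi : i ∈ T
    · simp only [hi, if_true]
      field_simp
      ring
    · have hij : i ≠ j := fun h => hi (h ▸ hj)
      simp [hi, hij]
  · simp [hj]

lemma sum_sum_radial_mul_radial {ι : Type*} [DecidableEq ι]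
    (T : Finset ι) (x : ι → ℝ) (a b c e : ℝ) :
    ∑ i ∈ T, ∑ j ∈ T, (a * (if i = j then 1 else 0) + b * (x i * x j)) *
        (c * (x i * x j) + e * (if i = j then 1 else 0)) =
      a * c * (∑ k ∈ T, x k ^ 2) + a * e * T.card +
        b * c * (∑ k ∈ T, x k ^ 2) ^ 2 + b * e * (∑ k ∈ T, x k ^ 2) := by
  have h : ∀ i ∈ T, ∑ j ∈ T, (a * (if i = j then 1 else 0) + b * (x i * x j)) *
        (c * (x i * x j) + e * (if i = j then 1 else 0)) =
      a * c * x i ^ 2 + a * e + b * c * (∑ k ∈ T, x k ^ 2) * x i ^ 2 + b * e * x i ^ 2 := by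
    intro i hi
    have h' : ∀ j ∈ T, (a * (if i = j then 1 else 0) + b * (x i * x j)) *
        (c * (x i * x j) + e * (if i = j then 1 else 0)) =
        (if i = j then a * c * x i ^ 2 + a * e + b * e * x i ^ 2 else 0) +
          b * c * x i ^ 2 * x j ^ 2 := by
      intro j _
      split_ifs with hij
      · subst hij; ring
      · ring
    rw [Finset.sum_congr rfl h', Finset.sum_add_distrib, Finset.sum_ite_eq, if_pos hi,
      ← Finset.mul_sum]
    ring
  rw [Finset.sum_congr rfl h]
  simp only [Finset.sum_add_distrib, ← Finset.mul_sum, Finset.sum_const, nsmul_eq_mul]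
  ring

/-- For `ε ∈ (0, 1/(d-2))`, `λ ≡ ε`, and `v(x) = |x'|^{1-ε(d-2)}`, for every
`x` with `x' ≠ 0` one has `∑_{i,j} ã_ε^{ij}(x) ∂²v/∂x_i∂x_j (x) = 0`. -/
theorem stmt17 (d : ℕ) (hd : 3 ≤ d)
    (ε : ℝ) (hε : 0 < ε) (hε' : ε < 1 / ((d : ℝ) - 2))
    (v : EuclideanSpace ℝ (Fin d) → ℝ)
    (hv : ∀ x : EuclideanSpace ℝ (Fin d), v x =
      (Real.sqrt (∑ k ∈ Finset.univ.filter (fun k : Fin d => (k : ℕ) ≠ 0), (x k) ^ 2)) ^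
        (1 - ε * ((d : ℝ) - 2)))
    (x : EuclideanSpace ℝ (Fin d))
    (hx : ∃ k : Fin d, (k : ℕ) ≠ 0 ∧ x k ≠ 0) :
    (∑ i : Fin d, ∑ j : Fin d, aTilde d (fun _ => ε) x i j *
        fderiv ℝ (fun y => fderiv ℝ v y (EuclideanSpace.single j 1)) x
          (EuclideanSpace.single i 1)) = 0 := by
  set T : Finset (Fin d) := Finset.univ.filter (fun k : Fin d => (k : ℕ) ≠ 0) with hT
  have hmem : ∀ k : Fin d, k ∈ T ↔ (k : ℕ) ≠ 0 := by simp [hT]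
  have hS : 0 < ∑ k ∈ T, (x k) ^ 2 := by
    obtain ⟨k, hk, hxk⟩ := hx
    exact Finset.sum_pos' (fun _ _ => sq_nonneg _) ⟨k, (hmem k).2 hk, by positivity⟩
  have hcard : (T.card : ℝ) = d - 1 := by
    have hTe : T = Finset.univ.erase (⟨0, by omega⟩ : Fin d) := by
      ext k
      simp [hT, Fin.ext_iff]
    rw [hTe, Finset.card_erase_of_mem (Finset.mem_univ _), Finset.card_univ, Fintype.card_fin,
      Nat.cast_sub (by omega), Nat.cast_one]
  obtain ⟨q, hq⟩ : ∃ q : ℝ, q = (1 - ε * ((d : ℝ) - 2)) / 2 := ⟨_, rfl⟩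
  have hvq : v = fun z => (∑ k ∈ T, (z k) ^ 2) ^ q := by
    funext z
    rw [hv, Real.sqrt_eq_rpow, ← Real.rpow_mul (Finset.sum_nonneg fun _ _ => sq_nonneg _), hq]
    congr 1
    ring
  subst hvq
  set S := ∑ k ∈ T, (x k) ^ 2 with hSdef
  have hterm : ∀ i j : Fin d, aTilde d (fun _ => ε) x i j *
      fderiv ℝ (fun y => fderiv ℝ (fun z : EuclideanSpace ℝ (Fin d) =>
        (∑ k ∈ T, (z k) ^ 2) ^ q) y (EuclideanSpace.single j 1)) x
          (EuclideanSpace.single i 1) =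
      if i ∈ T then if j ∈ T then
        (ε * (if i = j then 1 else 0) + ((1 - ε) / S) * (x i * x j)) *
          ((2 * q * S ^ (q - 1) * (2 * (q - 1)) / S) * (x i * x j) +
            (2 * q * S ^ (q - 1)) * (if i = j then 1 else 0)) else 0 else 0 := by
    intro i j
    rw [fderiv_fderiv_sum_sq_rpow_single T q hS]
    by_cases hi : i ∈ T
    · by_cases hj : j ∈ T
      · have hn : ¬ ((i : ℕ) = 0 ∨ (j : ℕ) = 0) :=
          not_or.2 ⟨(hmem i).1 hi, (hmem j).1 hj⟩
        simp only [aTilde, hn, hi, hj, and_self, if_true, if_false, ← hT, ← hSdef]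
        ring
      · simp [hj]
    · simp [hi]
  simp only [hterm]
  have hred : ∀ F : Fin d → Fin d → ℝ,
      (∑ i, ∑ j, if i ∈ T then if j ∈ T then F i j else 0 else 0) =
        ∑ i ∈ T, ∑ j ∈ T, F i j := by
    intro F
    rw [← Finset.sum_subset (Finset.subset_univ T) fun i _ hi => by simp [hi]]
    refine Finset.sum_congr rfl fun i hi => ?_
    simp [hi]
  rw [hred, sum_sum_radial_mul_radial, ← hSdef, hcard]
  have hd2 : ε * d = 1 - 2 * q + 2 * ε := by rw [hq]; ring
  field_simp
  linear_combination 2 * q * S ^ (q - 1) * hd2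
end

section
/- Let λ : ℝ^d → ℝ satisfy λ(x) ≥ 1 for all x, and define w : ℝ^d \ {0} → ℝ by w(x) = |x|^{−(d−2)}. Then for every x with x′ ≠ 0, Σ_{i,j=1}^d ã_λ^{ij}(x) ∂²w/∂x_i ∂x_j (x) = (λ(x)−1)(d−2)·(1/|x′|)·∂/∂r[(x₁²+r²)^{−(d−2)/2}]|_{r=|x′|} ≤ 0. -/
open MeasureTheory Set Filter

/-- Gradient of `‖y‖ ^ (2 * q)` away from the origin. -/
theorem hasFDerivAt_norm_sq_rpow {E : Type*} [NormedAddCommGroup E] [InnerProductSpace ℝ E]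
    (q : ℝ) {y : E} (hy : y ≠ 0) :
    HasFDerivAt (fun z : E => (‖z‖ ^ 2) ^ q)
      ((q * (‖y‖ ^ 2) ^ (q - 1)) • (2 • innerSL ℝ y)) y := by
  have h := (hasStrictFDerivAt_norm_sq y).hasFDerivAt
  exact h.rpow_const (Or.inl (by positivity))

/-- Second partial derivatives of a function that equals `(‖y‖ ^ 2) ^ q` away from the origin. -/
theorem fderiv_fderiv_norm_sq_rpow {d : ℕ} (q : ℝ) {w : EuclideanSpace ℝ (Fin d) → ℝ}
    (hw : ∀ y, y ≠ 0 → w y = (‖y‖ ^ 2) ^ q) {x : EuclideanSpace ℝ (Fin d)} (hx : x ≠ 0)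
    (i j : Fin d) :
    fderiv ℝ (fun y => fderiv ℝ w y (EuclideanSpace.single j 1)) x (EuclideanSpace.single i 1)
      = 4 * q * (q - 1) * (‖x‖ ^ 2) ^ (q - 1 - 1) * (x i * x j)
        + 2 * q * (‖x‖ ^ 2) ^ (q - 1) * (if i = j then 1 else 0) := by
  have hne : ∀ y : EuclideanSpace ℝ (Fin d), y ≠ 0 → ∀ᶠ z in nhds y, z ≠ 0 :=
    fun y hy => isOpen_ne.mem_nhds hy
  have h1 : (fun y => fderiv ℝ w y (EuclideanSpace.single j 1))
      =ᶠ[nhds x] fun y => (2 * q) * ((‖y‖ ^ 2) ^ (q - 1) * y j) := by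
    filter_upwards [hne x hx] with y hy
    have h : w =ᶠ[nhds y] fun z => (‖z‖ ^ 2) ^ q := by
      filter_upwards [hne y hy] with z hz using hw z hz
    rw [h.fderiv_eq, (hasFDerivAt_norm_sq_rpow q hy).fderiv]
    simp [EuclideanSpace.inner_single_right]
    ring
  have h2 : HasFDerivAt (fun y : EuclideanSpace ℝ (Fin d) => y j)
      (EuclideanSpace.proj j : EuclideanSpace ℝ (Fin d) →L[ℝ] ℝ) x :=
    (EuclideanSpace.proj j : EuclideanSpace ℝ (Fin d) →L[ℝ] ℝ).hasFDerivAt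
  have h3 := ((hasFDerivAt_norm_sq_rpow (q - 1) hx).mul h2).const_mul (2 * q)
  refine (congrArg (fun L => L (EuclideanSpace.single i 1)) (h1.fderiv_eq.trans h3.fderiv)).trans ?_
  simp [EuclideanSpace.inner_single_right, eq_comm (a := j)]
  ring

/-- The trace of `ã_λ(x)` and its quadratic form at `x`. -/
theorem aTilde_trace_and_quadForm {n : ℕ} (lam : EuclideanSpace ℝ (Fin (n + 1)) → ℝ)
    (x : EuclideanSpace ℝ (Fin (n + 1))) (hT : ∑ k : Fin n, x k.succ ^ 2 ≠ 0) :
    (∑ i, ∑ j, aTilde (n + 1) lam x i j * (if i = j then 1 else 0)) = 2 + lam x * (n - 1) ∧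
    (∑ i, ∑ j, aTilde (n + 1) lam x i j * (x i * x j)) = ‖x‖ ^ 2 := by
  have hF : ∑ k ∈ Finset.univ.filter (fun k : Fin (n + 1) => (k : ℕ) ≠ 0), (x k) ^ 2
      = ∑ k : Fin n, x k.succ ^ 2 := by
    simp [Finset.sum_filter, Fin.sum_univ_succ]
  have h00 : aTilde (n + 1) lam x 0 0 = 1 := by simp [aTilde]
  have h0s : ∀ j : Fin n, aTilde (n + 1) lam x 0 j.succ = 0 := fun j => by
    simp [aTilde, (Fin.succ_ne_zero j).symm]
  have hs0 : ∀ j : Fin n, aTilde (n + 1) lam x j.succ 0 = 0 := fun j => by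
    simp [aTilde, Fin.succ_ne_zero j]
  have hss : ∀ i j : Fin n, aTilde (n + 1) lam x i.succ j.succ =
      lam x * (if i = j then 1 else 0)
        + (1 - lam x) / (∑ k : Fin n, x k.succ ^ 2) * (x i.succ * x j.succ) := fun i j => by
    unfold aTilde
    rw [hF]
    simp
    ring
  have hN : ‖x‖ ^ 2 = x 0 ^ 2 + ∑ k : Fin n, x k.succ ^ 2 := by
    simp [EuclideanSpace.norm_sq_eq, Fin.sum_univ_succ]
  rw [hN]
  generalize hTT : ∑ k : Fin n, x k.succ ^ 2 = T at *
  constructor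
  · simp only [Fin.sum_univ_succ, h00, h0s, hs0, hss]
    simp [Finset.sum_add_distrib, ← Finset.mul_sum, ← pow_two, hTT]
    field_simp
    ring
  · have hquad : ∑ i : Fin n, ∑ j : Fin n,
        (x i.succ * x j.succ) * (x i.succ * x j.succ) = T * T := by
      rw [← hTT, Finset.sum_mul_sum]
      exact Finset.sum_congr rfl fun i _ => Finset.sum_congr rfl fun j _ => by ring
    simp only [Fin.sum_univ_succ, h00, h0s, hs0, hss, add_mul, Finset.sum_add_distrib,
      mul_assoc _ (x _ * x _), ← Finset.mul_sum, hquad]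
    simp [← Finset.mul_sum, ← pow_two, hTT]
    field_simp
    ring

/-- If `λ(x) ≥ 1` everywhere and `w(x) = |x|^{-(d-2)}`, then for every `x` with
`x' ≠ 0`, writing `r = |x'|`,
`∑_{i,j} ã_λ^{ij}(x) ∂²w/∂x_i∂x_j (x)
  = (λ(x)-1)(d-2) (1/|x'|) ∂/∂ρ[(x₁²+ρ²)^{-(d-2)/2}]|_{ρ=|x'|} ≤ 0`. -/
theorem stmt18 (d : ℕ) (hd : 3 ≤ d)
    (lam : EuclideanSpace ℝ (Fin d) → ℝ) (hlam : ∀ x, 1 ≤ lam x)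
    (w : EuclideanSpace ℝ (Fin d) → ℝ)
    (hw : ∀ x : EuclideanSpace ℝ (Fin d), x ≠ 0 → w x = ‖x‖ ^ (-((d : ℝ) - 2)))
    (x : EuclideanSpace ℝ (Fin d))
    (hx : ∃ k : Fin d, (k : ℕ) ≠ 0 ∧ x k ≠ 0)
    (r : ℝ)
    (hr : r = Real.sqrt (∑ k ∈ Finset.univ.filter (fun k : Fin d => (k : ℕ) ≠ 0), (x k) ^ 2)) :
    (∑ i : Fin d, ∑ j : Fin d, aTilde d lam x i j *
        fderiv ℝ (fun y => fderiv ℝ w y (EuclideanSpace.single j 1)) x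
          (EuclideanSpace.single i 1))
      = (lam x - 1) * ((d : ℝ) - 2) * (1 / r) *
          deriv (fun s : ℝ => ((x ⟨0, by omega⟩) ^ 2 + s ^ 2) ^ (-(((d : ℝ) - 2) / 2))) r ∧
    (lam x - 1) * ((d : ℝ) - 2) * (1 / r) *
        deriv (fun s : ℝ => ((x ⟨0, by omega⟩) ^ 2 + s ^ 2) ^ (-(((d : ℝ) - 2) / 2))) r ≤ 0 := by
  obtain ⟨n, rfl⟩ : ∃ n, d = n + 1 := ⟨d - 1, by omega⟩
  have hF : ∑ k ∈ Finset.univ.filter (fun k : Fin (n + 1) => (k : ℕ) ≠ 0), (x k) ^ 2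
      = ∑ k : Fin n, x k.succ ^ 2 := by
    simp [Finset.sum_filter, Fin.sum_univ_succ]
  rw [hF] at hr
  have hTpos : 0 < ∑ k : Fin n, x k.succ ^ 2 := by
    rw [← hF]
    obtain ⟨k, hk, hxk⟩ := hx
    exact Finset.sum_pos' (fun _ _ => sq_nonneg _) ⟨k, by simpa using hk, by positivity⟩
  have hx0 : x ≠ 0 := by
    rintro rfl
    simp at hTpos
  have hrpos : 0 < r := hr ▸ Real.sqrt_pos.2 hTpos
  have hN : ‖x‖ ^ 2 = x 0 ^ 2 + r ^ 2 := by
    rw [hr, Real.sq_sqrt hTpos.le]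
    simp [EuclideanSpace.norm_sq_eq, Fin.sum_univ_succ]
  have hNpos : 0 < ‖x‖ ^ 2 := by positivity
  set q : ℝ := -((((n + 1 : ℕ) : ℝ) - 2) / 2) with hq
  have hnq : ((n + 1 : ℕ) : ℝ) - 2 = -2 * q := by rw [hq]; ring
  have hn : (n : ℝ) = 1 - 2 * q := by push_cast at hnq; linarith
  have hw' : ∀ y, y ≠ 0 → w y = (‖y‖ ^ 2) ^ q := fun y hy => by
    rw [hw y hy, ← Real.rpow_natCast, ← Real.rpow_mul (norm_nonneg y), hnq]
    congr 1
    push_cast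
    ring
  have hder : deriv (fun s : ℝ => ((x ⟨0, by omega⟩) ^ 2 + s ^ 2) ^ q) r
      = 2 * r * q * (‖x‖ ^ 2) ^ (q - 1) := by
    have h := (((hasDerivAt_pow 2 r).const_add (x 0 ^ 2)).rpow_const (p := q)
      (Or.inl (hN ▸ hNpos.ne')))
    rw [hN]
    refine (HasDerivAt.deriv h).trans ?_
    norm_num
  have hrhs : (lam x - 1) * (((n + 1 : ℕ) : ℝ) - 2) * (1 / r)
      * (2 * r * q * (‖x‖ ^ 2) ^ (q - 1)) = -((lam x - 1) * (2 * q) ^ 2 * (‖x‖ ^ 2) ^ (q - 1)) := by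
    rw [hnq]
    field_simp
  rw [hder, hrhs]
  refine ⟨?_, ?_⟩
  · obtain ⟨htr, hquad⟩ := aTilde_trace_and_quadForm lam x hTpos.ne'
    have hpow : (‖x‖ ^ 2) ^ (q - 1) = (‖x‖ ^ 2) ^ (q - 1 - 1) * ‖x‖ ^ 2 := by
      rw [Real.rpow_sub_one hNpos.ne' (q - 1)]
      field_simp
    have hlin : ∀ a b : ℝ, ∑ i, ∑ j, aTilde (n + 1) lam x i j *
        (a * (x i * x j) + b * (if i = j then 1 else 0)) = a * ‖x‖ ^ 2
          + b * (2 + lam x * (n - 1)) := fun a b => by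
      rw [← htr, ← hquad]
      simp only [Finset.mul_sum, ← Finset.sum_add_distrib]
      exact Finset.sum_congr rfl fun i _ => Finset.sum_congr rfl fun j _ => by ring
    simp only [fderiv_fderiv_norm_sq_rpow q hw' hx0, hlin]
    rw [hn, hpow]
    ring
  · have := sub_nonneg.2 (hlam x)
    exact neg_nonpos.2 (by positivity)
end
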